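/- Let Q be a hereditary graph class with Q̂ nonempty. Then there exists r ∈ {1,2,3,…} ∪ {∞} (with the convention 1/∞ = 0) such that: (a) sup_{W∈Q̂} Ent(W) = 1 - 1/r, and the supremum is attained; (b) a graphon W ∈ Q̂ satisfies Ent(W) = 1 - 1/r if and only if δ_□(W, W') = 0 for some W' ∈ R_r; and (c) for every ε > 0 there exists N such that for all n ≥ N, 2^{(1-1/r-ε)·C(n,2)} ≤ |Q_n| ≤ 2^{(1-1/r+ε)·C(n,2)}, where |Q_n| is the number of labelled graphs on {1,…,n} in Q and C(n,2) = n(n-1)/2. -/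

import Mathlib

open MeasureTheory Set Filter

noncomputable section

/-- A graphon: a symmetric measurable function `ℝ → ℝ → ℝ` with values in `[0,1]`
(only its values on `[0,1]²` matter). -/
def IsGraphon (W : ℝ → ℝ → ℝ) : Prop :=
  (∀ x y, W x y = W y x) ∧ Measurable (Function.uncurry W) ∧
    ∀ x y, W x y ∈ Set.Icc (0 : ℝ) 1

/-- The cut norm `‖U‖_□`, the supremum over measurable `S, T ⊆ [0,1]` of
`|∫_{S×T} U|`. -/
def cutNorm (U : ℝ → ℝ → ℝ) : ℝ :=
  sSup { r : ℝ | ∃ S T : Set ℝ, MeasurableSet S ∧ MeasurableSet T ∧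
    S ⊆ Set.Icc 0 1 ∧ T ⊆ Set.Icc 0 1 ∧
    r = |∫ p in S ×ˢ T, U p.1 p.2| }

/-- `d_□(W₁, W₂) = ‖W₁ - W₂‖_□`. -/
def dCut (W₁ W₂ : ℝ → ℝ → ℝ) : ℝ := cutNorm (fun x y => W₁ x y - W₂ x y)

/-- A Lebesgue-measure-preserving map `[0,1] → [0,1]`. -/
def IsMPSelf (σ : ℝ → ℝ) : Prop :=
  MeasureTheory.MeasurePreserving σ
      (MeasureTheory.volume.restrict (Set.Icc (0:ℝ) 1))
      (MeasureTheory.volume.restrict (Set.Icc (0:ℝ) 1)) ∧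
    Set.MapsTo σ (Set.Icc (0:ℝ) 1) (Set.Icc (0:ℝ) 1)

/-- The cut distance `δ_□(W₁, W₂)`. -/
def deltaCut (W₁ W₂ : ℝ → ℝ → ℝ) : ℝ :=
  sInf { r : ℝ | ∃ σ₁ σ₂ : ℝ → ℝ, IsMPSelf σ₁ ∧ IsMPSelf σ₂ ∧
    r = cutNorm (fun x y => W₁ (σ₁ x) (σ₁ y) - W₂ (σ₂ x) (σ₂ y)) }

/-- The binary entropy function `h` (base-2 logarithm; `logb 2 0 = 0` by convention,
so `h 0 = h 1 = 0`). -/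
def binEnt (x : ℝ) : ℝ := -x * Real.logb 2 x - (1 - x) * Real.logb 2 (1 - x)

/-- `h̃ x = h (min x (1/2))`. -/
def htilde (x : ℝ) : ℝ := binEnt (min x (1/2))

/-- The entropy `Ent(W) = ∫₀¹∫₀¹ h(W(x,y)) dx dy` of a graphon. -/
def graphonEnt (W : ℝ → ℝ → ℝ) : ℝ :=
  ∫ x in Set.Icc (0:ℝ) 1, ∫ y in Set.Icc (0:ℝ) 1, binEnt (W x y)

open Classical in
/-- The graphon `W_G` of a simple graph `G` on `{1, …, n}` (vertices as `Fin n`,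
vertex `i : Fin n` representing `i+1`): `W_G x y = 1` iff `⌈nx⌉⌈ny⌉ ∈ E(G)`. -/
def graphonOfGraph {n : ℕ} (G : SimpleGraph (Fin n)) : ℝ → ℝ → ℝ := fun x y =>
  if ∃ i j : Fin n, G.Adj i j ∧ ⌈(n : ℝ) * x⌉ = ((i : ℕ) : ℤ) + 1 ∧
      ⌈(n : ℝ) * y⌉ = ((j : ℕ) : ℤ) + 1
  then 1 else 0

/-- A labelled graph class: a set of graphs on `{1,…,n}` for each `n`. -/
abbrev GraphClass := ∀ n : ℕ, Set (SimpleGraph (Fin n))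

/-- A graph class is closed under relabelling by permutations. -/
def IsGraphClass (Q : GraphClass) : Prop :=
  ∀ (n : ℕ) (π : Equiv.Perm (Fin n)) (G : SimpleGraph (Fin n)),
    G ∈ Q n → G.comap ⇑π ∈ Q n

/-- A hereditary graph class: a graph class closed under taking induced subgraphs
(relabelled by the order-preserving bijection). -/
def IsHereditary (Q : GraphClass) : Prop :=
  IsGraphClass Q ∧
    ∀ (m n : ℕ) (f : Fin m → Fin n), StrictMono f →
      ∀ G ∈ Q n, G.comap f ∈ Q m

/-- `Q̂`: the set of graphons which are limits (in cut distance) of sequences of graphs in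
the class `Q` whose orders tend to infinity. -/
def limitSet (Q : GraphClass) : Set (ℝ → ℝ → ℝ) :=
  { W | IsGraphon W ∧
    ∃ (nk : ℕ → ℕ) (Gk : ∀ k, SimpleGraph (Fin (nk k))),
      (∀ k, Gk k ∈ Q (nk k)) ∧ Filter.Tendsto nk Filter.atTop Filter.atTop ∧
      Filter.Tendsto (fun k => deltaCut (graphonOfGraph (Gk k)) W) Filter.atTop (nhds 0) }

/-- `C(n,2) = n(n-1)/2` as a real number. -/
def choose2 (n : ℕ) : ℝ := (n : ℝ) * ((n : ℝ) - 1) / 2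

open Classical in
/-- The step function `E[W | P]` obtained by averaging `W` over the products of the
parts of the partition `P` of `[0,1]`. -/
def condExpPart {k : ℕ} (P : Fin k → Set ℝ) (W : ℝ → ℝ → ℝ) : ℝ → ℝ → ℝ := fun x y =>
  ∑ i : Fin k, ∑ j : Fin k,
    if x ∈ P i ∧ y ∈ P j then ⨍ p in (P i) ×ˢ (P j), W p.1 p.2 else 0

/-- `W̄_n`: the step function of `W` for the partition of `[0,1]` into `n` consecutive
intervals of length `1/n`. -/
def barStep (n : ℕ) (W : ℝ → ℝ → ℝ) : ℝ → ℝ → ℝ :=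
  condExpPart (fun i : Fin n => Set.Ioc (((i : ℕ) : ℝ)/n) ((((i : ℕ) : ℝ) + 1)/n)) W

/-- `N̂_□(n, δ; W)`: the number of graphs `G` on `{1,…,n}` with `d_□(W_G, W) ≤ δ`. -/
def NhatCut (n : ℕ) (δ : ℝ) (W : ℝ → ℝ → ℝ) : ℕ :=
  Nat.card {G : SimpleGraph (Fin n) // dCut (graphonOfGraph G) W ≤ δ}

/-- `N_□(n, δ; W)`: the number of graphs `G` on `{1,…,n}` with `δ_□(W_G, W) ≤ δ`. -/
def NCut (n : ℕ) (δ : ℝ) (W : ℝ → ℝ → ℝ) : ℕ :=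
  Nat.card {G : SimpleGraph (Fin n) // deltaCut (graphonOfGraph G) W ≤ δ}

open Classical in
/-- The induced density `p(F; W)` of a graph `F` on `{1,…,k}` in a graphon `W`. -/
def inducedDensity {k : ℕ} (F : SimpleGraph (Fin k)) (W : ℝ → ℝ → ℝ) : ℝ :=
  ∫ x : Fin k → ℝ in Set.univ.pi (fun _ : Fin k => Set.Icc (0:ℝ) 1),
    ∏ i : Fin k, ∏ j : Fin k,
      if i < j then (if F.Adj i j then W (x i) (x j) else 1 - W (x i) (x j)) else 1

open Classical in
/-- The randomness support graphon `1_{rand(W)}` of `W`. -/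
def randIndicator (W : ℝ → ℝ → ℝ) : ℝ → ℝ → ℝ := fun x y =>
  if 0 < W x y ∧ W x y < 1 then 1 else 0

/-- A kernel `U` is `K_r`-free if `∏_{i<j} U(x_i, x_j) = 0` for a.e. `x ∈ [0,1]^r`. -/
def KFree (r : ℕ) (U : ℝ → ℝ → ℝ) : Prop :=
  ∀ᵐ x ∂(MeasureTheory.volume.restrict (Set.univ.pi fun _ : Fin r => Set.Icc (0:ℝ) 1)),
    (∏ i : Fin r, ∏ j : Fin r, if i < j then U (x i) (x j) else 1) = 0

open Classical in
/-- The graphon `W^{(r,s)}`: equal to `1/2` off the diagonal blocks, `1` on the first `s`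
diagonal blocks `I_i × I_i`, and `0` on the remaining diagonal blocks. -/
def Wrs (r s : ℕ) : ℝ → ℝ → ℝ := fun x y =>
  if ∃ i j : Fin r, i ≠ j ∧ x ∈ Set.Ioc (((i:ℕ):ℝ)/r) ((((i:ℕ):ℝ)+1)/r) ∧
      y ∈ Set.Ioc (((j:ℕ):ℝ)/r) ((((j:ℕ):ℝ)+1)/r)
  then 1/2
  else if ∃ i : Fin r, (i:ℕ) < s ∧ x ∈ Set.Ioc (((i:ℕ):ℝ)/r) ((((i:ℕ):ℝ)+1)/r) ∧
      y ∈ Set.Ioc (((i:ℕ):ℝ)/r) ((((i:ℕ):ℝ)+1)/r)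
  then 1 else 0

/-- `E_r = ⋃_{i ≠ j} I_i × I_j` where `I_i`, `i = 1, …, r`, are the consecutive
intervals of length `1/r` in `[0,1]`. -/
def Er (r : ℕ) : Set (ℝ × ℝ) :=
  ⋃ (i : Fin r) (j : Fin r) (_ : i ≠ j),
    (Set.Ioc (((i:ℕ):ℝ)/r) ((((i:ℕ):ℝ)+1)/r)) ×ˢ (Set.Ioc (((j:ℕ):ℝ)/r) ((((j:ℕ):ℝ)+1)/r))

/-- `R_r`: the set of graphons equal to `1/2` on `E_r` and `{0,1}`-valued elsewhere
on `[0,1]²`. -/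
def Rset (r : ℕ) : Set (ℝ → ℝ → ℝ) :=
  { W | IsGraphon W ∧ (∀ p ∈ Er r, W p.1 p.2 = 1/2) ∧
      ∀ p ∈ ((Set.Icc (0:ℝ) 1) ×ˢ (Set.Icc (0:ℝ) 1)) \ Er r,
        W p.1 p.2 = 0 ∨ W p.1 p.2 = 1 }

/-- A graphon is random-free if it is `{0,1}`-valued a.e. on `[0,1]²`. -/
def IsRandomFree (W : ℝ → ℝ → ℝ) : Prop :=
  ∀ᵐ p ∂(MeasureTheory.volume.restrict ((Set.Icc (0:ℝ) 1) ×ˢ (Set.Icc (0:ℝ) 1))),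
    W (Prod.fst p) (Prod.snd p) = 0 ∨ W (Prod.fst p) (Prod.snd p) = 1


/-- `1 - 1/r` for `r ∈ {1, 2, …} ∪ {∞}` (with `1/∞ = 0`). -/
def oneSubInv (r : ℕ∞) : ℝ := WithTop.recTopCoe (1 : ℝ) (fun m : ℕ => 1 - 1 / (m : ℝ)) r

/-- `R_r` for `r ∈ {1, 2, …} ∪ {∞}`; `R_∞` consists of the constant graphon `1/2`. -/
def RsetE (r : ℕ∞) : Set (ℝ → ℝ → ℝ) :=
  WithTop.recTopCoe
    { W | IsGraphon W ∧ ∀ x ∈ Set.Icc (0:ℝ) 1, ∀ y ∈ Set.Icc (0:ℝ) 1, W x y = 1/2 }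
    (fun m : ℕ => Rset m) r


section PiLemmas
variable {Ω : Type*} [MeasurableSpace Ω] (μ : Measure Ω) [IsProbabilityMeasure μ]
variable {ι κ : Type*} [Fintype ι] [DecidableEq ι] [Fintype κ] [DecidableEq κ]

lemma mp_resample (i : ι) :
    MeasurePreserving (fun p : (ι → Ω) × Ω => Function.update p.1 i p.2)
      ((Measure.pi fun _ => μ).prod μ) (Measure.pi fun _ : ι => μ) := by
  have hm : Measurable (fun p : (ι → Ω) × Ω => Function.update p.1 i p.2) := by
    refine measurable_pi_iff.2 fun j => ?_
    by_cases h : j = i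
    · subst h; simpa using measurable_snd
    · simp only [Function.update_of_ne h]; exact (measurable_pi_apply j).comp measurable_fst
  refine ⟨hm, ?_⟩
  symm
  refine Measure.pi_eq fun s hs => ?_
  rw [Measure.map_apply hm (MeasurableSet.univ_pi hs)]
  have : (fun p : (ι → Ω) × Ω => Function.update p.1 i p.2) ⁻¹' (univ.pi s)
      = (univ.pi (Function.update s i univ)) ×ˢ (s i) := by
    ext ⟨x, y⟩
    simp only [mem_preimage, Set.mem_pi, mem_univ, true_imp_iff, mem_prod]
    constructor
    · intro h
      refine ⟨fun j => ?_, by simpa using h i⟩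
      by_cases hj : j = i
      · subst hj; simp
      · simpa [hj] using h j
    · rintro ⟨h1, h2⟩ j
      by_cases hj : j = i
      · subst hj; simpa using h2
      · simpa [hj] using h1 j
  rw [this, Measure.prod_prod, Measure.pi_pi, ← Finset.mul_prod_erase _ _ (Finset.mem_univ i),
    ← Finset.mul_prod_erase Finset.univ (fun j => μ (s j)) (Finset.mem_univ i)]
  simp only [Function.update_self, measure_univ, one_mul]
  rw [mul_comm]
  congr 1
  refine Finset.prod_congr rfl fun j hj => ?_
  rw [Function.update_of_ne (Finset.ne_of_mem_erase hj)]

lemma mp_comp (φ : κ → ι) (hφ : Function.Injective φ) :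
    MeasurePreserving (fun x : ι → Ω => fun k => x (φ k))
      (Measure.pi fun _ => μ) (Measure.pi fun _ : κ => μ) := by
  have hm : Measurable (fun x : ι → Ω => fun k => x (φ k)) :=
    measurable_pi_iff.2 fun j => measurable_pi_apply _
  refine ⟨hm, ?_⟩
  symm
  refine Measure.pi_eq fun s hs => ?_
  rw [Measure.map_apply hm (MeasurableSet.univ_pi hs)]
  have : (fun x : ι → Ω => fun k => x (φ k)) ⁻¹' (univ.pi s)
      = univ.pi (Function.extend φ s (fun _ => univ)) := by
    ext x
    simp only [mem_preimage, Set.mem_pi, mem_univ, true_imp_iff]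
    constructor
    · intro h j
      by_cases hj : ∃ k, φ k = j
      · obtain ⟨k, rfl⟩ := hj
        rw [hφ.extend_apply]; exact h k
      · rw [Function.extend_apply' _ _ _ hj]; trivial
    · intro h k
      have := h (φ k)
      rwa [hφ.extend_apply] at this
  rw [this, Measure.pi_pi]
  rw [← Finset.prod_subset (Finset.subset_univ (Finset.univ.image φ))]
  · rw [Finset.prod_image (fun a _ b _ h => hφ h)]
    refine Finset.prod_congr rfl fun k _ => ?_
    rw [hφ.extend_apply]
  · intro j _ hj
    rw [Function.extend_apply' _ _ _ (by simpa using hj)]; simp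

lemma mp_pair {i j : ι} (hij : i ≠ j) :
    MeasurePreserving (fun x : ι → Ω => (x i, x j))
      (Measure.pi fun _ => μ) (μ.prod μ) := by
  have hm : Measurable (fun x : ι → Ω => (x i, x j)) :=
    (measurable_pi_apply i).prodMk (measurable_pi_apply j)
  refine ⟨hm, ?_⟩
  symm
  refine Measure.prod_eq fun s t hs ht => ?_
  rw [Measure.map_apply hm (hs.prod ht)]
  have : (fun x : ι → Ω => (x i, x j)) ⁻¹' (s ×ˢ t) =
      univ.pi (fun l => if l = i then s else if l = j then t else univ) := by
    ext x
    simp only [mem_preimage, Set.mem_pi, mem_univ, true_imp_iff, mem_prod]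
    constructor
    · rintro ⟨h1, h2⟩ l
      split_ifs with a b
      · subst a; exact h1
      · subst b; exact h2
      · trivial
    · intro h
      have h1 := h i
      have h2 := h j
      rw [if_pos rfl] at h1
      rw [if_neg hij.symm, if_pos rfl] at h2
      exact ⟨h1, h2⟩
  rw [this, Measure.pi_pi, ← Finset.prod_subset (Finset.subset_univ {i, j}),
    Finset.prod_pair hij]
  · simp [hij.symm]
  · intro l _ hl
    simp at hl
    simp [hl]
end PiLemmas


section Counting
variable {Ω : Type*} [MeasurableSpace Ω] (μ : Measure Ω) [IsProbabilityMeasure μ]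
variable {ι κ : Type*} [Fintype ι] [DecidableEq ι] [Fintype κ] [DecidableEq κ]

lemma integrable_bdd {X : Type*} [MeasurableSpace X] {ν : Measure X} [IsFiniteMeasure ν]
    {f : X → ℝ} (hf : Measurable f) {C : ℝ} (h : ∀ x, |f x| ≤ C) : Integrable f ν :=
  Integrable.of_bound hf.aestronglyMeasurable C (Eventually.of_forall h)

/-- the cut norm of `D` on the probability space is at most `δ` -/
def CutLe (D : Ω → Ω → ℝ) (δ : ℝ) : Prop :=
  ∀ S T : Set Ω, MeasurableSet S → MeasurableSet T →
    |∫ p in S ×ˢ T, D p.1 p.2 ∂(μ.prod μ)| ≤ δ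

lemma cut_step (D : Ω → Ω → ℝ) (hD : Measurable (Function.uncurry D)) (hb : ∀ x y, |D x y| ≤ 1)
    (f g : Ω → ℝ) (hf : Measurable f) (hg : Measurable g) (hf1 : ∀ x, f x ∈ Icc (0:ℝ) 1)
    (hg1 : ∀ x, g x ∈ Icc (0:ℝ) 1) :
    ∃ S : Set Ω, MeasurableSet S ∧
      ∫ p, f p.1 * D p.1 p.2 * g p.2 ∂(μ.prod μ) ≤
        ∫ p, S.indicator 1 p.1 * D p.1 p.2 * g p.2 ∂(μ.prod μ) := by
  have hDg : Measurable (fun p : Ω × Ω => D p.1 p.2 * g p.2) :=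
    (hD : Measurable (fun p : Ω × Ω => D p.1 p.2)).mul (hg.comp measurable_snd)
  set F : Ω → ℝ := fun x => ∫ y, D x y * g y ∂μ with hF
  have hFm : Measurable F := (hDg.stronglyMeasurable.integral_prod_right).measurable
  have hbd : ∀ x y, |D x y * g y| ≤ 1 := fun x y => by
    rw [abs_mul]
    have := hb x y
    have h2 : |g y| ≤ 1 := abs_le.2 ⟨by linarith [(hg1 y).1], (hg1 y).2⟩
    nlinarith [abs_nonneg (D x y), abs_nonneg (g y)]
  have hFb : ∀ x, |F x| ≤ 1 := fun x => by
    have := norm_integral_le_of_norm_le_const (μ := μ) (f := fun y => D x y * g y) (C := 1)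
      (Eventually.of_forall (hbd x))
    simpa using this
  have key : ∀ k : Ω → ℝ, Measurable k → (∀ x, k x ∈ Icc (0:ℝ) 1) →
      ∫ p, k p.1 * D p.1 p.2 * g p.2 ∂(μ.prod μ) = ∫ x, k x * F x ∂μ := by
    intro k hk hk1
    rw [integral_prod]
    · congr 1; ext x
      rw [hF, ← integral_const_mul]
      simp only [mul_assoc]
    · refine integrable_bdd (C := 1) ?_ ?_
      · simp only [mul_assoc]; exact (hk.comp measurable_fst).mul hDg
      · intro p
        rw [mul_assoc, abs_mul]
        have h2 : |k p.1| ≤ 1 := abs_le.2 ⟨by linarith [(hk1 p.1).1], (hk1 p.1).2⟩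
        nlinarith [abs_nonneg (k p.1), abs_nonneg (D p.1 p.2 * g p.2), hbd p.1 p.2]
  have hS : MeasurableSet {x | 0 < F x} := measurableSet_lt measurable_const hFm
  refine ⟨{x | 0 < F x}, hS, ?_⟩
  have hi : ∀ x, ({x | 0 < F x} : Set Ω).indicator (1 : Ω → ℝ) x ∈ Icc (0:ℝ) 1 := by
    intro x; by_cases h : 0 < F x <;> simp [h]
  rw [key f hf hf1, key _ (measurable_one.indicator hS) hi]
  have hInteg : ∀ k : Ω → ℝ, Measurable k → (∀ x, k x ∈ Icc (0:ℝ) 1) →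
      Integrable (fun x => k x * F x) μ := by
    intro k hk hk1
    refine integrable_bdd (C := 1) (hk.mul hFm) fun x => ?_
    rw [abs_mul]
    have h2 : |k x| ≤ 1 := abs_le.2 ⟨by linarith [(hk1 x).1], (hk1 x).2⟩
    nlinarith [abs_nonneg (k x), abs_nonneg (F x), hFb x]
  refine integral_mono (hInteg f hf hf1) (hInteg _ (measurable_one.indicator hS) hi) fun x => ?_
  by_cases h : 0 < F x
  · simp only [mem_setOf_eq, h, indicator_of_mem, Pi.one_apply, one_mul]
    nlinarith [(hf1 x).2]
  · simp only [mem_setOf_eq, h, not_false_eq_true, indicator_of_notMem, zero_mul]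
    nlinarith [(hf1 x).1]

lemma cut_fun_le (D : Ω → Ω → ℝ) (hD : Measurable (Function.uncurry D))
    (hb : ∀ x y, |D x y| ≤ 1) {δ : ℝ}
    (hc : ∀ S T : Set Ω, MeasurableSet S → MeasurableSet T →
      ∫ p in S ×ˢ T, D p.1 p.2 ∂(μ.prod μ) ≤ δ)
    (f g : Ω → ℝ) (hf : Measurable f) (hg : Measurable g) (hf1 : ∀ x, f x ∈ Icc (0:ℝ) 1)
    (hg1 : ∀ x, g x ∈ Icc (0:ℝ) 1) :
    ∫ p, f p.1 * D p.1 p.2 * g p.2 ∂(μ.prod μ) ≤ δ := by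
  obtain ⟨S, hS, h1⟩ := cut_step μ D hD hb f g hf hg hf1 hg1
  have hi : ∀ x, S.indicator (1 : Ω → ℝ) x ∈ Icc (0:ℝ) 1 := by
    intro x; by_cases h : x ∈ S <;> simp [h]
  obtain ⟨T, hT, h2⟩ := cut_step μ (fun x y => D y x) (hD.comp measurable_swap)
    (fun x y => hb y x) g (S.indicator 1) hg (measurable_one.indicator hS) hg1 hi
  have e1 : ∫ p, S.indicator 1 p.1 * D p.1 p.2 * g p.2 ∂(μ.prod μ) =
      ∫ p, g p.1 * D p.2 p.1 * S.indicator 1 p.2 ∂(μ.prod μ) := by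
    rw [← integral_prod_swap]
    congr 1; ext p; simp only [Prod.fst_swap, Prod.snd_swap]; ring
  have e2 : ∫ p, T.indicator 1 p.1 * D p.2 p.1 * S.indicator 1 p.2 ∂(μ.prod μ) =
      ∫ p in S ×ˢ T, D p.1 p.2 ∂(μ.prod μ) := by
    rw [← integral_prod_swap, ← integral_indicator (hS.prod hT)]
    congr 1; ext ⟨x, y⟩
    by_cases hx : x ∈ S <;> by_cases hy : y ∈ T <;> simp [hx, hy]
  linarith [hc S T hS hT]

lemma cut_fun (D : Ω → Ω → ℝ) (hD : Measurable (Function.uncurry D))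
    (hb : ∀ x y, |D x y| ≤ 1) {δ : ℝ} (hc : CutLe μ D δ)
    (f g : Ω → ℝ) (hf : Measurable f) (hg : Measurable g) (hf1 : ∀ x, f x ∈ Icc (0:ℝ) 1)
    (hg1 : ∀ x, g x ∈ Icc (0:ℝ) 1) :
    |∫ p, f p.1 * D p.1 p.2 * g p.2 ∂(μ.prod μ)| ≤ δ := by
  rw [abs_le]
  constructor
  · have := cut_fun_le μ (fun x y => - D x y) hD.neg (by simpa using hb) (δ := δ)
      (fun S T hS hT => by
        rw [integral_neg]; exact (abs_le.1 (hc S T hS hT)).1 |> fun h => by linarith)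
      f g hf hg hf1 hg1
    simp only [mul_neg, neg_mul, integral_neg] at this
    linarith
  · exact cut_fun_le μ D hD hb (fun S T hS hT => (abs_le.1 (hc S T hS hT)).2) f g hf hg hf1 hg1

lemma prod_mem_Icc {α : Type*} (s : Finset α) (f : α → ℝ) (h : ∀ a ∈ s, f a ∈ Icc (0:ℝ) 1) :
    ∏ a ∈ s, f a ∈ Icc (0:ℝ) 1 :=
  ⟨Finset.prod_nonneg fun a ha => (h a ha).1,
    Finset.prod_le_one (fun a ha => (h a ha).1) fun a ha => (h a ha).2⟩

lemma measurable_pair_prod (E : Finset (ι × ι)) (C : ι × ι → Ω → Ω → ℝ)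
    (hC : ∀ e, Measurable (Function.uncurry (C e))) :
    Measurable (fun x : ι → Ω => ∏ e ∈ E, C e (x e.1) (x e.2)) :=
  Finset.measurable_prod _ fun e _ =>
    (hC e).comp (g := Function.uncurry (C e)) (f := fun x : ι → Ω => (x e.1, x e.2))
      ((measurable_pi_apply e.1).prodMk (measurable_pi_apply e.2))

lemma measurable_update_pt (i : ι) (x : ι → Ω) : Measurable (fun a : Ω => Function.update x i a) := by
  refine measurable_pi_iff.2 fun j => ?_
  by_cases h : j = i
  · subst h; simp only [Function.update_self]; exact measurable_id
  · simp only [Function.update_of_ne h]; exact measurable_const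

lemma swap_bound {i j : ι} (hij : i ≠ j) (D : Ω → Ω → ℝ) (hD : Measurable (Function.uncurry D))
    (hb : ∀ x y, |D x y| ≤ 1) {δ : ℝ} (hc : CutLe μ D δ) (E : Finset (ι × ι))
    (hE1 : (i, j) ∉ E) (hE2 : (j, i) ∉ E) (C : ι × ι → Ω → Ω → ℝ)
    (hC : ∀ e, Measurable (Function.uncurry (C e))) (hC1 : ∀ e x y, C e x y ∈ Icc (0:ℝ) 1) :
    |∫ x, D (x i) (x j) * ∏ e ∈ E, C e (x e.1) (x e.2) ∂(Measure.pi fun _ : ι => μ)| ≤ δ := by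
  have hprod := measurable_pair_prod E C hC
  set Φ : (ι → Ω) → ℝ := fun x => D (x i) (x j) * ∏ e ∈ E, C e (x e.1) (x e.2) with hΦ
  have hΦm : Measurable Φ :=
    (hD.comp (g := Function.uncurry D) (f := fun x : ι → Ω => (x i, x j))
      ((measurable_pi_apply i).prodMk (measurable_pi_apply j))).mul hprod
  have hΦb : ∀ x, |Φ x| ≤ 1 := fun x => by
    have h1 := prod_mem_Icc E (fun e => C e (x e.1) (x e.2)) (fun e _ => hC1 e _ _)
    rw [hΦ, abs_mul, abs_of_nonneg h1.1]
    nlinarith [hb (x i) (x j), abs_nonneg (D (x i) (x j)), h1.1, h1.2]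
  have mp := (mp_resample μ j).comp ((mp_resample μ i).prod (MeasurePreserving.id μ))
  have mp2 := mp.comp (measurePreserving_prodAssoc (Measure.pi fun _ : ι => μ) μ μ).symm
  rw [← mp2.map_eq, integral_map mp2.measurable.aemeasurable hΦm.aestronglyMeasurable,
    integral_prod]
  · have : ∀ x : ι → Ω, ‖∫ p : Ω × Ω, Φ (Function.update (Function.update x i p.1) j p.2)
        ∂(μ.prod μ)‖ ≤ δ := by
      intro x
      set f : Ω → ℝ := fun a => ∏ e ∈ E with (e.1 ≠ j ∧ e.2 ≠ j),
        C e (Function.update x i a e.1) (Function.update x i a e.2)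
      set g : Ω → ℝ := fun b => ∏ e ∈ E with ¬ (e.1 ≠ j ∧ e.2 ≠ j),
        C e (Function.update x j b e.1) (Function.update x j b e.2)
      have hf : Measurable f := (measurable_pair_prod _ C hC).comp (measurable_update_pt i x)
      have hg : Measurable g := (measurable_pair_prod _ C hC).comp (measurable_update_pt j x)
      have := cut_fun μ D hD hb hc f g hf hg (fun a => prod_mem_Icc _ _ fun e _ => hC1 e _ _)
        (fun a => prod_mem_Icc _ _ fun e _ => hC1 e _ _)
      rw [Real.norm_eq_abs]
      convert this using 3
      ext ⟨a, b⟩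
      simp only [hΦ, Function.update_self, Function.update_of_ne hij]
      rw [← Finset.prod_filter_mul_prod_filter_not E (fun e => e.1 ≠ j ∧ e.2 ≠ j)]
      have h1 : ∏ e ∈ E with (e.1 ≠ j ∧ e.2 ≠ j),
          C e (Function.update (Function.update x i a) j b e.1)
            (Function.update (Function.update x i a) j b e.2) = f a := by
        refine Finset.prod_congr rfl fun e he => ?_
        obtain ⟨_, h1, h2⟩ := Finset.mem_filter.1 he
        rw [Function.update_of_ne h1, Function.update_of_ne h2]
      have h2 : ∏ e ∈ E with ¬ (e.1 ≠ j ∧ e.2 ≠ j),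
          C e (Function.update (Function.update x i a) j b e.1)
            (Function.update (Function.update x i a) j b e.2) = g b := by
        refine Finset.prod_congr rfl fun e he => ?_
        obtain ⟨h0, h1⟩ := Finset.mem_filter.1 he
        obtain ⟨u, v⟩ := e
        have hu : u ≠ i := by
          intro hu
          have hv : v = j := by by_contra hv; exact h1 ⟨by rw [hu]; exact hij, hv⟩
          rw [hu, hv] at h0; exact hE1 h0
        have hv : v ≠ i := by
          intro hv
          have hu : u = j := by by_contra hu; exact h1 ⟨hu, by rw [hv]; exact hij⟩
          rw [hu, hv] at h0; exact hE2 h0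
        simp only [Function.update_comm hij, Function.update_of_ne hu, Function.update_of_ne hv]
      rw [h1, h2]; ring
    have h3 := norm_integral_le_of_norm_le_const (μ := Measure.pi fun _ : ι => μ)
      (Eventually.of_forall this)
    simp only [probReal_univ, mul_one] at h3
    exact h3
  · exact integrable_bdd (hΦm.comp mp2.measurable) (fun p => hΦb _)

/-- The counting lemma. -/
lemma counting (E : Finset (ι × ι)) (hE : ∀ e ∈ E, e.1 ≠ e.2 ∧ (e.2, e.1) ∉ E)
    (A B : ι × ι → Ω → Ω → ℝ) (hA : ∀ e, Measurable (Function.uncurry (A e)))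
    (hA1 : ∀ e x y, A e x y ∈ Icc (0:ℝ) 1) (hB : ∀ e, Measurable (Function.uncurry (B e)))
    (hB1 : ∀ e x y, B e x y ∈ Icc (0:ℝ) 1) {δ : ℝ}
    (hc : ∀ e, CutLe μ (fun x y => A e x y - B e x y) δ) :
    |∫ x, ∏ e ∈ E, A e (x e.1) (x e.2) ∂(Measure.pi fun _ : ι => μ) -
      ∫ x, ∏ e ∈ E, B e (x e.1) (x e.2) ∂(Measure.pi fun _ : ι => μ)| ≤ E.card * δ := by
  classical
  set M : Finset (ι × ι) → ι × ι → Ω → Ω → ℝ := fun S e => if e ∈ S then A e else B e with hM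
  have hMm : ∀ S e, Measurable (Function.uncurry (M S e)) := fun S e => by
    simp only [hM]; split_ifs <;> simp [hA, hB]
  have hM1 : ∀ S e x y, M S e x y ∈ Icc (0:ℝ) 1 := fun S e x y => by
    simp only [hM]; split_ifs <;> simp only [hA1, hB1]
  have key : ∀ S ⊆ E, |∫ x, ∏ e ∈ E, M S e (x e.1) (x e.2) ∂(Measure.pi fun _ : ι => μ) -
      ∫ x, ∏ e ∈ E, B e (x e.1) (x e.2) ∂(Measure.pi fun _ : ι => μ)| ≤ S.card * δ := by
    intro S
    induction S using Finset.induction_on with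
    | empty => intro _; simp [hM]
    | insert e S he ih =>
      intro hS
      have heE : e ∈ E := hS (Finset.mem_insert_self _ _)
      have ih := ih ((Finset.subset_insert _ _).trans hS)
      have hInteg : ∀ S, Integrable (fun x : ι → Ω => ∏ e ∈ E, M S e (x e.1) (x e.2))
          (Measure.pi fun _ : ι => μ) := fun S =>
        integrable_bdd (C := 1) (measurable_pair_prod E _ (hMm S)) fun x => by
          have := prod_mem_Icc E (fun e => M S e (x e.1) (x e.2)) (fun e _ => hM1 S e _ _)
          rw [abs_of_nonneg this.1]; exact this.2
      have hstep : |∫ x, ∏ e' ∈ E, M (insert e S) e' (x e'.1) (x e'.2)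
          ∂(Measure.pi fun _ : ι => μ) - ∫ x, ∏ e ∈ E, M S e (x e.1) (x e.2)
          ∂(Measure.pi fun _ : ι => μ)| ≤ δ := by
        rw [← integral_sub (hInteg _) (hInteg _)]
        have := swap_bound μ (hE e heE).1 (fun x y => A e x y - B e x y) ((hA e).sub (hB e))
          (fun x y => abs_le.2 ⟨by linarith [(hA1 e x y).1, (hB1 e x y).2],
            by linarith [(hA1 e x y).2, (hB1 e x y).1]⟩) (hc e) (E.erase e) (by simp)
          (fun h => (hE e heE).2 (Finset.mem_of_mem_erase h)) (M S) (hMm S) (hM1 S)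
        convert this using 3
        ext x
        rw [← Finset.mul_prod_erase E _ heE,
          ← Finset.mul_prod_erase E (fun e => M S e (x e.1) (x e.2)) heE]
        have h2 : ∏ e' ∈ E.erase e, M (insert e S) e' (x e'.1) (x e'.2) =
            ∏ e' ∈ E.erase e, M S e' (x e'.1) (x e'.2) := by
          refine Finset.prod_congr rfl fun e' he' => ?_
          simp [hM, Finset.ne_of_mem_erase he']
        rw [h2]
        simp only [hM, Finset.mem_insert_self, if_true, if_neg he]
        ring
      rw [Finset.card_insert_of_notMem he]
      push_cast
      have := abs_sub_le (∫ x, ∏ e' ∈ E, M (insert e S) e' (x e'.1) (x e'.2)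
          ∂(Measure.pi fun _ : ι => μ)) (∫ x, ∏ e ∈ E, M S e (x e.1) (x e.2)
          ∂(Measure.pi fun _ : ι => μ)) (∫ x, ∏ e ∈ E, B e (x e.1) (x e.2)
          ∂(Measure.pi fun _ : ι => μ))
      linarith
  have := key E subset_rfl
  have h3 : ∀ x : ι → Ω, ∏ e ∈ E, M E e (x e.1) (x e.2) = ∏ e ∈ E, A e (x e.1) (x e.2) :=
    fun x => Finset.prod_congr rfl fun e he => by simp [hM, he]
  simpa only [h3] using this
end Counting


section Blowup

lemma mp_cons {Ω : Type} [MeasurableSpace Ω] (μ : Measure Ω) [IsProbabilityMeasure μ] (r : ℕ) :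
    MeasurePreserving (fun p : (Fin r → Ω) × Ω => (Fin.cons p.2 p.1 : Fin (r+1) → Ω))
      ((Measure.pi fun _ => μ).prod μ) (Measure.pi fun _ => μ) := by
  have hm : Measurable (fun p : (Fin r → Ω) × Ω => (Fin.cons p.2 p.1 : Fin (r+1) → Ω)) := by
    refine measurable_pi_iff.2 fun j => ?_
    refine Fin.cases ?_ (fun i => ?_) j
    · simp only [Fin.cons_zero]; exact measurable_snd
    · simp only [Fin.cons_succ]; exact (measurable_pi_apply i).comp measurable_fst
  refine ⟨hm, ?_⟩
  symm
  refine Measure.pi_eq fun s hs => ?_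
  rw [Measure.map_apply hm (MeasurableSet.univ_pi hs)]
  have : (fun p : (Fin r → Ω) × Ω => (Fin.cons p.2 p.1 : Fin (r+1) → Ω)) ⁻¹' (univ.pi s)
      = (univ.pi (fun i => s (Fin.succ i))) ×ˢ (s 0) := by
    ext ⟨x, y⟩
    simp only [mem_preimage, Set.mem_pi, mem_univ, true_imp_iff, mem_prod]
    rw [Fin.forall_fin_succ]
    simp [and_comm]
  rw [this, Measure.prod_prod, Measure.pi_pi, Fin.prod_univ_succ, mul_comm]

lemma mp_consBlock {Ω : Type} [MeasurableSpace Ω] (μ : Measure Ω) [IsProbabilityMeasure μ]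
    (r m : ℕ) :
    MeasurePreserving (fun p : (Fin m → Ω) × (Fin r × Fin m → Ω) =>
      (fun v : Fin (r+1) × Fin m => (Fin.cons p.1 (fun i a => p.2 (i, a)) :
        Fin (r+1) → Fin m → Ω) v.1 v.2))
      ((Measure.pi fun _ => μ).prod (Measure.pi fun _ => μ)) (Measure.pi fun _ => μ) := by
  have hm : Measurable (fun p : (Fin m → Ω) × (Fin r × Fin m → Ω) =>
      (fun v : Fin (r+1) × Fin m => (Fin.cons p.1 (fun i a => p.2 (i, a)) :
        Fin (r+1) → Fin m → Ω) v.1 v.2)) := by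
    refine measurable_pi_iff.2 fun ⟨j, a⟩ => ?_
    refine Fin.cases ?_ (fun i => ?_) j
    · simp only [Fin.cons_zero]; exact (measurable_pi_apply a).comp measurable_fst
    · simp only [Fin.cons_succ]; exact (measurable_pi_apply (i, a)).comp measurable_snd
  refine ⟨hm, ?_⟩
  symm
  refine Measure.pi_eq fun s hs => ?_
  rw [Measure.map_apply hm (MeasurableSet.univ_pi hs)]
  have : (fun p : (Fin m → Ω) × (Fin r × Fin m → Ω) =>
      (fun v : Fin (r+1) × Fin m => (Fin.cons p.1 (fun i a => p.2 (i, a)) :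
        Fin (r+1) → Fin m → Ω) v.1 v.2)) ⁻¹' (univ.pi s)
      = (univ.pi (fun a => s (0, a))) ×ˢ (univ.pi (fun v : Fin r × Fin m => s (v.1.succ, v.2))) := by
    ext ⟨x, y⟩
    simp only [mem_preimage, Set.mem_pi, mem_univ, true_imp_iff, mem_prod]
    simp only [Prod.forall]
    rw [Fin.forall_fin_succ]
    simp
  rw [this, Measure.prod_prod, Measure.pi_pi, Measure.pi_pi, Fintype.prod_prod_type,
    Fintype.prod_prod_type, Fin.prod_univ_succ]

lemma jensen_pow {X : Type} [MeasurableSpace X] (ν : Measure X) [IsProbabilityMeasure ν]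
    (F : X → ℝ) (hF : Measurable F) (h1 : ∀ x, F x ∈ Icc (0:ℝ) 1) (m : ℕ) :
    (∫ x, F x ∂ν) ^ m ≤ ∫ x, F x ^ m ∂ν := by
  have hb : ∀ x, |F x| ≤ 1 := fun x => abs_le.2 ⟨by linarith [(h1 x).1], (h1 x).2⟩
  refine (convexOn_pow m).map_integral_le (continuous_pow m).continuousOn isClosed_Ici
    (Eventually.of_forall fun x => (h1 x).1) (integrable_bdd hF hb) ?_
  refine integrable_bdd (hF.pow_const m) (C := 1) fun x => ?_
  simp only [Function.comp]
  rw [abs_pow]; exact pow_le_one₀ (abs_nonneg _) (hb x)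

lemma blowup {Ω : Type} [MeasurableSpace Ω] (μ : Measure Ω) [IsProbabilityMeasure μ] (m r : ℕ) :
    ∀ {X : Type} [MeasurableSpace X] (ν : Measure X) [IsProbabilityMeasure ν]
    (f : X × (Fin r → Ω) → ℝ) (_ : Measurable f) (_ : ∀ p, f p ∈ Icc (0:ℝ) 1),
    (∫ p, f p ∂(ν.prod (Measure.pi fun _ => μ))) ^ (m ^ r) ≤
      ∫ q : X × (Fin r × Fin m → Ω), ∏ φ : Fin r → Fin m, f (q.1, fun i => q.2 (i, φ i))
        ∂(ν.prod (Measure.pi fun _ => μ)) := by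
  induction r with
  | zero =>
    intro X _ ν _ f hf hf1
    have mp := (MeasurePreserving.id ν).prod
      (mp_comp μ (ι := Fin 0 × Fin m) (κ := Fin 0) (fun i => i.elim0) (fun i => i.elim0))
    rw [pow_zero, pow_one, ← mp.map_eq,
      integral_map mp.measurable.aemeasurable hf.aestronglyMeasurable]
    refine le_of_eq (congrArg _ ?_)
    ext q
    rw [Fintype.prod_eq_single (fun i => i.elim0) (fun φ h => absurd (Subsingleton.elim _ _) h)]
    exact congrArg f (Prod.ext rfl (Subsingleton.elim _ _))
  | succ r ih =>
    intro X _ ν _ f hf hf1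
    have hcm : ∀ a : Fin m, Measurable (fun p : (X × (Fin m → Ω)) × (Fin r → Ω) =>
        ((p.1.1, Fin.cons (p.1.2 a) p.2) : X × (Fin (r+1) → Ω))) := fun a =>
      (measurable_fst.comp measurable_fst).prodMk ((mp_cons μ r).measurable.comp
        (measurable_snd.prodMk ((measurable_pi_apply a).comp (measurable_snd.comp measurable_fst))))
    set f' : (X × (Fin m → Ω)) × (Fin r → Ω) → ℝ :=
      fun p => ∏ a, f (p.1.1, Fin.cons (p.1.2 a) p.2) with hf'
    have hf'm : Measurable f' := Finset.measurable_prod _ fun a _ => hf.comp (hcm a)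
    have hf'1 : ∀ p, f' p ∈ Icc (0:ℝ) 1 := fun p => prod_mem_Icc _ _ fun a _ => hf1 _
    have IH := ih (ν.prod (Measure.pi fun _ : Fin m => μ)) f' hf'm hf'1
    -- left side
    have hL : (∫ p, f p ∂(ν.prod (Measure.pi fun _ => μ))) ^ m ≤
        ∫ p, f' p ∂((ν.prod (Measure.pi fun _ : Fin m => μ)).prod (Measure.pi fun _ => μ)) := by
      set F : X × (Fin r → Ω) → ℝ := fun p => ∫ y, f (p.1, Fin.cons y p.2) ∂μ with hF
      have mp1 := ((MeasurePreserving.id ν).prod (mp_cons μ r)).comp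
        (measurePreserving_prodAssoc ν (Measure.pi fun _ : Fin r => μ) μ)
      have hfm : Measurable (fun p : (X × (Fin r → Ω)) × Ω => f (p.1.1, Fin.cons p.2 p.1.2)) :=
        hf.comp mp1.measurable
      have hFm : Measurable F := hfm.stronglyMeasurable.integral_prod_right.measurable
      have hF1 : ∀ p, F p ∈ Icc (0:ℝ) 1 := fun p => by
        refine ⟨integral_nonneg fun y => (hf1 _).1, ?_⟩
        have := norm_integral_le_of_norm_le_const (μ := μ)
          (f := fun y => f (p.1, Fin.cons y p.2)) (C := 1) (Eventually.of_forall fun y => by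
            rw [Real.norm_eq_abs, abs_of_nonneg (hf1 _).1]; exact (hf1 _).2)
        simp only [probReal_univ, mul_one] at this
        exact (le_abs_self _).trans this
      have e1 : ∫ p, f p ∂(ν.prod (Measure.pi fun _ => μ)) =
          ∫ p, F p ∂(ν.prod (Measure.pi fun _ => μ)) := by
        rw [← mp1.map_eq, integral_map mp1.measurable.aemeasurable hf.aestronglyMeasurable,
          integral_prod]
        · rfl
        · exact integrable_bdd (C := 1) (hf.comp mp1.measurable) fun p => by
            rw [abs_of_nonneg (hf1 _).1]; exact (hf1 _).2
      have mp2 := ((measurePreserving_prodAssoc ν (Measure.pi fun _ : Fin m => μ)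
          (Measure.pi fun _ : Fin r => μ)).symm.comp ((MeasurePreserving.id ν).prod
            (Measure.measurePreserving_swap (μ := Measure.pi fun _ : Fin r => μ)
              (ν := Measure.pi fun _ : Fin m => μ)))).comp
          (measurePreserving_prodAssoc ν (Measure.pi fun _ : Fin r => μ)
          (Measure.pi fun _ : Fin m => μ))
      have e2 : ∫ p, f' p ∂((ν.prod (Measure.pi fun _ : Fin m => μ)).prod
          (Measure.pi fun _ => μ)) = ∫ p, F p ^ m ∂(ν.prod (Measure.pi fun _ => μ)) := by
        rw [← mp2.map_eq, integral_map mp2.measurable.aemeasurable hf'm.aestronglyMeasurable,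
          integral_prod]
        · congr 1; ext p
          rw [hF]
          have := integral_fintype_prod_eq_pow (μ := μ) (ι := Fin m) (fun y => f (p.1, Fin.cons y p.2))
          rw [Fintype.card_fin] at this
          exact this
        · exact integrable_bdd (C := 1) (hf'm.comp mp2.measurable) fun p => by
            rw [abs_of_nonneg (hf'1 _).1]; exact (hf'1 _).2
      rw [e1, e2]
      exact jensen_pow _ F hFm hF1 m
    have hR : ∫ q : X × (Fin (r+1) × Fin m → Ω), ∏ φ : Fin (r+1) → Fin m,
        f (q.1, fun i => q.2 (i, φ i)) ∂(ν.prod (Measure.pi fun _ => μ)) =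
        ∫ q : (X × (Fin m → Ω)) × (Fin r × Fin m → Ω), ∏ φ : Fin r → Fin m,
          f' (q.1, fun i => q.2 (i, φ i))
        ∂((ν.prod (Measure.pi fun _ => μ)).prod (Measure.pi fun _ => μ)) := by
      have mp3 := ((MeasurePreserving.id ν).prod (mp_consBlock μ r m)).comp
        (measurePreserving_prodAssoc ν (Measure.pi fun _ : Fin m => μ)
          (Measure.pi fun _ : Fin r × Fin m => μ))
      have hmm : Measurable (fun q : X × (Fin (r+1) × Fin m → Ω) => ∏ φ : Fin (r+1) → Fin m,
        f (q.1, fun i => q.2 (i, φ i))) := by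
        refine Finset.measurable_prod _ fun φ _ => hf.comp ?_
        refine measurable_fst.prodMk (measurable_pi_iff.2 fun i => ?_)
        exact (measurable_pi_apply (i, φ i)).comp measurable_snd
      rw [← mp3.map_eq, integral_map mp3.measurable.aemeasurable hmm.aestronglyMeasurable]
      congr 1; ext q
      rw [← Fintype.prod_equiv (Fin.consEquiv (fun _ : Fin (r+1) => Fin m)) _ _ (fun _ => rfl),
        Fintype.prod_prod_type, Finset.prod_comm]
      refine Finset.prod_congr rfl fun φ _ => ?_
      refine Finset.prod_congr rfl fun a _ => ?_
      congr 2
      ext i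
      refine Fin.cases ?_ (fun i => ?_) i
      · simp [Fin.consEquiv, MeasurableEquiv.prodAssoc]
      · simp [Fin.consEquiv, MeasurableEquiv.prodAssoc]
    rw [hR, pow_succ' m r, pow_mul]
    refine le_trans (pow_le_pow_left₀ ?_ hL _) IH
    exact pow_nonneg (integral_nonneg fun p => (hf1 p).1) _
end Blowup


lemma collision {Ω : Type} [MeasurableSpace Ω] (μ : Measure Ω) [IsProbabilityMeasure μ] {n : ℕ}
    (q : Ω → Fin n) (hq : Measurable q) {t : ℝ} (ht : 0 ≤ t)
    (h : ∀ v, μ.real (q ⁻¹' {v}) ≤ t) :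
    (μ.prod μ).real {p | q p.1 = q p.2} ≤ t := by
  have hm : MeasurableSet {p : Ω × Ω | q p.1 = q p.2} :=
    measurableSet_eq_fun (hq.comp measurable_fst) (hq.comp measurable_snd)
  rw [measureReal_def]
  refine ENNReal.toReal_le_of_le_ofReal ht ?_
  rw [Measure.prod_apply hm]
  calc ∫⁻ x, μ (Prod.mk x ⁻¹' {p : Ω × Ω | q p.1 = q p.2}) ∂μ
      ≤ ∫⁻ x, ENNReal.ofReal t ∂μ := by
        refine lintegral_mono fun x => ?_
        rw [← ofReal_measureReal (measure_ne_top _ _)]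
        refine ENNReal.ofReal_le_ofReal (le_trans (le_of_eq ?_) (h (q x)))
        congr 1
        ext y; simp [eq_comm]
    _ = ENNReal.ofReal t := by simp

lemma blowup_event {Ω : Type} [MeasurableSpace Ω] (μ : Measure Ω) [IsProbabilityMeasure μ]
    (m r : ℕ) (R : Set (Ω × Ω)) (hR : MeasurableSet R) :
    (Measure.pi fun _ : Fin r => μ).real {x | ∀ i j, i ≠ j → (x i, x j) ∈ R} ^ (m ^ r) ≤
    (Measure.pi fun _ : Fin r × Fin m => μ).real
      {x | ∀ u v, u.1 ≠ v.1 → (x u, x v) ∈ R} := by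
  classical
  set K : Set (Fin r → Ω) := {x | ∀ i j, i ≠ j → (x i, x j) ∈ R} with hK
  have hpm : ∀ {ι : Type} [Fintype ι] (u v : ι), MeasurableSet {x : ι → Ω | (x u, x v) ∈ R} :=
    fun u v => ((measurable_pi_apply u).prodMk (measurable_pi_apply v)) hR
  have hKm : MeasurableSet K := by
    have : K = ⋂ i, ⋂ j, ⋂ (_ : i ≠ j), {x : Fin r → Ω | (x i, x j) ∈ R} := by
      ext x; simp [hK]
    rw [this]
    exact MeasurableSet.iInter fun i => MeasurableSet.iInter fun j => MeasurableSet.iInter fun _ =>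
      hpm i j
  set B : Set (Fin r × Fin m → Ω) := {x | ∀ u v, u.1 ≠ v.1 → (x u, x v) ∈ R} with hB
  have hBm : MeasurableSet B := by
    have : B = ⋂ i, ⋂ j, ⋂ (_ : i.1 ≠ j.1), {x : Fin r × Fin m → Ω | (x i, x j) ∈ R} := by
      ext x; simp [hB]
    rw [this]
    exact MeasurableSet.iInter fun i => MeasurableSet.iInter fun j => MeasurableSet.iInter fun _ =>
      hpm i j
  have h0 := blowup μ m r (Measure.dirac ()) (fun p => K.indicator (1 : (Fin r → Ω) → ℝ) p.2)
    ((measurable_one.indicator hKm).comp measurable_snd)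
    (fun p => by by_cases h : p.2 ∈ K <;> simp [h])
  have mp1 := measurePreserving_snd (μ := Measure.dirac ()) (ν := Measure.pi fun _ : Fin r => μ)
  have mp2 := measurePreserving_snd (μ := Measure.dirac ())
    (ν := Measure.pi fun _ : Fin r × Fin m => μ)
  have e1 : ∫ p, K.indicator (1 : (Fin r → Ω) → ℝ) p.2
      ∂((Measure.dirac ()).prod (Measure.pi fun _ : Fin r => μ)) =
      (Measure.pi fun _ : Fin r => μ).real K := by
    rw [← integral_indicator_one hKm]
    nth_rewrite 2 [← mp1.map_eq]
    rw [integral_map mp1.measurable.aemeasurable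
      (measurable_one.indicator hKm).aestronglyMeasurable]
  rw [e1] at h0
  refine h0.trans ?_
  rw [← integral_indicator_one hBm]
  conv_rhs => rw [← mp2.map_eq]
  rw [integral_map mp2.measurable.aemeasurable
      (measurable_one.indicator hBm).aestronglyMeasurable]
  refine integral_mono ?_ ?_ ?_
  · refine integrable_bdd (C := 1) (Finset.measurable_prod _ fun φ _ =>
      (measurable_one.indicator hKm).comp (measurable_pi_iff.2 fun i =>
        (measurable_pi_apply (i, φ i)).comp measurable_snd)) fun q => ?_
    have := prod_mem_Icc Finset.univ (fun φ : Fin r → Fin m =>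
      K.indicator (1 : (Fin r → Ω) → ℝ) fun i => q.2 (i, φ i)) (fun φ _ => by
        by_cases h : (fun i => q.2 (i, φ i)) ∈ K <;> simp [h])
    rw [abs_of_nonneg this.1]; exact this.2
  · refine integrable_bdd (C := 1) ((measurable_one.indicator hBm).comp measurable_snd) fun q => ?_
    by_cases h : q.2 ∈ B <;> simp [h]
  · intro q
    simp only
    by_cases h : q.2 ∈ B
    · rw [indicator_of_mem h]
      exact (prod_mem_Icc Finset.univ (fun φ : Fin r → Fin m =>
        K.indicator (1 : (Fin r → Ω) → ℝ) fun i => q.2 (i, φ i)) (fun φ _ => by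
        by_cases h : (fun i => q.2 (i, φ i)) ∈ K <;> simp [h])).2
    · rw [indicator_of_notMem h]
      refine le_of_eq ?_
      simp only [hB, mem_setOf_eq, not_forall] at h
      obtain ⟨u, v, huv, h⟩ := h
      refine Finset.prod_eq_zero (Finset.mem_univ
        (Function.update (fun _ => v.2) u.1 u.2 : Fin r → Fin m)) ?_
      refine indicator_of_notMem ?_ _
      intro hk
      have := hk u.1 v.1 huv
      simp only [Function.update_self, Function.update_of_ne huv.symm] at this
      exact h this

set_option maxHeartbeats 1000000 in
lemma lemmaM (r m : ℕ) (c η : ℝ) (hc : 0 < c) (hη : 0 < η) : ∃ κ > 0, ∃ N : ℕ,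
    ∀ {Ω : Type} [MeasurableSpace Ω] (μ : Measure Ω) [IsProbabilityMeasure μ] (W : Ω → Ω → ℝ)
    (_ : ∀ x y, W x y = W y x) (_ : Measurable (Function.uncurry W))
    (_ : ∀ x y, W x y ∈ Icc (0:ℝ) 1)
    (_ : c ≤ (Measure.pi fun _ : Fin r => μ).real
      {x | ∀ i j, i ≠ j → (x i, x j) ∈ {p : Ω × Ω | W p.1 p.2 ∈ Icc η (1-η)}}),
    ∀ n ≥ N, ∀ (G : SimpleGraph (Fin n)) [DecidableRel G.Adj] (q : Ω → Fin n) (_ : Measurable q)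
      (_ : ∀ v, μ.real (q ⁻¹' {v}) ≤ 1 / n)
      (_ : CutLe μ (fun x y => W x y - if G.Adj (q x) (q y) then 1 else 0) κ),
    ∃ D : Fin r → SimpleGraph (Fin m), ∀ F : SimpleGraph (Fin r × Fin m),
      (∀ i a b, F.Adj (i, a) (i, b) ↔ (D i).Adj a b) →
      ∃ φ : Fin r × Fin m → Fin n, Function.Injective φ ∧ G.comap φ = F := by
  classical
  let V := Fin r × Fin m
  let e := Fintype.equivFin V
  let E : Finset (V × V) := Finset.univ.filter fun p => e p.1 < e p.2
  set η' := min η (1/2) with hη'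
  have hη'0 : 0 < η' := lt_min hη (by norm_num)
  set ND : ℝ := ((Fintype.card (Fin r → SimpleGraph (Fin m)) : ℕ) : ℝ) with hND
  have hND0 : 0 < ND := by rw [hND]; exact_mod_cast Fintype.card_pos
  set τ := η' ^ E.card * (c ^ (m ^ r) / ND) with hτ
  have hτ0 : 0 < τ := by positivity
  obtain ⟨N, hN⟩ := exists_nat_gt ((Fintype.card (V × V) : ℝ) / (τ / 2))
  refine ⟨τ / 2 / (E.card + 1), by positivity, N + 1, ?_⟩
  intro Ω _ μ _ W hsymm hW hW1 hprob n hn G _ q hq hqn hcut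
  set R : Set (Ω × Ω) := {p : Ω × Ω | W p.1 p.2 ∈ Icc η (1-η)} with hR
  have hRm : MeasurableSet R := (show Measurable (fun p : Ω × Ω => W p.1 p.2) from hW) measurableSet_Icc
  set P := (Measure.pi fun _ : V => μ) with hP
  set B : Set (V → Ω) := {x | ∀ u v : V, u.1 ≠ v.1 → (x u, x v) ∈ R} with hB
  have hPB : c ^ (m ^ r) ≤ P.real B :=
    (pow_le_pow_left₀ hc.le hprob _).trans (blowup_event μ m r R hRm)
  let Dx : (V → Ω) → Fin r → SimpleGraph (Fin m) := fun x i =>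
    { Adj := fun a b => a ≠ b ∧ 1/2 ≤ W (x (i, a)) (x (i, b))
      symm := ⟨fun a b h => ⟨h.1.symm, by rw [hsymm]; exact h.2⟩⟩
      loopless := ⟨fun a h => h.1 rfl⟩ }
  have hsum : P.real B ≤ ∑ D, P.real (B ∩ {x | Dx x = D}) := by
    refine le_trans (measureReal_mono ?_ (by finiteness)) (measureReal_iUnion_fintype_le _)
    intro x hx
    exact mem_iUnion.2 ⟨Dx x, hx, rfl⟩
  obtain ⟨D, -, hD⟩ := Finset.exists_le_of_sum_le (s := Finset.univ)
    (f := fun _ : Fin r → SimpleGraph (Fin m) => c ^ (m ^ r) / ND)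
    (g := fun D => P.real (B ∩ {x | Dx x = D})) Finset.univ_nonempty (by
      rw [Finset.sum_const, Finset.card_univ, nsmul_eq_mul, ← hND, mul_div_cancel₀ _ hND0.ne']
      exact hPB.trans hsum)
  refine ⟨D, fun F hF => ?_⟩
  let g : Ω → Ω → ℝ := fun x y => if G.Adj (q x) (q y) then 1 else 0
  have hg : Measurable (Function.uncurry g) := by
    have : Measurable (fun p : Fin n × Fin n => if G.Adj p.1 p.2 then (1:ℝ) else 0) :=
      Measurable.of_discrete
    exact this.comp ((hq.comp measurable_fst).prodMk (hq.comp measurable_snd))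
  have hg1 : ∀ x y, g x y ∈ Icc (0:ℝ) 1 := fun x y => by
    simp only [g]; split_ifs <;> simp
  let A : V × V → Ω → Ω → ℝ := fun u x y => if F.Adj u.1 u.2 then W x y else 1 - W x y
  let C : V × V → Ω → Ω → ℝ := fun u x y => if F.Adj u.1 u.2 then g x y else 1 - g x y
  have key : ∀ (Z : Ω → Ω → ℝ), Measurable (Function.uncurry Z) → (∀ x y, Z x y ∈ Icc (0:ℝ) 1) →
      ∀ u : V × V, Measurable (Function.uncurry
        (fun x y => if F.Adj u.1 u.2 then Z x y else 1 - Z x y)) ∧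
        ∀ x y, (if F.Adj u.1 u.2 then Z x y else 1 - Z x y) ∈ Icc (0:ℝ) 1 := by
    intro Z hZ hZ1 u
    by_cases h : F.Adj u.1 u.2
    · simp only [h, if_true]; exact ⟨hZ, hZ1⟩
    · simp only [h, if_false]
      refine ⟨measurable_const.sub hZ, fun x y => ⟨?_, ?_⟩⟩ <;> linarith [(hZ1 x y).1, (hZ1 x y).2]
  have hA := fun u => (key W hW hW1 u).1
  have hA1 := fun u => (key W hW hW1 u).2
  have hC := fun u => (key g hg hg1 u).1
  have hC1 := fun u => (key g hg hg1 u).2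
  have hcnt := counting μ E (fun u hu => by
    simp only [E, Finset.mem_filter, Finset.mem_univ, true_and] at hu ⊢
    refine ⟨fun h => ?_, not_lt.2 hu.le⟩
    rw [h] at hu; exact lt_irrefl _ hu) A C hA hA1 hC hC1 (δ := τ / 2 / (E.card + 1)) (by
    intro u
    by_cases h : F.Adj u.1 u.2
    · simp only [A, C, h, if_true]; exact hcut
    · simp only [A, C, h, if_false]
      intro S T hS hT
      have := hcut S T hS hT
      rw [← abs_neg, ← integral_neg] at this
      refine le_trans (le_of_eq ?_) this
      congr 2; ext p; simp only [g]; ring)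
  have hIA : τ ≤ ∫ x, ∏ u ∈ E, A u (x u.1) (x u.2) ∂P := by
    have hm := measurable_pair_prod E A hA
    have h01 : ∀ x : V → Ω, ∏ u ∈ E, A u (x u.1) (x u.2) ∈ Icc (0:ℝ) 1 := fun x =>
      prod_mem_Icc _ _ fun u _ => hA1 u _ _
    have h1 := mul_meas_ge_le_integral_of_nonneg (μ := P)
      (f := fun x => ∏ u ∈ E, A u (x u.1) (x u.2)) (Eventually.of_forall fun x => (h01 x).1)
      (integrable_bdd (C := 1) hm fun x => by rw [abs_of_nonneg (h01 x).1]; exact (h01 x).2)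
      (η' ^ E.card)
    refine le_trans ?_ h1
    rw [hτ]
    refine mul_le_mul_of_nonneg_left (hD.trans (measureReal_mono ?_ (by finiteness))) (by positivity)
    rintro x ⟨hxB, hxD⟩
    rw [mem_setOf_eq, ← Finset.prod_const]
    refine Finset.prod_le_prod (fun _ _ => hη'0.le) fun u hu => ?_
    have hne : u.1 ≠ u.2 := fun h => by
      simp only [E, Finset.mem_filter, h] at hu
      exact lt_irrefl _ hu.2
    obtain ⟨⟨i, a⟩, ⟨j, b⟩⟩ := u
    by_cases hij : i = j
    · subst hij
      have hab : a ≠ b := fun h => hne (by simp [h])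
      have hFD := hF i a b
      rw [mem_setOf_eq] at hxD
      rw [← hxD] at hFD
      simp only [A]
      by_cases hW2 : 1/2 ≤ W (x (i, a)) (x (i, b))
      · rw [if_pos (hFD.2 ⟨hab, hW2⟩)]
        exact (min_le_right _ _).trans hW2
      · rw [if_neg (fun h => hW2 (hFD.1 h).2)]
        have := min_le_right η (1/2)
        linarith
    · have := hxB (i, a) (j, b) hij
      simp only [hR, mem_setOf_eq, mem_Icc] at this
      have h3 := min_le_left η (1/2)
      simp only [A]; split_ifs <;> linarith
  have hIC : τ / 2 < ∫ x, ∏ u ∈ E, C u (x u.1) (x u.2) ∂P := by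
    have h1 := (abs_le.1 hcnt).2
    have h2 : (E.card : ℝ) * (τ / 2 / (E.card + 1)) < τ / 2 := by
      rw [mul_div_assoc', div_lt_iff₀ (by positivity)]
      nlinarith
    linarith
  have hmC := measurable_pair_prod E C hC
  have h01 : ∀ x : V → Ω, ∏ u ∈ E, C u (x u.1) (x u.2) ∈ Icc (0:ℝ) 1 := fun x =>
      prod_mem_Icc _ _ fun u _ => hC1 u _ _
  -- non-injectivity
  set Bad : Set (V → Ω) := {x | ∃ u v, u ≠ v ∧ q (x u) = q (x v)} with hBad
  have hpairm : ∀ u v : V, MeasurableSet {x : V → Ω | q (x u) = q (x v)} := fun u v =>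
    measurableSet_eq_fun (hq.comp (measurable_pi_apply u)) (hq.comp (measurable_pi_apply v))
  have hBad' : Bad = ⋃ w : V × V, (if w.1 ≠ w.2 then {x : V → Ω | q (x w.1) = q (x w.2)} else ∅) := by
    ext x
    simp only [hBad, mem_setOf_eq, mem_iUnion, Prod.exists]
    refine exists_congr fun u => exists_congr fun v => ?_
    by_cases h : u = v <;> simp [h]
  have hBadm : MeasurableSet Bad := by
    rw [hBad']
    refine MeasurableSet.iUnion fun w => ?_
    split_ifs
    · exact hpairm _ _
    · exact MeasurableSet.empty
  have hn0 : (0:ℝ) < n := by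
    have : 0 < n := by omega
    exact_mod_cast this
  have hBadle : P.real Bad ≤ Fintype.card (V × V) * (1 / n) := by
    rw [hBad']
    refine (measureReal_iUnion_fintype_le _).trans ?_
    rw [← nsmul_eq_mul, ← Finset.card_univ, ← Finset.sum_const]
    refine Finset.sum_le_sum fun w _ => ?_
    split_ifs with h
    · have := (mp_pair μ h).measureReal_preimage (s := {p : Ω × Ω | q p.1 = q p.2})
        (measurableSet_eq_fun (hq.comp measurable_fst) (hq.comp measurable_snd)).nullMeasurableSet
      exact (le_of_eq this).trans (collision μ q hq (by positivity) hqn)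
    · simp
  have hlt : P.real Bad < τ / 2 := by
    refine hBadle.trans_lt ?_
    rw [mul_one_div, div_lt_iff₀ hn0]
    rw [div_lt_iff₀ (by positivity)] at hN
    refine hN.trans ?_
    rw [mul_comm]
    refine mul_lt_mul_of_pos_left ?_ (by positivity)
    exact_mod_cast hn
  by_contra hcon
  have hle : ∫ x, ∏ u ∈ E, C u (x u.1) (x u.2) ∂P ≤ P.real Bad := by
    rw [← integral_indicator_one hBadm]
    refine integral_mono
      (integrable_bdd (C := 1) hmC fun x => by rw [abs_of_nonneg (h01 x).1]; exact (h01 x).2)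
      (integrable_bdd (C := 1) (measurable_one.indicator hBadm) fun x => by
        by_cases h : x ∈ Bad <;> simp [h]) fun x => ?_
    by_cases h : x ∈ Bad
    · simp only [indicator_of_mem h]; exact (h01 x).2
    · simp only [indicator_of_notMem h]
      refine le_of_eq ?_
      by_contra hx0
      apply hcon
      have hall := Finset.prod_ne_zero_iff.1 hx0
      refine ⟨fun u => q (x u), fun u v huv => ?_, ?_⟩
      · by_contra hne
        exact h ⟨u, v, hne, huv⟩
      · have hlt2 : ∀ u v : V, e u < e v → (G.Adj (q (x u)) (q (x v)) ↔ F.Adj u v) := by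
          intro u v huv
          have := hall (u, v) (by simp [E, huv])
          simp only [C, g] at this
          by_cases h1 : F.Adj u v
          · rw [if_pos h1] at this
            have h2 : G.Adj (q (x u)) (q (x v)) := by
              by_contra h2
              rw [if_neg h2] at this; exact this rfl
            exact ⟨fun _ => h1, fun _ => h2⟩
          · rw [if_neg h1] at this
            have h2 : ¬ G.Adj (q (x u)) (q (x v)) := by
              intro h2
              rw [if_pos h2] at this; exact this (sub_self 1)
            exact ⟨fun h => absurd h h2, fun h => absurd h h1⟩
        ext u v
        rw [SimpleGraph.comap_adj]
        rcases lt_trichotomy (e u) (e v) with h1 | h1 | h1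
        · exact hlt2 u v h1
        · have := e.injective h1; subst this; simp
        · rw [G.adj_comm, F.adj_comm]; exact hlt2 v u h1
  linarith


lemma turan_pairs {M r : ℕ} (hr : 1 ≤ r) (G : SimpleGraph (Fin M)) [DecidableRel G.Adj]
    (h : G.CliqueFree (r + 1)) :
    ∑ i, ∑ j, (if G.Adj i j then (1:ℝ) else 0) ≤ (1 - 1 / r) * M ^ 2 := by
  have h1 : ∑ i, ∑ j, (if G.Adj i j then (1:ℝ) else 0) = 2 * G.edgeFinset.card := by
    have := G.sum_degrees_eq_twice_card_edges
    have h2 : ∀ i, ∑ j, (if G.Adj i j then (1:ℝ) else 0) = G.degree i := fun i => by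
      rw [Finset.sum_boole, ← SimpleGraph.card_neighborFinset_eq_degree]
      congr 2; ext j; simp
    simp_rw [h2]
    exact_mod_cast this
  have h3 : 2 * r * G.edgeFinset.card ≤ (r - 1) * M ^ 2 := by
    have h4 := h.card_edgeFinset_le
    have h5 := SimpleGraph.mul_card_edgeFinset_turanGraph_le (n := M) (r := r)
    rw [SimpleGraph.card_edgeFinset_turanGraph] at h5
    simp only [Fintype.card_fin] at h4
    exact (Nat.mul_le_mul_left _ h4).trans h5
  rw [h1]
  have hr0 : (0:ℝ) < r := by exact_mod_cast hr
  have h6 : (2 * r * G.edgeFinset.card : ℝ) ≤ (r - 1) * M ^ 2 := by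
    have : ((2 * r * G.edgeFinset.card : ℕ) : ℝ) ≤ (((r - 1) * M ^ 2 : ℕ) : ℝ) := by
      exact_mod_cast h3
    push_cast [Nat.cast_sub hr] at this
    exact this
  rw [show (1 - 1 / (r:ℝ)) * M ^ 2 = (r - 1) * M^2 / r by field_simp, le_div_iff₀ hr0]
  linarith

/-- the event that all pairs are in `R` -/
def cliqueEv {Ω : Type} (r : ℕ) (R : Set (Ω × Ω)) : Set (Fin r → Ω) :=
  {x | ∀ i j, i ≠ j → (x i, x j) ∈ R}

lemma measurableSet_cliqueEv {Ω : Type} [MeasurableSpace Ω] (r : ℕ) {R : Set (Ω × Ω)}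
    (hR : MeasurableSet R) : MeasurableSet (cliqueEv r R) := by
  have : cliqueEv r R = ⋂ i, ⋂ j, ⋂ (_ : i ≠ j), {x : Fin r → Ω | (x i, x j) ∈ R} := by
    ext x; simp [cliqueEv]
  rw [this]
  exact MeasurableSet.iInter fun i => MeasurableSet.iInter fun j => MeasurableSet.iInter fun _ =>
    ((measurable_pi_apply i).prodMk (measurable_pi_apply j)) hR

lemma lemmaS_core {Ω : Type} [MeasurableSpace Ω] (μ : Measure Ω) [IsProbabilityMeasure μ]
    {r : ℕ} (hr : 1 ≤ r) (M : ℕ) (R : Set (Ω × Ω)) (hR : MeasurableSet R)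
    (hs : ∀ x y, (x, y) ∈ R → (y, x) ∈ R) :
    (M * (M - 1) : ℝ) * (μ.prod μ).real R ≤ (1 - 1 / r) * M ^ 2 +
      M ^ 2 * (M ^ (r + 1) * (Measure.pi fun _ : Fin (r+1) => μ).real (cliqueEv (r+1) R)) := by
  classical
  set P := Measure.pi fun _ : Fin M => μ with hP
  set p := (Measure.pi fun _ : Fin (r+1) => μ).real (cliqueEv (r+1) R) with hp
  let f : Fin M → Fin M → (Fin M → Ω) → ℝ := fun i j x =>
    if i = j then 0 else R.indicator 1 (x i, x j)
  let g : (Fin (r+1) → Fin M) → (Fin M → Ω) → ℝ := fun φ x =>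
    if Function.Injective φ then (cliqueEv (r+1) R).indicator 1 (fun k => x (φ k)) else 0
  have hfm : ∀ i j, Measurable (f i j) := fun i j => by
    simp only [f]; split_ifs
    · exact measurable_const
    · exact (measurable_one.indicator hR).comp
        ((measurable_pi_apply i).prodMk (measurable_pi_apply j))
  have hgm : ∀ φ, Measurable (g φ) := fun φ => by
    simp only [g]; split_ifs
    · exact (measurable_one.indicator (measurableSet_cliqueEv _ hR)).comp
        (measurable_pi_iff.2 fun k => measurable_pi_apply (φ k))
    · exact measurable_const
  have ind1 : ∀ {α : Type} (s : Set α) (a : α), |s.indicator (1 : α → ℝ) a| ≤ 1 := fun s a => by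
    by_cases h : a ∈ s <;> simp [h]
  have ind0 : ∀ {α : Type} (s : Set α) (a : α), 0 ≤ s.indicator (1 : α → ℝ) a := fun s a => by
    by_cases h : a ∈ s <;> simp [h]
  have hfi : ∀ i j, Integrable (f i j) P := fun i j => integrable_bdd (C := 1) (hfm i j) fun x => by
    simp only [f]; split_ifs
    · simp
    · exact ind1 _ _
  have hgi : ∀ φ, Integrable (g φ) P := fun φ => integrable_bdd (C := 1) (hgm φ) fun x => by
    simp only [g]; split_ifs
    · exact ind1 _ _
    · simp
  have hg0 : ∀ φ x, 0 ≤ g φ x := fun φ x => by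
    simp only [g]; split_ifs
    · exact ind0 _ _
    · simp
  have hfint : ∀ i j, ∫ x, f i j x ∂P = if i = j then 0 else (μ.prod μ).real R := fun i j => by
    simp only [f]; split_ifs with h
    · simp
    · have mp := mp_pair μ h
      rw [← integral_indicator_one hR, ← mp.map_eq, integral_map mp.measurable.aemeasurable
        (measurable_one.indicator hR).aestronglyMeasurable]
  have hgint : ∀ φ, ∫ x, g φ x ∂P ≤ p := fun φ => by
    simp only [g]; split_ifs with h
    · have mp := mp_comp μ φ h
      rw [hp, ← integral_indicator_one (measurableSet_cliqueEv _ hR), ← mp.map_eq,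
        integral_map mp.measurable.aemeasurable
        (measurable_one.indicator (measurableSet_cliqueEv _ hR)).aestronglyMeasurable]
    · simp [hp]
  have hpt : ∀ x, ∑ i, ∑ j, f i j x ≤ (1 - 1 / r) * M ^ 2 + M ^ 2 * ∑ φ, g φ x := by
    intro x
    let G : SimpleGraph (Fin M) :=
      { Adj := fun i j => i ≠ j ∧ (x i, x j) ∈ R
        symm := ⟨fun i j h => ⟨h.1.symm, hs _ _ h.2⟩⟩
        loopless := ⟨fun i h => h.1 rfl⟩ }
    have hfG : ∀ i j, f i j x = if G.Adj i j then (1:ℝ) else 0 := fun i j => by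
      by_cases h : i = j
      · subst h; simp [f]
      · by_cases h2 : (x i, x j) ∈ R <;> simp [f, G, h, h2]
    simp_rw [hfG]
    have hsum0 : 0 ≤ ∑ φ, g φ x := Finset.sum_nonneg fun φ _ => hg0 φ x
    by_cases hcf : G.CliqueFree (r + 1)
    · have := turan_pairs hr G hcf
      have h2 : 0 ≤ (M:ℝ) ^ 2 * ∑ φ, g φ x := by positivity
      linarith
    · let φ := SimpleGraph.topEmbeddingOfNotCliqueFree hcf
      have h1 : 1 ≤ ∑ φ, g φ x := by
        refine le_trans (le_of_eq ?_) (Finset.single_le_sum (f := fun φ => g φ x)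
          (fun φ _ => hg0 φ x) (Finset.mem_univ (φ : Fin (r+1) → Fin M)))
        simp only [g]
        rw [if_pos φ.injective, indicator_of_mem]
        · rfl
        · intro i j hij
          have : G.Adj (φ i) (φ j) := φ.map_rel_iff.2 (by simpa using hij)
          exact this.2
      have h2 : ∑ i, ∑ j, (if G.Adj i j then (1:ℝ) else 0) ≤ M ^ 2 := by
        calc ∑ i, ∑ j, (if G.Adj i j then (1:ℝ) else 0) ≤ ∑ i : Fin M, ∑ j : Fin M, (1:ℝ) :=
              Finset.sum_le_sum fun i _ => Finset.sum_le_sum fun j _ => by split_ifs <;> norm_num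
          _ = M ^ 2 := by simp [sq]
      have h3 : (0:ℝ) ≤ (1 - 1 / r) * M ^ 2 := by
        have : (1:ℝ) / r ≤ 1 := by
          rw [div_le_one (by exact_mod_cast hr)]; exact_mod_cast hr
        have := sub_nonneg.2 this
        positivity
      have h4 : (M:ℝ) ^ 2 * 1 ≤ (M:ℝ) ^ 2 * ∑ φ, g φ x :=
        mul_le_mul_of_nonneg_left h1 (by positivity)
      linarith
  have hI := integral_mono (μ := P)
    (integrable_finset_sum _ fun i _ => integrable_finset_sum _ fun j _ => hfi i j)
    ((integrable_const _).add ((integrable_finset_sum _ fun φ _ => hgi φ).const_mul ((M:ℝ)^2)))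
    hpt
  simp only [Pi.add_apply] at hI
  rw [integral_finset_sum _ fun i _ => integrable_finset_sum _ fun j _ => hfi i j,
    integral_add (integrable_const _) ((integrable_finset_sum _ fun φ _ => hgi φ).const_mul _),
    integral_const_mul ((M:ℝ)^2), integral_finset_sum _ fun φ _ => hgi φ, integral_const,
    probReal_univ, one_smul] at hI
  simp_rw [integral_finset_sum _ fun j _ => hfi _ j, hfint] at hI
  have hL : ∑ i : Fin M, ∑ j : Fin M, (if i = j then 0 else (μ.prod μ).real R) =
      (M * (M - 1) : ℝ) * (μ.prod μ).real R := by
    have : ∀ i j : Fin M, (if i = j then 0 else (μ.prod μ).real R) =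
      (μ.prod μ).real R - if i = j then (μ.prod μ).real R else 0 := fun i j => by
        split_ifs <;> ring
    simp_rw [this, Finset.sum_sub_distrib]
    simp
    ring
  rw [hL] at hI
  refine hI.trans (add_le_add_right (mul_le_mul_of_nonneg_left ?_ (by positivity)) _)
  calc ∑ φ, ∫ x, g φ x ∂P ≤ ∑ φ : Fin (r+1) → Fin M, p := Finset.sum_le_sum fun φ _ => hgint φ
    _ = M ^ (r+1) * p := by simp

lemma lemmaS (r : ℕ) (hr : 1 ≤ r) (ε : ℝ) (hε : 0 < ε) : ∃ c > 0,
    ∀ {Ω : Type} [MeasurableSpace Ω] (μ : Measure Ω) [IsProbabilityMeasure μ]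
    (R : Set (Ω × Ω)) (_ : MeasurableSet R) (_ : ∀ x y, (x, y) ∈ R → (y, x) ∈ R)
    (_ : 1 - 1 / r + ε ≤ (μ.prod μ).real R),
    c ≤ (Measure.pi fun _ : Fin (r+1) => μ).real (cliqueEv (r+1) R) := by
  obtain ⟨M, hM⟩ := exists_nat_gt (2 / ε)
  have hM0 : (0:ℝ) < M := lt_trans (by positivity) hM
  refine ⟨ε / 2 / M ^ (r+1), by positivity, ?_⟩
  intro Ω _ μ _ R hR hs h
  have h1 := lemmaS_core μ hr M R hR hs
  set p := (Measure.pi fun _ : Fin (r+1) => μ).real (cliqueEv (r+1) R)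
  have hR1 : (μ.prod μ).real R ≤ 1 := measureReal_le_one
  rw [div_lt_iff₀ hε] at hM
  rw [div_le_iff₀ (by positivity)]
  set d := (μ.prod μ).real R
  have h2 : (M:ℝ)^2 * d - M * d ≤ (1 - 1 / r) * M ^ 2 + M ^ 2 * (M ^ (r + 1) * p) := by linarith
  have h3 : (M:ℝ)^2 * (1 - 1 / r + ε) ≤ (M:ℝ)^2 * d := mul_le_mul_of_nonneg_left h (by positivity)
  have h4 : (M:ℝ) * d ≤ M := mul_le_of_le_one_right hM0.le hR1
  have h5 : (M:ℝ)^2 * ε - M ≤ M ^ 2 * (M ^ (r + 1) * p) := by linarith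
  have h6 : (M:ℝ) ^ 2 * (ε / 2) ≤ M ^ 2 * (p * M ^ (r + 1)) := by nlinarith
  exact le_of_mul_le_mul_left h6 (by positivity)

lemma turan_le (r : ℕ) (hr : 1 ≤ r) {Ω : Type} [MeasurableSpace Ω] (μ : Measure Ω)
    [IsProbabilityMeasure μ] (R : Set (Ω × Ω)) (hR : MeasurableSet R)
    (hs : ∀ x y, (x, y) ∈ R → (y, x) ∈ R)
    (h : (Measure.pi fun _ : Fin (r+1) => μ) (cliqueEv (r+1) R) = 0) :
    (μ.prod μ).real R ≤ 1 - 1 / r := by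
  by_contra hcon
  push Not at hcon
  obtain ⟨c, hc, H⟩ := lemmaS r hr ((μ.prod μ).real R - (1 - 1 / r)) (by linarith)
  have := H μ R hR hs (by linarith)
  rw [measureReal_def, h] at this
  simp at this
  linarith


lemma turan_le_restrict (r : ℕ) (hr : 1 ≤ r) {Ω : Type} [MeasurableSpace Ω] (μ : Measure Ω)
    [IsProbabilityMeasure μ] (R : Set (Ω × Ω)) (hR : MeasurableSet R)
    (hs : ∀ x y, (x, y) ∈ R → (y, x) ∈ R)
    (h : (Measure.pi fun _ : Fin (r+1) => μ) (cliqueEv (r+1) R) = 0)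
    (A : Set Ω) (hA : MeasurableSet A) (hA0 : μ A ≠ 0) :
    (μ.prod μ).real (R ∩ A ×ˢ A) ≤ (1 - 1 / r) * μ.real A ^ 2 := by
  have := ProbabilityTheory.cond_isProbabilityMeasure hA0
  have hfin : μ A ≠ ⊤ := measure_ne_top _ _
  have hpi : (Measure.pi fun _ : Fin (r+1) => ProbabilityTheory.cond μ A) =
      ((μ A)⁻¹ ^ (r+1)) • (Measure.pi fun _ : Fin (r+1) => μ).restrict (univ.pi fun _ => A) := by
    refine Measure.pi_eq fun s hs => ?_
    rw [Measure.smul_apply, Measure.restrict_apply (MeasurableSet.univ_pi hs),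
      ← Set.pi_inter_distrib, Measure.pi_pi]
    simp only [ProbabilityTheory.cond, Measure.smul_apply, smul_eq_mul, Finset.prod_mul_distrib,
      Finset.prod_const, Finset.card_univ, Fintype.card_fin]
    congr 1
    exact Finset.prod_congr rfl fun i _ => (Measure.restrict_apply (hs i)).symm
  have h1 := turan_le r hr (ProbabilityTheory.cond μ A) R hR hs (by
    rw [hpi, Measure.smul_apply, Measure.restrict_apply (measurableSet_cliqueEv _ hR),
      measure_mono_null inter_subset_left h, smul_zero])
  have hprod : (ProbabilityTheory.cond μ A).prod (ProbabilityTheory.cond μ A) R =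
      (μ A)⁻¹ * ((μ A)⁻¹ * (μ.prod μ) (R ∩ A ×ˢ A)) := by
    rw [← Measure.restrict_apply hR, ← Measure.prod_restrict]
    simp only [ProbabilityTheory.cond]
    rw [Measure.prod_smul_left, Measure.prod_smul_right]
    rfl
  rw [measureReal_def, hprod, ENNReal.toReal_mul, ENNReal.toReal_mul, ENNReal.toReal_inv] at h1
  have hA1 : 0 < μ.real A := ENNReal.toReal_pos hA0 hfin
  change (μ.real A)⁻¹ * ((μ.real A)⁻¹ * (μ.prod μ).real (R ∩ A ×ˢ A)) ≤ _ at h1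
  rw [inv_mul_le_iff₀ hA1, inv_mul_le_iff₀ hA1] at h1
  linarith

/-- Lebesgue measure on `[0,1]` -/
noncomputable abbrev mu0 : Measure ℝ := volume.restrict (Icc (0:ℝ) 1)

instance mu0_prob : IsProbabilityMeasure mu0 := ⟨by simp [mu0]⟩

lemma measure_colour_ne {Ω : Type} [MeasurableSpace Ω] (μ : Measure Ω) [IsProbabilityMeasure μ]
    {r : ℕ} (hr : 1 ≤ r) (c : Ω → Fin r) (hc : Measurable c)
    (h : ∀ i, μ.real (c ⁻¹' {i}) = 1 / r) :
    MeasurableSet {p : Ω × Ω | c p.1 ≠ c p.2} ∧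
    (μ.prod μ).real {p : Ω × Ω | c p.1 ≠ c p.2} = 1 - 1 / r := by
  have hm : MeasurableSet {p : Ω × Ω | c p.1 = c p.2} :=
    measurableSet_eq_fun (hc.comp measurable_fst) (hc.comp measurable_snd)
  have hcomp : {p : Ω × Ω | c p.1 ≠ c p.2} = {p : Ω × Ω | c p.1 = c p.2}ᶜ := rfl
  refine ⟨by rw [hcomp]; exact hm.compl, ?_⟩
  rw [hcomp, probReal_compl_eq_one_sub hm]
  congr 1
  have hu : {p : Ω × Ω | c p.1 = c p.2} = ⋃ i, (c ⁻¹' {i}) ×ˢ (c ⁻¹' {i}) := by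
    ext p; simp [eq_comm]
  rw [hu, measureReal_iUnion_fintype]
  · simp_rw [measureReal_prod_prod, h]
    have hr0 : (r:ℝ) ≠ 0 := by positivity
    simp
    field_simp
  · intro i j hij
    simp only [Function.onFun]
    rw [Set.disjoint_left]
    rintro p ⟨hp, -⟩ ⟨hq, -⟩
    exact hij (hp.symm.trans hq)
  · intro i
    exact (hc (measurableSet_singleton i)).prod (hc (measurableSet_singleton i))

lemma deg_strip {Ω : Type} [MeasurableSpace Ω] (μ : Measure Ω) [IsProbabilityMeasure μ]
    (R : Set (Ω × Ω)) (hR : MeasurableSet R) (B : Set Ω) (hB : MeasurableSet B) (t : ℝ)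
    (ht : 0 ≤ t) (h : ∀ x ∈ B, μ.real (Prod.mk x ⁻¹' R) ≤ t) :
    (μ.prod μ).real (R ∩ B ×ˢ univ) ≤ t * μ.real B := by
  rw [measureReal_def]
  refine ENNReal.toReal_le_of_le_ofReal (by positivity) ?_
  rw [Measure.prod_apply (hR.inter (hB.prod MeasurableSet.univ)), ENNReal.ofReal_mul ht,
    ofReal_measureReal (measure_ne_top _ _), ← lintegral_indicator_const hB]
  refine lintegral_mono fun x => ?_
  by_cases hx : x ∈ B
  · rw [indicator_of_mem hx, ← ofReal_measureReal (measure_ne_top _ _)]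
    refine ENNReal.ofReal_le_ofReal (le_trans ?_ (h x hx))
    exact measureReal_mono (fun y hy => hy.1) (measure_ne_top _ _)
  · rw [indicator_of_notMem hx]
    have : Prod.mk x ⁻¹' (R ∩ B ×ˢ univ) = ∅ := by
      ext y; simp [hx]
    simp [this]

lemma deg_ge (r : ℕ) (hr : 1 ≤ r) (R : Set (ℝ × ℝ)) (hR : MeasurableSet R)
    (hs : ∀ x y, (x, y) ∈ R → (y, x) ∈ R)
    (h : (Measure.pi fun _ : Fin (r+1) => mu0) (cliqueEv (r+1) R) = 0)
    (he : (mu0.prod mu0).real R = 1 - 1 / r) (ρ : ℝ) (hρ : 0 < ρ) :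
    mu0 {x | mu0.real (Prod.mk x ⁻¹' R) < 1 - 1 / r - ρ} = 0 := by
  set a : ℝ := 1 - 1 / r with ha
  have ha1 : a ≤ 1 := by rw [ha]; have : (0:ℝ) ≤ 1 / r := by positivity
                         linarith
  set B := {x | mu0.real (Prod.mk x ⁻¹' R) < a - ρ} with hB
  have hdm : Measurable (fun x => mu0.real (Prod.mk x ⁻¹' R)) :=
    (measurable_measure_prodMk_left hR).ennreal_toReal
  have hBm : MeasurableSet B := measurableSet_lt hdm measurable_const
  by_contra hne
  obtain ⟨N, hN⟩ := exists_nat_gt (1 / ρ)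
  have hN0 : (0:ℝ) < N := lt_trans (by positivity) hN
  have hcov : B ⊆ ⋃ k : ℤ, B ∩ Ico ((k:ℝ) / N) (((k:ℝ) + 1) / N) := by
    intro x hx
    refine mem_iUnion.2 ⟨⌊x * N⌋, hx, ?_, ?_⟩
    · rw [div_le_iff₀ hN0]; exact Int.floor_le _
    · rw [lt_div_iff₀ hN0]; exact Int.lt_floor_add_one _
  obtain ⟨k, hk⟩ : ∃ k : ℤ, mu0 (B ∩ Ico ((k:ℝ) / N) (((k:ℝ) + 1) / N)) ≠ 0 := by
    by_contra hcon
    push Not at hcon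
    exact hne (measure_mono_null hcov (measure_iUnion_null hcon))
  set B' := B ∩ Ico ((k:ℝ) / N) (((k:ℝ) + 1) / N) with hB'
  have hB'm : MeasurableSet B' := hBm.inter measurableSet_Ico
  set b := mu0.real B' with hb
  have hb0 : 0 < b := ENNReal.toReal_pos hk (measure_ne_top _ _)
  have hbρ : b < ρ := by
    have h1 : mu0 B' ≤ ENNReal.ofReal (1 / N) := by
      calc mu0 B' ≤ volume B' := Measure.restrict_apply_le _ _
        _ ≤ volume (Ico ((k:ℝ) / N) (((k:ℝ) + 1) / N)) := measure_mono inter_subset_right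
        _ = ENNReal.ofReal (1 / N) := by
          rw [Real.volume_Ico]; congr 1; ring
    have h2 : b ≤ 1 / N := ENNReal.toReal_le_of_le_ofReal (by positivity) h1
    have h3 : 1 / (N:ℝ) < ρ := by
      rw [div_lt_comm₀ hN0 hρ]; exact hN
    linarith
  obtain ⟨x0, hx0⟩ : B'.Nonempty := nonempty_of_measure_ne_zero hk
  have hx1 : mu0.real (Prod.mk x0 ⁻¹' R) < a - ρ := hx0.1
  have haρ : 0 ≤ a - ρ := le_trans measureReal_nonneg hx1.le
  have hA : mu0.real B'ᶜ = 1 - b := probReal_compl_eq_one_sub hB'm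
  have h1 := turan_le_restrict r hr mu0 R hR hs h B'ᶜ hB'm.compl (by
    intro h0
    rw [measureReal_def, h0] at hA
    simp at hA; linarith)
  have h2 := deg_strip mu0 R hR B' hB'm (a - ρ) haρ (fun x hx => (show x ∈ B from hx.1).le)
  have h3 : (mu0.prod mu0).real (R ∩ univ ×ˢ B') = (mu0.prod mu0).real (R ∩ B' ×ˢ univ) := by
    have mp := Measure.measurePreserving_swap (μ := mu0) (ν := mu0)
    have := mp.measureReal_preimage (s := R ∩ B' ×ˢ univ)
      (hR.inter (hB'm.prod MeasurableSet.univ)).nullMeasurableSet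
    rw [← this]
    congr 1
    ext ⟨x, y⟩
    simp only [mem_inter_iff, mem_prod, mem_univ, true_and, and_true, mem_preimage, Prod.swap]
    exact and_congr_left fun _ => ⟨hs _ _, hs _ _⟩
  have h4 : (mu0.prod mu0).real R ≤ (mu0.prod mu0).real (R ∩ B'ᶜ ×ˢ B'ᶜ) +
      (mu0.prod mu0).real (R ∩ B' ×ˢ univ) + (mu0.prod mu0).real (R ∩ univ ×ˢ B') := by
    refine le_trans (measureReal_mono (s₂ := (R ∩ B'ᶜ ×ˢ B'ᶜ ∪ R ∩ B' ×ˢ univ) ∪ R ∩ univ ×ˢ B') ?_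
      (by finiteness)) ((measureReal_union_le _ _).trans
        (add_le_add_left (measureReal_union_le _ _) _))
    rintro ⟨x, y⟩ hxy
    by_cases hx : x ∈ B'
    · left; right; exact ⟨hxy, hx, trivial⟩
    · by_cases hy : y ∈ B'
      · right; exact ⟨hxy, trivial, hy⟩
      · left; left; exact ⟨hxy, hx, hy⟩
  rw [he, h3] at h4
  rw [hA, ← ha] at h1
  have h5 : 2 * b * ρ ≤ a * b ^ 2 := by nlinarith
  have h6 : a * b ^ 2 ≤ 1 * b ^ 2 := mul_le_mul_of_nonneg_right ha1 (by positivity)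
  nlinarith

lemma deg_eq (r : ℕ) (hr : 1 ≤ r) (R : Set (ℝ × ℝ)) (hR : MeasurableSet R)
    (hs : ∀ x y, (x, y) ∈ R → (y, x) ∈ R)
    (h : (Measure.pi fun _ : Fin (r+1) => mu0) (cliqueEv (r+1) R) = 0)
    (he : (mu0.prod mu0).real R = 1 - 1 / r) :
    ∀ᵐ x ∂mu0, mu0.real (Prod.mk x ⁻¹' R) = 1 - 1 / r := by
  set a : ℝ := 1 - 1 / r with ha
  have hdm : Measurable (fun x => mu0.real (Prod.mk x ⁻¹' R)) :=
    (measurable_measure_prodMk_left hR).ennreal_toReal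
  have hge : ∀ᵐ x ∂mu0, a ≤ mu0.real (Prod.mk x ⁻¹' R) := by
    have : ∀ k : ℕ, ∀ᵐ x ∂mu0, a - 1 / (k + 1) ≤ mu0.real (Prod.mk x ⁻¹' R) := by
      intro k
      have := deg_ge r hr R hR hs h he (1 / (k+1)) (by positivity)
      rw [ae_iff]; simpa only [not_le] using this
    filter_upwards [ae_all_iff.2 this] with x hx
    refine le_of_forall_pos_le_add fun ε hε => ?_
    obtain ⟨k, hk⟩ := exists_nat_one_div_lt hε
    linarith [hx k]
  have hi : Integrable (fun x => mu0.real (Prod.mk x ⁻¹' R)) mu0 :=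
    integrable_bdd (C := 1) hdm fun x => by
      rw [abs_of_nonneg measureReal_nonneg]; exact measureReal_le_one
  have hInteg : ∫ x, mu0.real (Prod.mk x ⁻¹' R) ∂mu0 = a := by
    rw [← he, measureReal_def, Measure.prod_apply hR, ← integral_toReal]
    · rfl
    · exact (measurable_measure_prodMk_left hR).aemeasurable
    · exact Eventually.of_forall fun x => measure_lt_top _ _
  have h0 : ∫ x, (mu0.real (Prod.mk x ⁻¹' R) - a) ∂mu0 = 0 := by
    rw [integral_sub hi (integrable_const _), hInteg]; simp
  have := (integral_eq_zero_iff_of_nonneg_ae (hge.mono fun x hx => sub_nonneg.2 hx)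
    (hi.sub (integrable_const _))).1 h0
  filter_upwards [this] with x hx
  simpa [sub_eq_zero] using hx


lemma cliqueEv_cons {Ω : Type} {r : ℕ} {R : Set (Ω × Ω)} (hs : ∀ x y, (x, y) ∈ R → (y, x) ∈ R)
    {x : Fin r → Ω} (hx : x ∈ cliqueEv r R) {y : Ω} (hy : ∀ i, (x i, y) ∈ R) :
    (Fin.cons y x : Fin (r+1) → Ω) ∈ cliqueEv (r+1) R := by
  intro i j hij
  induction i using Fin.cases with
  | zero =>
    induction j using Fin.cases with
    | zero => exact absurd rfl hij
    | succ j => simpa using hs _ _ (hy j)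
  | succ i =>
    induction j using Fin.cases with
    | zero => simpa using hy i
    | succ j => simpa using hx i j (fun h => hij (by rw [h]))

lemma cliqueEv_update {Ω : Type} {r : ℕ} {R : Set (Ω × Ω)} (hs : ∀ x y, (x, y) ∈ R → (y, x) ∈ R)
    {x : Fin r → Ω} (hx : x ∈ cliqueEv r R) {y : Ω} (i : Fin r) (hy : ∀ j, j ≠ i → (x j, y) ∈ R) :
    Function.update x i y ∈ cliqueEv r R := by
  intro j k hjk
  by_cases hj : j = i
  · subst hj
    rw [Function.update_self, Function.update_of_ne hjk.symm]
    exact hs _ _ (hy k hjk.symm)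
  · by_cases hk : k = i
    · subst hk
      rw [Function.update_self, Function.update_of_ne hj]
      exact hy j hj
    · rw [Function.update_of_ne hj, Function.update_of_ne hk]
      exact hx j k hjk

lemma cliques_pos (r : ℕ) (hr : 1 ≤ r) {Ω : Type} [MeasurableSpace Ω] (μ : Measure Ω)
    [IsProbabilityMeasure μ] (R : Set (Ω × Ω)) (hR : MeasurableSet R)
    (hs : ∀ x y, (x, y) ∈ R → (y, x) ∈ R)
    (he : (μ.prod μ).real R = 1 - 1 / r) :
    (Measure.pi fun _ : Fin r => μ) (cliqueEv r R) ≠ 0 := by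
  intro h0
  obtain ⟨s, rfl⟩ : ∃ s, r = s + 1 := ⟨r - 1, by omega⟩
  rcases Nat.eq_zero_or_pos s with rfl | hs0
  · have : cliqueEv (0 + 1) R = univ := by
      ext x; simp only [cliqueEv, mem_setOf_eq, mem_univ, iff_true]
      intro i j hij; exact absurd (Fin.ext (by omega)) hij
    rw [this, measure_univ] at h0
    exact one_ne_zero h0
  · have := turan_le s hs0 μ R hR hs h0
    rw [he] at this
    have h1 : (1:ℝ) / ((s+1 : ℕ) : ℝ) < 1 / s := by
      apply one_div_lt_one_div_of_lt
      · exact_mod_cast hs0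
      · push_cast; linarith
    linarith

lemma turan_eq (r : ℕ) (hr : 1 ≤ r) {Ω : Type} [MeasurableSpace Ω] (μ : Measure Ω)
    [IsProbabilityMeasure μ] (R : Set (Ω × Ω)) (hR : MeasurableSet R)
    (hs : ∀ x y, (x, y) ∈ R → (y, x) ∈ R)
    (h : (Measure.pi fun _ : Fin (r+1) => μ) (cliqueEv (r+1) R) = 0)
    (he : (μ.prod μ).real R = 1 - 1 / r)
    (hdeg : ∀ᵐ x ∂μ, μ.real (Prod.mk x ⁻¹' R) = 1 - 1 / r) :
    ∃ c : Ω → Fin r, Measurable c ∧ (∀ i, μ.real (c ⁻¹' {i}) = 1 / r) ∧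
      ∀ᵐ p ∂(μ.prod μ), (p ∈ R ↔ c p.1 ≠ c p.2) := by
  classical
  have hfree : ∀ᵐ x ∂(Measure.pi fun _ : Fin (r+1) => μ), x ∉ cliqueEv (r+1) R :=
    measure_eq_zero_iff_ae_notMem.1 h
  have F1 : ∀ᵐ x ∂(Measure.pi fun _ : Fin r => μ), ∀ i, μ.real (Prod.mk (x i) ⁻¹' R) = 1 - 1 / r :=
    ae_all_iff.2 fun i => (measurePreserving_eval (fun _ : Fin r => μ) i).quasiMeasurePreserving.ae hdeg
  have F2 : ∀ᵐ x ∂(Measure.pi fun _ : Fin r => μ), ∀ᵐ y ∂μ,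
      (Fin.cons y x : Fin (r+1) → Ω) ∉ cliqueEv (r+1) R :=
    Measure.ae_ae_of_ae_prod ((mp_cons μ r).quasiMeasurePreserving.ae hfree)
  have F3 : ∀ᵐ x ∂(Measure.pi fun _ : Fin r => μ), ∀ i, ∀ᵐ q ∂(μ.prod μ),
      (Fin.cons q.2 (Function.update x i q.1) : Fin (r+1) → Ω) ∉ cliqueEv (r+1) R := by
    refine ae_all_iff.2 fun i => ?_
    have mp := ((mp_cons μ r).comp ((mp_resample μ i).prod (MeasurePreserving.id μ))).comp
      (measurePreserving_prodAssoc (Measure.pi fun _ : Fin r => μ) μ μ).symm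
    exact Measure.ae_ae_of_ae_prod (mp.quasiMeasurePreserving.ae hfree)
  obtain ⟨x, hx, h1, h2, h3⟩ := Measure.exists_mem_of_measure_ne_zero_of_ae (cliques_pos r hr μ R hR hs he)
    (ae_restrict_of_ae (F1.and (F2.and F3)))
  have hr0 : (r:ℝ) ≠ 0 := by positivity
  let Nb : Fin r → Set Ω := fun i => (Prod.mk (x i) ⁻¹' R)ᶜ
  have hRx : ∀ i, MeasurableSet (Prod.mk (x i) ⁻¹' R) := fun i => measurable_prodMk_left hR
  have hNm : ∀ i, MeasurableSet (Nb i) := fun i => (hRx i).compl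
  have hNμ : ∀ i, μ.real (Nb i) = 1 / r := fun i => by
    rw [probReal_compl_eq_one_sub (hRx i), h1 i]; ring
  have hcov : ∀ᵐ y ∂μ, ∃ i, y ∈ Nb i := by
    filter_upwards [h2] with y hy
    by_contra hcon
    push Not at hcon
    exact hy (cliqueEv_cons hs hx fun i => by
      have := hcon i; simpa [Nb] using this)
  let S : Ω → (Fin r → Prop) := fun y i => y ∈ Nb i
  have hS : Measurable S := measurable_pi_iff.2 fun i => measurableSet_setOf.1 (hNm i)
  let g : (Fin r → Prop) → Fin r := fun s => if h : ∃ i, s i then h.choose else ⟨0, hr⟩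
  have hg : Measurable g := Measurable.of_discrete
  let c : Ω → Fin r := fun y => g (S y)
  have hc : Measurable c := hg.comp hS
  have hcN : ∀ᵐ y ∂μ, y ∈ Nb (c y) := by
    filter_upwards [hcov] with y hy
    have : g (S y) = hy.choose := dif_pos hy
    have h4 := hy.choose_spec
    rw [← this] at h4
    exact h4
  have hle : ∀ i, μ.real (c ⁻¹' {i}) ≤ 1 / r := fun i => by
    rw [← hNμ i, measureReal_def, measureReal_def]
    refine ENNReal.toReal_mono (measure_ne_top _ _) (measure_mono_ae ?_)
    filter_upwards [hcN] with y hy hyi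
    have : c y = i := hyi
    rw [this] at hy; exact hy
  have hsum : ∑ i, μ.real (c ⁻¹' {i}) = 1 := by
    rw [← measureReal_iUnion_fintype]
    · have : (⋃ i, c ⁻¹' {i}) = univ := by ext y; simp
      rw [this, probReal_univ]
    · intro i j hij
      simp only [Function.onFun]
      rw [Set.disjoint_left]
      intro p hp hq
      exact hij (hp.symm.trans hq)
    · exact fun i => hc (measurableSet_singleton i)
  have heq : ∀ i, μ.real (c ⁻¹' {i}) = 1 / r := by
    have : ∑ i, μ.real (c ⁻¹' {i}) = ∑ i : Fin r, (1:ℝ) / r := by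
      rw [hsum]; simp [hr0]
    have := (Finset.sum_eq_sum_iff_of_le fun i _ => hle i).1 this
    exact fun i => this i (Finset.mem_univ i)
  refine ⟨c, hc, heq, ?_⟩
  have hiff : ∀ᵐ y ∂μ, ∀ i, y ∈ Nb i → c y = i := by
    refine ae_all_iff.2 fun i => ?_
    have hae : (c ⁻¹' {i} : Set Ω) =ᵐ[μ] Nb i := by
      refine ae_eq_of_ae_subset_of_measure_ge ?_ ?_ (hc (measurableSet_singleton i)).nullMeasurableSet
        (measure_ne_top _ _)
      · filter_upwards [hcN] with y hy hyi
        have : c y = i := hyi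
        rw [this] at hy; exact hy
      · rw [← ofReal_measureReal (measure_ne_top μ (Nb i)),
          ← ofReal_measureReal (measure_ne_top μ (c ⁻¹' {i})), hNμ, heq]
    filter_upwards [hae] with y hy hyi
    have : y ∈ c ⁻¹' {i} := by
      exact (eq_iff_iff.1 hy).2 hyi
    exact this
  have hsub : ∀ᵐ p ∂(μ.prod μ), p ∈ R → c p.1 ≠ c p.2 := by
    have e1 := (measurePreserving_fst (μ := μ) (ν := μ)).quasiMeasurePreserving.ae hiff
    have e2 := (measurePreserving_snd (μ := μ) (ν := μ)).quasiMeasurePreserving.ae hiff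
    filter_upwards [e1, e2, ae_all_iff.2 h3] with p hp1 hp2 hp3 hpR heqc
    have k1 : ∀ j, j ≠ c p.1 → (x j, p.1) ∈ R := fun j hj => by
      by_contra hcon
      exact hj (hp1 j hcon).symm
    have k2 : ∀ j, j ≠ c p.1 → (x j, p.2) ∈ R := fun j hj => by
      by_contra hcon
      exact hj ((hp2 j hcon).symm.trans heqc.symm)
    refine hp3 (c p.1) (cliqueEv_cons hs (cliqueEv_update hs hx (c p.1) k1) fun j => ?_)
    by_cases hj : j = c p.1
    · rw [hj, Function.update_self]; exact hpR
    · rw [Function.update_of_ne hj]; exact k2 j hj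
  obtain ⟨hTm, hT⟩ := measure_colour_ne μ hr c hc heq
  have hae : R =ᵐ[μ.prod μ] {p : Ω × Ω | c p.1 ≠ c p.2} := by
    refine ae_eq_of_ae_subset_of_measure_ge hsub ?_ hR.nullMeasurableSet (measure_ne_top _ _)
    rw [← ofReal_measureReal (measure_ne_top (μ.prod μ) R), ← ofReal_measureReal
      (measure_ne_top (μ.prod μ) {p : Ω × Ω | c p.1 ≠ c p.2}), he, hT]
  filter_upwards [hae] with p hp
  exact eq_iff_iff.1 hp


/-- all finite induced subgraphs of `G` are in `Q` -/
def InQ (Q : GraphClass) {V : Type} (G : SimpleGraph V) : Prop :=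
  ∀ (n : ℕ) (f : Fin n → V), Function.Injective f → G.comap f ∈ Q n

lemma InQ.of_mem {Q : GraphClass} (hQ : IsHereditary Q) {n : ℕ} {G : SimpleGraph (Fin n)}
    (hG : G ∈ Q n) : InQ Q G := by
  intro m f hf
  have hmono : StrictMono (f ∘ Tuple.sort f) :=
    (Tuple.monotone_sort f).strictMono_of_injective (hf.comp (Tuple.sort f).injective)
  have h1 := hQ.2 m n _ hmono G hG
  have h2 := hQ.1 m (Tuple.sort f)⁻¹ _ h1
  convert h2 using 1
  ext a b
  simp

lemma InQ.mem {Q : GraphClass} {n : ℕ} {G : SimpleGraph (Fin n)} (h : InQ Q G) : G ∈ Q n := by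
  have := h n id Function.injective_id
  rwa [SimpleGraph.comap_id] at this

lemma InQ.comap {Q : GraphClass} {V V' : Type} {G : SimpleGraph V} (h : InQ Q G) (g : V' → V)
    (hg : Function.Injective g) : InQ Q (G.comap g) := by
  intro n f hf
  rw [SimpleGraph.comap_comap]
  exact h n _ (hg.comp hf)

/-- `r` parts of any size can be put with arbitrary cross edges -/
def Good (Q : GraphClass) (r : ℕ) : Prop :=
  ∀ m, ∃ D : Fin r → SimpleGraph (Fin m), ∀ F : SimpleGraph (Fin r × Fin m),
    (∀ i a b, F.Adj (i, a) (i, b) ↔ (D i).Adj a b) → InQ Q F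

/-- sign templates -/
def TG (Q : GraphClass) {r : ℕ} (s : Fin r → Bool) (m : ℕ) : Prop :=
  ∀ F : SimpleGraph (Fin r × Fin m),
    (∀ i a b, a ≠ b → (F.Adj (i, a) (i, b) ↔ s i = true)) → InQ Q F

lemma good_one {Q : GraphClass} (hQ : IsHereditary Q) (hne : (limitSet Q).Nonempty) :
    Good Q 1 := by
  obtain ⟨W, -, nk, Gk, hG, hn, -⟩ := hne
  intro m
  obtain ⟨k, hk⟩ := (hn.eventually_ge_atTop m).exists
  refine ⟨fun _ => (Gk k).comap (Fin.castLE hk), fun F hF => ?_⟩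
  have : F = (Gk k).comap (fun p : Fin 1 × Fin m => Fin.castLE hk p.2) := by
    ext ⟨i, a⟩ ⟨j, b⟩
    have hij : i = j := Subsingleton.elim _ _
    subst hij
    rw [hF]; simp
  rw [this]
  refine (InQ.of_mem hQ (hG k)).comap _ ?_
  rintro ⟨i, a⟩ ⟨j, b⟩ h
  have hij : i = j := Subsingleton.elim _ _
  subst hij
  have h' : a = b := (Fin.castLE_injective hk) h
  rw [h']

lemma ramsey {V : Type} (G : SimpleGraph V) : ∀ (n k l : ℕ), k + l ≤ n → ∀ S : Finset V,
    2 ^ n ≤ S.card → ∃ T ⊆ S, (T.card = k ∧ ∀ a ∈ T, ∀ b ∈ T, a ≠ b → G.Adj a b) ∨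
      (T.card = l ∧ ∀ a ∈ T, ∀ b ∈ T, a ≠ b → ¬ G.Adj a b) := by
  classical
  intro n
  induction n with
  | zero =>
    intro k l hkl S _
    have hk : k = 0 := by omega
    exact ⟨∅, by simp, Or.inl ⟨by simp [hk], by simp⟩⟩
  | succ n ih =>
    intro k l hkl S hS
    rcases Nat.eq_zero_or_pos k with rfl | hk
    · exact ⟨∅, by simp, Or.inl ⟨by simp, by simp⟩⟩
    rcases Nat.eq_zero_or_pos l with rfl | hl
    · exact ⟨∅, by simp, Or.inr ⟨by simp, by simp⟩⟩
    have hpos : 0 < S.card := lt_of_lt_of_le (by positivity) hS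
    obtain ⟨v, hv⟩ := Finset.card_pos.1 hpos
    have hcard := Finset.card_filter_add_card_filter_not (s := S.erase v) (fun w => G.Adj v w)
    rw [Finset.card_erase_of_mem hv] at hcard
    have h2 : 2 ^ (n+1) = 2 ^ n + 2 ^ n := by ring
    by_cases hc : 2 ^ n ≤ ((S.erase v).filter (fun w => G.Adj v w)).card
    · obtain ⟨T, hT, h | h⟩ := ih (k-1) l (by omega) _ hc
      · have hvT : v ∉ T := fun h' => by
          have := hT h'; simp at this
        refine ⟨insert v T, ?_, Or.inl ⟨by rw [Finset.card_insert_of_notMem hvT]; omega, ?_⟩⟩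
        · intro w hw
          rcases Finset.mem_insert.1 hw with rfl | hw
          · exact hv
          · exact Finset.mem_of_mem_erase (Finset.mem_filter.1 (hT hw)).1
        · intro a ha b hb hab
          rcases Finset.mem_insert.1 ha with rfl | ha' <;>
            rcases Finset.mem_insert.1 hb with rfl | hb'
          · exact absurd rfl hab
          · exact (Finset.mem_filter.1 (hT hb')).2
          · exact (Finset.mem_filter.1 (hT ha')).2.symm
          · exact h.2 a ha' b hb' hab
      · exact ⟨T, fun w hw => Finset.mem_of_mem_erase (Finset.mem_filter.1 (hT hw)).1, Or.inr h⟩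
    · have hc' : 2 ^ n ≤ ((S.erase v).filter (fun w => ¬ G.Adj v w)).card := by omega
      obtain ⟨T, hT, h | h⟩ := ih k (l-1) (by omega) _ hc'
      · exact ⟨T, fun w hw => Finset.mem_of_mem_erase (Finset.mem_filter.1 (hT hw)).1, Or.inl h⟩
      · have hvT : v ∉ T := fun h' => by
          have := hT h'; simp at this
        refine ⟨insert v T, ?_, Or.inr ⟨by rw [Finset.card_insert_of_notMem hvT]; omega, ?_⟩⟩
        · intro w hw
          rcases Finset.mem_insert.1 hw with rfl | hw
          · exact hv
          · exact Finset.mem_of_mem_erase (Finset.mem_filter.1 (hT hw)).1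
        · intro a ha b hb hab
          rcases Finset.mem_insert.1 ha with rfl | ha' <;>
            rcases Finset.mem_insert.1 hb with rfl | hb'
          · exact absurd rfl hab
          · exact (Finset.mem_filter.1 (hT hb')).2
          · exact fun h' => (Finset.mem_filter.1 (hT ha')).2 h'.symm
          · exact h.2 a ha' b hb' hab

lemma ramsey_fin (m : ℕ) : ∃ N, ∀ G : SimpleGraph (Fin N), ∃ (s : Bool) (f : Fin m → Fin N),
    Function.Injective f ∧ ∀ a b, a ≠ b → (G.Adj (f a) (f b) ↔ s = true) := by
  refine ⟨2 ^ (m + m), fun G => ?_⟩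
  obtain ⟨T, -, h | h⟩ := ramsey G (m+m) m m le_rfl Finset.univ (by simp)
  · let e := T.equivFinOfCardEq h.1
    refine ⟨true, fun a => (e.symm a : Fin _), Subtype.val_injective.comp e.symm.injective, ?_⟩
    intro a b hab
    simp only [iff_true]
    exact h.2 _ (e.symm a).2 _ (e.symm b).2
      (fun h => hab (e.symm.injective (Subtype.ext h)))
  · let e := T.equivFinOfCardEq h.1
    refine ⟨false, fun a => (e.symm a : Fin _), Subtype.val_injective.comp e.symm.injective, ?_⟩
    intro a b hab
    simp only [Bool.false_eq_true, iff_false]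
    exact h.2 _ (e.symm a).2 _ (e.symm b).2
      (fun h => hab (e.symm.injective (Subtype.ext h)))

/-- extension of a graph along part-wise injections -/
lemma ext_template {Q : GraphClass} {r m N : ℕ} (D : Fin r → SimpleGraph (Fin N))
    (hD : ∀ F : SimpleGraph (Fin r × Fin N),
      (∀ i a b, F.Adj (i, a) (i, b) ↔ (D i).Adj a b) → InQ Q F)
    (f : Fin r → Fin m → Fin N) (hf : ∀ i, Function.Injective (f i))
    (F : SimpleGraph (Fin r × Fin m))
    (hF : ∀ i a b, F.Adj (i, a) (i, b) ↔ (D i).Adj (f i a) (f i b)) : InQ Q F := by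
  let F' : SimpleGraph (Fin r × Fin N) :=
    { Adj := fun p q => (p.1 = q.1 ∧ (D p.1).Adj p.2 q.2) ∨
        (p.1 ≠ q.1 ∧ ∃ a b, f p.1 a = p.2 ∧ f q.1 b = q.2 ∧ F.Adj (p.1, a) (q.1, b))
      symm := ⟨by
        rintro ⟨i, x⟩ ⟨j, y⟩ (⟨h1, h2⟩ | ⟨h1, a, b, h2, h3, h4⟩)
        · simp only at h1; subst h1; exact Or.inl ⟨rfl, h2.symm⟩
        · exact Or.inr ⟨Ne.symm h1, b, a, h3, h2, h4.symm⟩⟩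
      loopless := ⟨by
        rintro ⟨i, x⟩ (⟨h1, h2⟩ | ⟨h1, -⟩)
        · exact (D i).loopless.irrefl _ h2
        · exact h1 rfl⟩ }
  have h1 : InQ Q F' := hD F' fun i a b => by simp [F']
  have h2 : F = F'.comap (fun p : Fin r × Fin m => (p.1, f p.1 p.2)) := by
    ext ⟨i, a⟩ ⟨j, b⟩
    simp only [SimpleGraph.comap_adj, F']
    by_cases hij : i = j
    · subst hij; simp [hF]
    · simp only [hij, false_and, false_or, ne_eq, not_false_eq_true, true_and]
      constructor
      · intro h; exact ⟨a, b, rfl, rfl, h⟩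
      · rintro ⟨a', b', ha, hb, h⟩
        rw [hf _ ha, hf _ hb] at h; exact h
  rw [h2]
  refine h1.comap _ ?_
  rintro ⟨i, a⟩ ⟨j, b⟩ h
  simp only [Prod.mk.injEq] at h
  obtain ⟨rfl, h⟩ := h
  rw [hf _ h]

lemma TG_anti {Q : GraphClass} {r : ℕ} (s : Fin r → Bool) {m m' : ℕ} (hm : m ≤ m')
    (h : TG Q s m') : TG Q s m := by
  intro F hF
  refine ext_template (N := m') (fun i => if s i then ⊤ else ⊥) (fun F' hF' => h F' ?_)
    (fun _ => Fin.castLE hm) (fun _ => Fin.castLE_injective hm) F ?_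
  · intro i a b hab
    rw [hF']
    by_cases hs : s i <;> simp [hs, hab]
  · intro i a b
    by_cases hab : a = b
    · subst hab; simp
    · have : Fin.castLE hm a ≠ Fin.castLE hm b := fun h => hab (Fin.castLE_injective hm h)
      rw [hF i a b hab]
      by_cases hs : s i <;> simp [hs, hab]

lemma exists_signs {Q : GraphClass} {r : ℕ} (h : Good Q r) : ∃ s : Fin r → Bool, ∀ m, TG Q s m := by
  have h1 : ∀ m, ∃ s : Fin r → Bool, TG Q s m := by
    intro m
    obtain ⟨N, hN⟩ := ramsey_fin m
    obtain ⟨D, hD⟩ := h N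
    choose s f hf hs using fun i => hN (D i)
    refine ⟨s, fun F hF => ext_template D hD f hf F fun i a b => ?_⟩
    by_cases hab : a = b
    · subst hab; simp
    · rw [hF i a b hab, hs i a b hab]
  by_contra hcon
  push Not at hcon
  choose M hM using hcon
  obtain ⟨s, hs⟩ := h1 (Finset.univ.sup M)
  exact hM s (TG_anti s (Finset.le_sup (Finset.mem_univ s)) hs)

lemma sign_mem {Q : GraphClass} {r : ℕ} {s : Fin r → Bool} (h : ∀ m, TG Q s m) {n : ℕ}
    (F : SimpleGraph (Fin n)) (c : Fin n → Fin r)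
    (hF : ∀ u v, u ≠ v → c u = c v → (F.Adj u v ↔ s (c u) = true)) : F ∈ Q n := by
  apply InQ.mem
  let F' : SimpleGraph (Fin r × Fin n) :=
    { Adj := fun p q => (p.1 = q.1 ∧ p.2 ≠ q.2 ∧ s p.1 = true) ∨
        (p.1 ≠ q.1 ∧ c p.2 = p.1 ∧ c q.2 = q.1 ∧ F.Adj p.2 q.2)
      symm := ⟨by
        rintro ⟨i, x⟩ ⟨j, y⟩ (⟨h1, h2, h3⟩ | ⟨h1, h2, h3, h4⟩)
        · simp only at h1; subst h1; exact Or.inl ⟨rfl, h2.symm, h3⟩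
        · exact Or.inr ⟨Ne.symm h1, h3, h2, h4.symm⟩⟩
      loopless := ⟨by
        rintro ⟨i, x⟩ (⟨h1, h2, -⟩ | ⟨h1, -⟩)
        · exact h2 rfl
        · exact h1 rfl⟩ }
  have h1 : InQ Q F' := h n F' fun i a b hab => by simp [F', hab]
  have h2 : F = F'.comap (fun v => (c v, v)) := by
    ext u v
    simp only [SimpleGraph.comap_adj, F']
    by_cases huv : u = v
    · subst huv; simp
    · by_cases hc : c u = c v
      · rw [hF u v huv hc]; simp [huv, hc]
      · simp [hc]
  rw [h2]
  exact h1.comap _ fun a b hab => (Prod.ext_iff.1 hab).2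

lemma all_mem {Q : GraphClass} {n : ℕ} (h : Good Q n) (F : SimpleGraph (Fin n)) : F ∈ Q n := by
  apply InQ.mem
  obtain ⟨D, hD⟩ := h 1
  have h1 : InQ Q (F.comap (fun p : Fin n × Fin 1 => p.1)) := hD _ fun i a b => by
    have hab : a = b := Subsingleton.elim _ _
    subst hab; simp
  have h2 := h1.comap (fun v : Fin n => (v, (0 : Fin 1))) fun a b hab => (Prod.ext_iff.1 hab).1
  exact h2

lemma good_dichotomy {Q : GraphClass} (h : Good Q 1) :
    (∀ r, 1 ≤ r → Good Q r) ∨ ∃ r, 1 ≤ r ∧ Good Q r ∧ ¬ Good Q (r+1) := by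
  by_cases hcon : ∃ r, 1 ≤ r ∧ Good Q r ∧ ¬ Good Q (r+1)
  · exact Or.inr hcon
  · left
    push Not at hcon
    intro r hr
    induction r, hr using Nat.le_induction with
    | base => exact h
    | succ r hr ih => exact hcon r hr ih


lemma count_lower {Q : GraphClass} {n : ℕ} (H B : SimpleGraph (Fin n)) [DecidableRel H.Adj]
    (hd : Disjoint H.edgeSet B.edgeSet)
    (h : ∀ A : Set (Sym2 (Fin n)), A ⊆ H.edgeSet → SimpleGraph.fromEdgeSet A ⊔ B ∈ Q n) :
    (2:ℝ) ^ H.edgeFinset.card ≤ Nat.card ↥(Q n) := by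
  classical
  let f : ↥(H.edgeFinset.powerset) → ↥(Q n) := fun A =>
    ⟨SimpleGraph.fromEdgeSet (A.1 : Set (Sym2 (Fin n))) ⊔ B, h _ (fun e he => by
      have := Finset.mem_powerset.1 A.2 he
      simpa using this)⟩
  have hf : Function.Injective f := by
    intro A A' hAA
    have h1 : SimpleGraph.fromEdgeSet (A.1 : Set (Sym2 (Fin n))) ⊔ B =
      SimpleGraph.fromEdgeSet (A'.1 : Set (Sym2 (Fin n))) ⊔ B := congrArg Subtype.val hAA
    have key : ∀ C : ↥(H.edgeFinset.powerset), ∀ e, e ∈ C.1 ↔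
        (e ∈ H.edgeSet ∧ e ∈ (SimpleGraph.fromEdgeSet (C.1 : Set (Sym2 (Fin n))) ⊔ B).edgeSet) := by
      intro C e
      have hC : ∀ e ∈ C.1, e ∈ H.edgeSet := fun e he => by
        have := Finset.mem_powerset.1 C.2 he
        simpa using this
      rw [SimpleGraph.edgeSet_sup, SimpleGraph.edgeSet_fromEdgeSet]
      constructor
      · intro he
        refine ⟨hC e he, Or.inl ⟨he, ?_⟩⟩
        exact SimpleGraph.not_isDiag_of_mem_edgeSet _ (hC e he)
      · rintro ⟨h1, h2 | h2⟩
        · exact h2.1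
        · exact absurd h2 (Set.disjoint_left.1 hd h1)
    apply Subtype.ext
    ext e
    rw [key A e, key A' e, h1]
  have := Nat.card_le_card_of_injective f hf
  rw [Nat.card_eq_fintype_card, Fintype.card_coe, Finset.card_powerset] at this
  exact_mod_cast this

lemma card_all_le {Q : GraphClass} (n : ℕ) : (Nat.card ↥(Q n) : ℝ) ≤ (2:ℝ) ^ (n.choose 2) := by
  classical
  have h1 : Nat.card ↥(Q n) ≤ Nat.card (SimpleGraph (Fin n)) :=
    Nat.card_le_card_of_injective _ Subtype.val_injective
  let f : SimpleGraph (Fin n) → ↥((⊤ : SimpleGraph (Fin n)).edgeFinset.powerset) := fun G =>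
    ⟨G.edgeFinset, Finset.mem_powerset.2 (SimpleGraph.edgeFinset_mono le_top)⟩
  have hf : Function.Injective f := by
    intro G G' h
    exact SimpleGraph.edgeFinset_inj.1 (congrArg Subtype.val h)
  have h2 := Nat.card_le_card_of_injective f hf
  rw [Nat.card_eq_fintype_card (α := ↥((⊤ : SimpleGraph (Fin n)).edgeFinset.powerset)),
    Fintype.card_coe, Finset.card_powerset,
    SimpleGraph.card_edgeFinset_top_eq_card_choose_two, Fintype.card_fin] at h2
  exact_mod_cast h1.trans h2

lemma choose2_eq (n : ℕ) : ((n.choose 2 : ℕ) : ℝ) = choose2 n := by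
  rw [Nat.cast_choose_two]; rfl

lemma choose2_nonneg (n : ℕ) : 0 ≤ choose2 n := by
  rw [← choose2_eq]; positivity

lemma count_infinite {Q : GraphClass} (h : ∀ r, 1 ≤ r → Good Q r) (ε : ℝ) (hε : 0 < ε) :
    ∃ N : ℕ, ∀ n ≥ N, (2 : ℝ) ^ ((1 - ε) * choose2 n) ≤ (Nat.card ↥(Q n) : ℝ) ∧
          (Nat.card ↥(Q n) : ℝ) ≤ (2 : ℝ) ^ ((1 + ε) * choose2 n) := by
  classical
  refine ⟨1, fun n hn => ⟨?_, ?_⟩⟩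
  · have := count_lower (Q := Q) (⊤ : SimpleGraph (Fin n)) ⊥ (by simp)
      (fun A _ => all_mem (h n hn) _)
    refine le_trans ?_ this
    rw [SimpleGraph.card_edgeFinset_top_eq_card_choose_two, Fintype.card_fin, ← Real.rpow_natCast,
      choose2_eq]
    exact Real.rpow_le_rpow_of_exponent_le (by norm_num) (by nlinarith [choose2_nonneg n])
  · refine (card_all_le n).trans ?_
    rw [← Real.rpow_natCast, choose2_eq]
    exact Real.rpow_le_rpow_of_exponent_le (by norm_num) (by nlinarith [choose2_nonneg n])

lemma turan_edges_ge (n r : ℕ) (hr : 1 ≤ r) :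
    (1 - 1 / (r:ℝ)) * ((n:ℝ)^2 - r ^ 2) / 2 - 1 ≤ ((SimpleGraph.turanGraph n r).edgeFinset.card : ℝ) := by
  rw [SimpleGraph.card_edgeFinset_turanGraph]
  have hr0 : (0:ℝ) < r := by exact_mod_cast hr
  have h1 := Nat.lt_div_mul_add (a := (n ^ 2 - (n % r) ^ 2) * (r - 1)) (b := 2 * r) (by omega)
  set q := (n ^ 2 - (n % r) ^ 2) * (r - 1) / (2 * r) with hq
  have hle : (n % r)^2 ≤ n ^ 2 := Nat.pow_le_pow_left (Nat.mod_le _ _) 2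
  have h2 : (((n ^ 2 - (n % r) ^ 2) * (r - 1) : ℕ) : ℝ) ≤ ((q * (2 * r) + 2 * r : ℕ) : ℝ) := by
    exact_mod_cast h1.le
  rw [Nat.cast_mul, Nat.cast_sub hle, Nat.cast_sub hr] at h2
  push_cast at h2
  have h3 : ((n % r : ℕ) : ℝ) ^ 2 ≤ (r:ℝ) ^ 2 := by
    have : n % r ≤ r := (Nat.mod_lt _ hr).le
    have : ((n % r : ℕ):ℝ) ≤ r := by exact_mod_cast this
    gcongr
  push_cast
  have h4 : ((n:ℝ)^2 - r^2) * (r - 1) ≤ q * (2 * r) + 2 * r := by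
    refine le_trans (mul_le_mul_of_nonneg_right (by linarith) ?_) h2
    have : (1:ℝ) ≤ r := by exact_mod_cast hr
    linarith
  have h5 : (1 - 1 / (r:ℝ)) * ((n:ℝ)^2 - r ^ 2) / 2 = ((n:ℝ)^2 - r^2) * (r - 1) / (2 * r) := by
    field_simp
  have h6 : ((n:ℝ)^2 - r^2) * (r - 1) / (2 * r) ≤ q + 1 := by
    rw [div_le_iff₀ (by positivity)]; linarith
  have h7 : (0:ℝ) ≤ ((n % r).choose 2 : ℕ) := by positivity
  rw [h5]; linarith

lemma count_lower_finite {Q : GraphClass} {r : ℕ} (hr : 1 ≤ r) (h : Good Q r) (ε : ℝ)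
    (hε : 0 < ε) :
    ∃ N : ℕ, ∀ n ≥ N, (2 : ℝ) ^ ((1 - 1 / (r:ℝ) - ε) * choose2 n) ≤ (Nat.card ↥(Q n) : ℝ) := by
  classical
  obtain ⟨s, hs⟩ := exists_signs h
  obtain ⟨N, hN⟩ := exists_nat_gt (((r:ℝ)^2 + 2) / ε + 1)
  refine ⟨N, fun n hn => ?_⟩
  let c : Fin n → Fin r := fun v => ⟨v % r, Nat.mod_lt _ hr⟩
  let B : SimpleGraph (Fin n) :=
    { Adj := fun u v => u ≠ v ∧ c u = c v ∧ s (c u) = true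
      symm := ⟨fun u v h => ⟨h.1.symm, h.2.1.symm, by rw [← h.2.1]; exact h.2.2⟩⟩
      loopless := ⟨fun u h => h.1 rfl⟩ }
  have hcH : ∀ u v : Fin n, (SimpleGraph.turanGraph n r).Adj u v ↔ c u ≠ c v := fun u v => by
    simp [SimpleGraph.turanGraph, c]
  have := count_lower (Q := Q) (SimpleGraph.turanGraph n r) B (by
    rw [Set.disjoint_left]
    intro e
    induction e using Sym2.ind with
    | _ u v =>
      rw [SimpleGraph.mem_edgeSet, SimpleGraph.mem_edgeSet, hcH]
      exact fun h1 h2 => h1 h2.2.1) (fun A hA => by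
    refine sign_mem hs _ c fun u v huv hc => ?_
    rw [SimpleGraph.sup_adj, SimpleGraph.fromEdgeSet_adj]
    constructor
    · rintro (h1 | h1)
      · have := hA h1.1
        rw [SimpleGraph.mem_edgeSet, hcH] at this
        exact absurd hc this
      · exact h1.2.2
    · intro h1
      exact Or.inr ⟨huv, hc, h1⟩)
  refine le_trans ?_ this
  rw [← Real.rpow_natCast]
  refine Real.rpow_le_rpow_of_exponent_le (by norm_num) (le_trans ?_ (turan_edges_ge n r hr))
  have hn' : ((r:ℝ)^2 + 2) / ε + 1 < n := lt_of_lt_of_le hN (by exact_mod_cast hn)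
  have hr1 : (1:ℝ) ≤ r := by exact_mod_cast hr
  have ha0 : 0 ≤ 1 - 1 / (r:ℝ) := by
    rw [sub_nonneg, div_le_one (by linarith)]; exact hr1
  have ha1 : 1 - 1 / (r:ℝ) ≤ 1 := by
    have : 0 ≤ 1 / (r:ℝ) := by positivity
    linarith
  set a := 1 - 1 / (r:ℝ)
  have hn2 : (r:ℝ)^2 + 2 < ε * (n - 1) := by
    rw [← lt_sub_iff_add_lt, div_lt_iff₀ hε] at hn'; linarith
  have hn1 : (1:ℝ) ≤ n := by
    have : 0 ≤ ((r:ℝ)^2 + 2) / ε := by positivity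
    linarith
  have h1 : (r:ℝ)^2 + 2 ≤ ε * (n - 1) * n := by nlinarith
  have h2 : a * (r:ℝ)^2 ≤ 1 * r ^ 2 := mul_le_mul_of_nonneg_right ha1 (by positivity)
  have h3 : 0 ≤ a * n := by positivity
  unfold choose2
  nlinarith


lemma small_subsets (c : ℝ) (hc : 0 < c) : ∃ θ : ℝ, 0 < θ ∧ ∀ {α : Type} [DecidableEq α] (X : Finset α),
    (((X.powerset).filter (fun E => (E.card : ℝ) ≤ θ * X.card)).card : ℝ) ≤ (2:ℝ) ^ (c * X.card) := by
  have hl : 0 < Real.log 2 := Real.log_pos (by norm_num)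
  obtain ⟨b, hb⟩ := exists_pow_lt_of_lt_one (show 0 < c / 2 * Real.log 2 by positivity)
    (show (1/2 : ℝ) < 1 by norm_num)
  refine ⟨c / (2 * (b + 1)), by positivity, fun {α} _ X => ?_⟩
  set θ := c / (2 * ((b:ℝ) + 1)) with hθ
  set F := (X.powerset).filter (fun E => (E.card : ℝ) ≤ θ * X.card)
  set x : ℝ := (1/2) ^ b with hx
  have hx0 : 0 < x := by positivity
  have hxr : x = (2:ℝ) ^ (-(b:ℝ)) := by
    rw [hx, Real.rpow_neg (by norm_num), Real.rpow_natCast]; simp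
  have h1 : (F.card : ℝ) * (2:ℝ) ^ (-(b:ℝ) * (θ * X.card)) ≤ (1 + x) ^ X.card := by
    have h2 := Finset.sum_pow_mul_eq_add_pow x 1 X
    rw [add_comm] at h2
    rw [← h2]
    calc (F.card : ℝ) * (2:ℝ) ^ (-(b:ℝ) * (θ * X.card))
        = ∑ E ∈ F, (2:ℝ) ^ (-(b:ℝ) * (θ * X.card)) := by simp
      _ ≤ ∑ E ∈ F, x ^ E.card * 1 ^ (X.card - E.card) := by
          refine Finset.sum_le_sum fun E hE => ?_
          have hE2 := (Finset.mem_filter.1 hE).2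
          rw [one_pow, mul_one, hxr, ← Real.rpow_natCast, ← Real.rpow_mul (by norm_num)]
          refine Real.rpow_le_rpow_of_exponent_le (by norm_num) ?_
          nlinarith [(Nat.cast_nonneg b : (0:ℝ) ≤ b)]
      _ ≤ _ := Finset.sum_le_sum_of_subset_of_nonneg (Finset.filter_subset _ _)
          (fun _ _ _ => by positivity)
  have h3 : (1 + x) ^ X.card ≤ (2:ℝ) ^ (c / 2 * X.card) := by
    rw [Real.rpow_mul (by norm_num), Real.rpow_natCast]
    refine pow_le_pow_left₀ (by positivity) ?_ _
    rw [Real.rpow_def_of_pos (by norm_num)]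
    have := Real.add_one_le_exp x
    have h4 : Real.exp x ≤ Real.exp (Real.log 2 * (c/2)) := Real.exp_le_exp.2 (by linarith)
    linarith
  have h5 : (2:ℝ) ^ (c * X.card) = (2:ℝ) ^ (c * X.card + -(b:ℝ) * (θ * X.card)) /
      (2:ℝ) ^ (-(b:ℝ) * (θ * X.card)) := by
    rw [← Real.rpow_sub (by norm_num)]; congr 1; ring
  rw [h5, le_div_iff₀ (by positivity)]
  refine h1.trans (h3.trans ?_)
  refine Real.rpow_le_rpow_of_exponent_le (by norm_num) ?_
  have h6 : (b:ℝ) * θ ≤ c / 2 := by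
    rw [hθ, mul_div_assoc', div_le_div_iff₀ (by positivity) (by norm_num)]
    nlinarith [(Nat.cast_nonneg b : (0:ℝ) ≤ b)]
  nlinarith [(Nat.cast_nonneg X.card : (0:ℝ) ≤ X.card)]

/-- one descent step -/
lemma descent {V : Type} [Fintype V] (A U φ : V → V → ℝ) (δ : ℝ) (hδ : 0 ≤ δ)
    (hA : ∀ u v, A u v ∈ Icc (0:ℝ) 1) (hφ : ∀ u v, |φ u v| ≤ 1)
    (h : δ * (Fintype.card V:ℝ)^2 ≤ |∑ u, ∑ v, (A u v - U u v) * φ u v|) :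
    ∃ t : ℝ, ∑ u, ∑ v, (A u v - max 0 (min 1 (U u v + t * φ u v)))^2 ≤
      ∑ u, ∑ v, (A u v - U u v)^2 - δ^2 * (Fintype.card V:ℝ)^2 := by
  have key : ∀ t : ℝ, ∑ u, ∑ v, (A u v - max 0 (min 1 (U u v + t * φ u v)))^2 ≤
      ∑ u, ∑ v, (A u v - U u v)^2 - 2 * t * (∑ u, ∑ v, (A u v - U u v) * φ u v)
        + t^2 * (Fintype.card V:ℝ)^2 := by
    intro t
    have e : t^2 * (Fintype.card V:ℝ)^2 = ∑ u : V, ∑ v : V, t^2 := by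
      simp; ring
    rw [e, Finset.mul_sum, ← Finset.sum_sub_distrib, ← Finset.sum_add_distrib]
    refine Finset.sum_le_sum fun u _ => ?_
    rw [Finset.mul_sum, ← Finset.sum_sub_distrib, ← Finset.sum_add_distrib]
    refine Finset.sum_le_sum fun v _ => ?_
    have h1 := hA u v
    have h2 : (A u v - max 0 (min 1 (U u v + t * φ u v)))^2 ≤ (A u v - (U u v + t * φ u v))^2 := by
      rw [sq_le_sq]
      obtain ⟨h3, h4⟩ := h1
      rcases le_total (U u v + t * φ u v) 0 with h5 | h5
      · rw [max_eq_left (by rw [min_le_iff]; right; exact h5), abs_of_nonneg, abs_of_nonneg] <;> linarith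
      · rcases le_total (U u v + t * φ u v) 1 with h6 | h6
        · rw [min_eq_right h6, max_eq_right h5]
        · rw [min_eq_left h6, max_eq_right (by norm_num), abs_of_nonpos, abs_of_nonpos] <;> linarith
    have h3 : φ u v ^ 2 ≤ 1 := by
      have := hφ u v
      rw [← sq_abs]; nlinarith [abs_nonneg (φ u v)]
    nlinarith [sq_nonneg t]
  rcases le_total 0 (∑ u, ∑ v, (A u v - U u v) * φ u v) with h0 | h0
  · rw [abs_of_nonneg h0] at h
    refine ⟨δ, (key δ).trans ?_⟩
    nlinarith
  · rw [abs_of_nonpos h0] at h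
    refine ⟨-δ, (key (-δ)).trans ?_⟩
    nlinarith

/-- `U` passes all the tests -/
def Passes {V : Type} [Fintype V] (A U : V → V → ℝ) (δ η : ℝ) : Prop :=
  (∀ S T : Finset V, |∑ u ∈ S, ∑ v ∈ T, (A u v - U u v)| ≤ δ * (Fintype.card V:ℝ)^2) ∧
  (|∑ u, ∑ v, (A u v - U u v) * (if U u v < η then 1 else 0)| ≤ δ * (Fintype.card V:ℝ)^2) ∧
  (|∑ u, ∑ v, (A u v - U u v) * (if 1 - η < U u v then 1 else 0)| ≤ δ * (Fintype.card V:ℝ)^2)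

lemma weak_reg_step {V : Type} [Fintype V] (A : V → V → ℝ) (δ η : ℝ) (hδ : 0 < δ)
    (hA : ∀ u v, A u v ∈ Icc (0:ℝ) 1) (hs : ∀ u v, A u v = A v u) (j : ℕ) :
    ∃ (k : ℕ) (f : V → Fin k) (g : Fin k → Fin k → ℝ), k ≤ 4 ^ j ∧
      (∀ u v, g (f u) (f v) = g (f v) (f u)) ∧ (∀ a b, g a b ∈ Icc (0:ℝ) 1) ∧
      (Passes A (fun u v => g (f u) (f v)) δ η ∨
        ∑ u, ∑ v, (A u v - g (f u) (f v))^2 ≤ (1 - j * δ^2) * (Fintype.card V:ℝ)^2) := by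
  classical
  induction j with
  | zero =>
    refine ⟨1, fun _ => 0, fun _ _ => 0, by simp, fun _ _ => rfl, fun _ _ => by simp, Or.inr ?_⟩
    have : ∑ u : V, ∑ v : V, (A u v - 0)^2 ≤ ∑ u : V, ∑ v : V, (1:ℝ) := by
      refine Finset.sum_le_sum fun u _ => Finset.sum_le_sum fun v _ => ?_
      have := hA u v
      rw [sub_zero]; nlinarith [this.1, this.2]
    refine this.trans (le_of_eq ?_)
    simp; ring
  | succ j ih =>
    obtain ⟨k, f, g, hk, hgs, hg, h⟩ := ih
    by_cases hP : Passes A (fun u v => g (f u) (f v)) δ η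
    · exact ⟨k, f, g, hk.trans (Nat.pow_le_pow_right (by norm_num) (by omega)), hgs, hg, Or.inl hP⟩
    replace h := h.resolve_left hP
    -- enough : a symmetric test function factoring
    suffices ∃ (k' : ℕ) (f' : V → Fin k') (g₀ ψ : Fin k' → Fin k' → ℝ), k' ≤ 4 ^ (j+1) ∧
        (∀ u v, g₀ (f' u) (f' v) = g (f u) (f v)) ∧ (∀ a b, |ψ a b| ≤ 1) ∧
        (∀ u v, ψ (f' u) (f' v) = ψ (f' v) (f' u)) ∧
        δ * (Fintype.card V:ℝ)^2 ≤ |∑ u, ∑ v, (A u v - g (f u) (f v)) * ψ (f' u) (f' v)| by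
      obtain ⟨k', f', g₀, ψ, hk', hg₀, hψ1, hψs, hψ⟩ := this
      obtain ⟨t, ht⟩ := descent A (fun u v => g (f u) (f v)) (fun u v => ψ (f' u) (f' v)) δ hδ.le hA
        (fun _ _ => hψ1 _ _) hψ
      refine ⟨k', f', fun a b => max 0 (min 1 (g₀ a b + t * ψ a b)), hk', ?_, ?_, Or.inr ?_⟩
      · intro u v
        simp only [hg₀, hψs u v, hgs u v]
      · intro a b
        exact ⟨le_max_left _ _, max_le (by norm_num) (min_le_left _ _)⟩
      · simp only [hg₀]
        push_cast
        linarith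
    have hk1 : k ≤ 4 ^ (j+1) := hk.trans (Nat.pow_le_pow_right (by norm_num) (by omega))
    unfold Passes at hP
    rw [not_and_or, not_and_or] at hP
    rcases hP with hP | hP | hP
    · push Not at hP
      obtain ⟨S, T, hST⟩ := hP
      let e : (Fin k × Bool × Bool) ≃ Fin (k * 4) := Fintype.equivFinOfCardEq (by simp)
      let f' : V → Fin (k*4) := fun u => e (f u, decide (u ∈ S), decide (u ∈ T))
      let b : Bool → ℝ := fun x => if x then 1 else 0
      have hb : ∀ x, b x = 0 ∨ b x = 1 := by intro x; cases x <;> simp [b]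
      let ψ : Fin (k*4) → Fin (k*4) → ℝ := fun x y =>
        (b (e.symm x).2.1 * b (e.symm y).2.2 + b (e.symm y).2.1 * b (e.symm x).2.2) / 2
      refine ⟨k * 4, f', fun x y => g (e.symm x).1 (e.symm y).1, ψ, ?_, ?_, ?_, ?_, ?_⟩
      · rw [pow_succ]; exact Nat.mul_le_mul_right _ hk
      · intro u v; simp [f']
      · intro x y
        simp only [ψ]
        rcases hb (e.symm x).2.1 with h1 | h1 <;> rcases hb (e.symm x).2.2 with h2 | h2 <;>
        rcases hb (e.symm y).2.1 with h3 | h3 <;> rcases hb (e.symm y).2.2 with h4 | h4 <;>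
        rw [h1, h2, h3, h4] <;> norm_num
      · intro u v; simp only [ψ]; ring
      · refine hST.le.trans (le_of_eq ?_)
        congr 1
        have h1 : ∑ u ∈ S, ∑ v ∈ T, (A u v - g (f u) (f v)) =
            ∑ u, ∑ v, (A u v - g (f u) (f v)) * (b (decide (u ∈ S)) * b (decide (v ∈ T))) := by
          rw [← Finset.sum_subset (Finset.subset_univ S)]
          · refine Finset.sum_congr rfl fun u hu => ?_
            rw [← Finset.sum_subset (Finset.subset_univ T)]
            · refine Finset.sum_congr rfl fun v hv => ?_
              simp [b, hu, hv]
            · intro v _ hv; simp [b, hv]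
          · intro u _ hu; simp [b, hu]
        have h2 : ∑ u, ∑ v, (A u v - g (f u) (f v)) * (b (decide (u ∈ S)) * b (decide (v ∈ T))) =
            ∑ u, ∑ v, (A u v - g (f u) (f v)) * (b (decide (v ∈ S)) * b (decide (u ∈ T))) := by
          rw [Finset.sum_comm]
          refine Finset.sum_congr rfl fun u _ => Finset.sum_congr rfl fun v _ => ?_
          rw [hs v u, hgs v u]
        have h3 : ∀ u v, (A u v - g (f u) (f v)) * ψ (f' u) (f' v) =
            ((A u v - g (f u) (f v)) * (b (decide (u ∈ S)) * b (decide (v ∈ T)))) / 2 +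
            ((A u v - g (f u) (f v)) * (b (decide (v ∈ S)) * b (decide (u ∈ T)))) / 2 := by
          intro u v; simp only [ψ, f', Equiv.symm_apply_apply]; ring
        simp only [h3, Finset.sum_add_distrib, ← Finset.sum_div]
        rw [h1, ← h2]; ring
    · rw [not_le] at hP
      refine ⟨k, f, g, fun a b => if g a b < η then 1 else 0, hk1, fun _ _ => rfl, ?_, ?_, hP.le⟩
      · intro a b; dsimp only; split_ifs <;> simp
      · intro u v; simp only [hgs u v]
    · rw [not_le] at hP
      refine ⟨k, f, g, fun a b => if 1 - η < g a b then 1 else 0, hk1, fun _ _ => rfl, ?_, ?_, hP.le⟩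
      · intro a b; dsimp only; split_ifs <;> simp
      · intro u v; simp only [hgs u v]

lemma weak_reg (δ : ℝ) (hδ : 0 < δ) : ∃ K : ℕ, ∀ (η : ℝ) {V : Type} [Fintype V] [Nonempty V]
    (A : V → V → ℝ) (hA : ∀ u v, A u v ∈ Icc (0:ℝ) 1) (hs : ∀ u v, A u v = A v u),
    ∃ (f : V → Fin K) (g : Fin K → Fin K → ℝ),
      (∀ u v, g (f u) (f v) = g (f v) (f u)) ∧ (∀ a b, g a b ∈ Icc (0:ℝ) 1) ∧
      Passes A (fun u v => g (f u) (f v)) δ η := by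
  classical
  obtain ⟨j, hj⟩ := exists_nat_gt (1 / δ^2)
  refine ⟨4 ^ j, fun η {V} _ _ A hA hs => ?_⟩
  obtain ⟨k, f, g, hk, hgs, hg, h⟩ := weak_reg_step A δ η hδ hA hs j
  have hP : Passes A (fun u v => g (f u) (f v)) δ η := by
    refine h.resolve_right fun h => ?_
    have h0 : 0 ≤ ∑ u, ∑ v, (A u v - g (f u) (f v))^2 :=
      Finset.sum_nonneg fun _ _ => Finset.sum_nonneg fun _ _ => sq_nonneg _
    have h1 : (0:ℝ) < Fintype.card V := by exact_mod_cast Fintype.card_pos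
    have h2 : 1 - j * δ^2 < 0 := by
      rw [div_lt_iff₀ (by positivity)] at hj; linarith
    nlinarith [pow_pos h1 2]
  have hgk : ∀ u, (f u : ℕ) < k := fun u => (f u).2
  refine ⟨fun u => Fin.castLE hk (f u), fun a b => if h : (a:ℕ) < k ∧ (b:ℕ) < k then g ⟨a, h.1⟩ ⟨b, h.2⟩ else 0,
    ?_, ?_, ?_⟩
  · intro u v; simp [hgs u v]
  · intro a b
    dsimp only
    split_ifs
    · exact hg _ _
    · simp
  · simpa using hP


/-- uniform measure on `Fin n` -/
noncomputable def unif (n : ℕ) : Measure (Fin n) := (n : ENNReal)⁻¹ • Measure.count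

lemma unif_singleton {n : ℕ} (v : Fin n) : (unif n).real {v} = 1 / n := by
  simp [unif, Measure.real, Measure.count_singleton]

instance unif_prob (n : ℕ) [NeZero n] : IsProbabilityMeasure (unif n) := by
  constructor
  have h : (n : ENNReal) ≠ 0 := by exact_mod_cast NeZero.ne n
  simp [unif]
  exact ENNReal.inv_mul_cancel h (by simp)

lemma unif_pair {n : ℕ} [NeZero n] (p : Fin n × Fin n) : ((unif n).prod (unif n)).real {p} = (1 / n) ^ 2 := by
  obtain ⟨u, v⟩ := p
  rw [← Set.singleton_prod_singleton, measureReal_prod_prod, unif_singleton, unif_singleton]; ring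

lemma unif_integral {n : ℕ} [NeZero n] (D : Fin n → Fin n → ℝ) :
    ∫ p, D p.1 p.2 ∂((unif n).prod (unif n)) = (1/n)^2 * ∑ u, ∑ v, D u v := by
  rw [integral_fintype Integrable.of_finite, Fintype.sum_prod_type]
  simp only [unif_pair, smul_eq_mul, Finset.mul_sum]

lemma unif_real {n : ℕ} [NeZero n] (R : Finset (Fin n × Fin n)) :
    ((unif n).prod (unif n)).real (R : Set (Fin n × Fin n)) = (1/n)^2 * R.card := by
  rw [← sum_measureReal_singleton]
  simp only [unif_pair]; simp; ring

lemma struct_bound {Q : GraphClass} (hQ : IsHereditary Q) {r : ℕ} (hr : 1 ≤ r) (hng : ¬ Good Q (r+1))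
    (ε η : ℝ) (hε : 0 < ε) (hη : 0 < η) : ∃ δ > 0, ∃ N : ℕ, ∀ n ≥ N, ∀ G ∈ Q n, ∀ [DecidableRel G.Adj]
      (U : Fin n → Fin n → ℝ), (∀ u v, U u v = U v u) → (∀ u v, U u v ∈ Icc (0:ℝ) 1) →
      (∀ S T : Finset (Fin n), |∑ u ∈ S, ∑ v ∈ T, ((if G.Adj u v then 1 else 0) - U u v)| ≤ δ * (n:ℝ)^2) →
      ((Finset.univ.filter fun p : Fin n × Fin n => U p.1 p.2 ∈ Icc η (1-η)).card : ℝ) ≤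
        (1 - 1 / r + ε) * (n:ℝ)^2 := by
  classical
  unfold Good at hng
  push Not at hng
  obtain ⟨m, hm⟩ := hng
  obtain ⟨c, hc, hS⟩ := lemmaS r hr ε hε
  obtain ⟨κ, hκ, N, hM⟩ := lemmaM (r+1) m c η hc hη
  refine ⟨κ, hκ, N + 1, fun n hn G hG _ U hUs hU hcut => ?_⟩
  by_contra hlt
  rw [not_le] at hlt
  haveI : NeZero n := ⟨by omega⟩
  have hn0 : (0:ℝ) < n := by exact_mod_cast (show 0 < n by omega)
  let R : Set (Fin n × Fin n) := {p | U p.1 p.2 ∈ Icc η (1-η)}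
  have hR : 1 - 1 / (r:ℝ) + ε ≤ ((unif n).prod (unif n)).real R := by
    have : R = ((Finset.univ.filter fun p : Fin n × Fin n => U p.1 p.2 ∈ Icc η (1-η) : Finset _) : Set _) := by
      ext p; simp [R]
    rw [this, unif_real]
    rw [one_div_pow, one_div_mul_eq_div, le_div_iff₀ (by positivity)]
    exact hlt.le
  have h1 := hS (unif n) R (Set.toFinite _).measurableSet (fun x y h => by
    simp only [R, mem_setOf_eq] at h ⊢; rwa [hUs y x]) hR
  obtain ⟨D, hD⟩ := hM (unif n) U hUs Measurable.of_discrete hU h1 n (by omega) G id measurable_id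
    (fun v => by rw [Set.preimage_id, unif_singleton]) (by
      intro S T hS hT
      rw [← integral_indicator (hS.prod hT)]
      have e : ∀ p : Fin n × Fin n, (S ×ˢ T).indicator (fun p : Fin n × Fin n =>
        U p.1 p.2 - if G.Adj (id p.1) (id p.2) then 1 else 0) p =
        (fun u v => if u ∈ S then (if v ∈ T then (U u v - if G.Adj u v then 1 else 0) else 0) else 0) p.1 p.2 := by
        intro p
        simp only [Set.indicator, Set.mem_prod, id]
        by_cases h1 : p.1 ∈ S <;> by_cases h2 : p.2 ∈ T <;> simp only [h1, h2] <;> simp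
      clear hm hM
      simp only [e]
      rw [unif_integral (fun u v => if u ∈ S then (if v ∈ T then (U u v - if G.Adj u v then 1 else 0) else 0) else 0)]
      have h2 := hcut (Finset.univ.filter (· ∈ S)) (Finset.univ.filter (· ∈ T))
      simp only [Finset.sum_filter] at h2
      have h3 : (∑ u : Fin n, ∑ v : Fin n, (if u ∈ S then (if v ∈ T then (U u v - if G.Adj u v then (1:ℝ) else 0) else 0) else 0))
        = - ∑ a : Fin n, if a ∈ S then ∑ a_1 : Fin n, if a_1 ∈ T then (if G.Adj a a_1 then 1 else 0) - U a a_1 else 0 else 0 := by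
        rw [← Finset.sum_neg_distrib]
        refine Finset.sum_congr rfl fun u _ => ?_
        by_cases hu : u ∈ S
        · simp only [hu, if_true]
          rw [← Finset.sum_neg_distrib]
          refine Finset.sum_congr rfl fun v _ => ?_
          split_ifs <;> simp
        · simp [hu]
      rw [h3, abs_mul, abs_neg, abs_of_nonneg (by positivity : (0:ℝ) ≤ (1/n)^2), one_div, inv_pow, inv_mul_eq_div,
        div_le_iff₀ (by positivity)]
      exact h2)
  obtain ⟨F, hF, hFQ⟩ := hm D
  obtain ⟨φ, hφ, hφF⟩ := hD F hF
  exact hFQ (hφF ▸ (InQ.of_mem hQ hG).comap φ hφ)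


/-- exceptional pairs -/
noncomputable def excSet {n K : ℕ} (G : SimpleGraph (Fin n)) (f : Fin n → Fin K)
    (τ : Fin K → Fin K → Fin 3) : Finset (Fin n × Fin n) := by
  classical
  exact Finset.univ.filter fun p => τ (f p.1) (f p.2) ≠ 1 ∧ ¬ (G.Adj p.1 p.2 ↔ τ (f p.1) (f p.2) = 2)

/-- free pairs -/
def midSet {n K : ℕ} (f : Fin n → Fin K)
    (τ : Fin K → Fin K → Fin 3) : Finset (Fin n × Fin n) :=
  Finset.univ.filter fun p => τ (f p.1) (f p.2) = 1

lemma exists_data (δ θ : ℝ) (hδ : 0 < δ) (hθ : 0 < θ) (hδθ : δ ≤ θ / 4) : ∃ K : ℕ, ∀ n ≥ 1, ∀ (G : SimpleGraph (Fin n))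
    [DecidableRel G.Adj],
    ∃ (f : Fin n → Fin K) (τ : Fin K → Fin K → Fin 3) (U : Fin n → Fin n → ℝ),
      (∀ u v, U u v = U v u) ∧ (∀ u v, U u v ∈ Icc (0:ℝ) 1) ∧
      (∀ S T : Finset (Fin n), |∑ u ∈ S, ∑ v ∈ T, ((if G.Adj u v then 1 else 0) - U u v)| ≤ δ * (n:ℝ)^2) ∧
      (∀ u v, τ (f u) (f v) = 1 ↔ U u v ∈ Icc (θ/4) (1-θ/4)) ∧
      ((excSet G f τ).card : ℝ) ≤ θ * (n:ℝ)^2 := by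
  classical
  obtain ⟨K, hK⟩ := weak_reg δ hδ
  refine ⟨K, fun n hn G _ => ?_⟩
  haveI : Nonempty (Fin n) := ⟨⟨0, hn⟩⟩
  set η := θ / 4 with hη
  set A : Fin n → Fin n → ℝ := fun u v => if G.Adj u v then 1 else 0 with hA
  obtain ⟨f, g, hgs, hg, h1, h2, h3⟩ := hK η A
    (fun u v => by simp only [hA]; split_ifs <;> simp)
    (fun u v => by simp only [hA, G.adj_comm])
  set U : Fin n → Fin n → ℝ := fun u v => g (f u) (f v) with hU
  set τ : Fin K → Fin K → Fin 3 := fun a b => if g a b < η then 0 else if 1 - η < g a b then 2 else 1 with hτ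
  simp only [Fintype.card_fin] at h1 h2 h3
  have hτ1 : ∀ u v, τ (f u) (f v) = 1 ↔ U u v ∈ Icc η (1-η) := by
    intro u v
    simp only [hτ, hU, mem_Icc]
    split_ifs with h4 h5
    · simp [not_le.2 h4]
    · simp [not_le.2 h5]
    · simp [not_lt.1 h4, not_lt.1 h5]
  refine ⟨f, τ, U, hgs, fun u v => hg _ _, h1, hτ1, ?_⟩
  have hlow : ∑ u, ∑ v, A u v * (if U u v < η then 1 else 0) ≤ (η + δ) * (n:ℝ)^2 := by
    have e : ∑ u, ∑ v, A u v * (if U u v < η then 1 else 0) =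
        ∑ u, ∑ v, (A u v - U u v) * (if U u v < η then 1 else 0) +
        ∑ u, ∑ v, U u v * (if U u v < η then 1 else 0) := by
      rw [← Finset.sum_add_distrib]
      refine Finset.sum_congr rfl fun u _ => ?_
      rw [← Finset.sum_add_distrib]
      refine Finset.sum_congr rfl fun v _ => ?_
      ring
    have : ∑ u, ∑ v, U u v * (if U u v < η then 1 else 0) ≤ ∑ u : Fin n, ∑ v : Fin n, η := by
      refine Finset.sum_le_sum fun u _ => Finset.sum_le_sum fun v _ => ?_
      split_ifs with h
      · rw [mul_one]; exact h.le
      · rw [mul_zero]; positivity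
    simp only [Finset.sum_const, Finset.card_univ, Fintype.card_fin, nsmul_eq_mul] at this
    have h4 := (abs_le.1 h2).2
    rw [e]
    have : ∑ u, ∑ v, (A u v - U u v) * (if U u v < η then 1 else 0) ≤ δ * (n:ℝ)^2 := h4
    nlinarith
  have hhigh : ∑ u, ∑ v, (1 - A u v) * (if 1 - η < U u v then 1 else 0) ≤ (η + δ) * (n:ℝ)^2 := by
    have e : ∑ u, ∑ v, (1 - A u v) * (if 1 - η < U u v then 1 else 0) =
        - ∑ u, ∑ v, (A u v - U u v) * (if 1 - η < U u v then 1 else 0) +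
        ∑ u, ∑ v, (1 - U u v) * (if 1 - η < U u v then 1 else 0) := by
      rw [← Finset.sum_neg_distrib, ← Finset.sum_add_distrib]
      refine Finset.sum_congr rfl fun u _ => ?_
      rw [← Finset.sum_neg_distrib, ← Finset.sum_add_distrib]
      refine Finset.sum_congr rfl fun v _ => ?_
      ring
    have : ∑ u, ∑ v, (1 - U u v) * (if 1 - η < U u v then 1 else 0) ≤ ∑ u : Fin n, ∑ v : Fin n, η := by
      refine Finset.sum_le_sum fun u _ => Finset.sum_le_sum fun v _ => ?_
      split_ifs with h
      · rw [mul_one]; linarith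
      · rw [mul_zero]; positivity
    simp only [Finset.sum_const, Finset.card_univ, Fintype.card_fin, nsmul_eq_mul] at this
    have h4 := (abs_le.1 h3).1
    rw [e]
    have : -(δ * (n:ℝ)^2) ≤ ∑ u, ∑ v, (A u v - U u v) * (if 1 - η < U u v then 1 else 0) := h4
    nlinarith
  have hcard : ((excSet G f τ).card : ℝ) ≤ ∑ u, ∑ v, A u v * (if U u v < η then 1 else 0) +
      ∑ u, ∑ v, (1 - A u v) * (if 1 - η < U u v then 1 else 0) := by
    have : ((excSet G f τ).card : ℝ) = ∑ u, ∑ v, (if (u,v) ∈ excSet G f τ then (1:ℝ) else 0) := by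
      rw [← Fintype.sum_prod_type (f := fun p => if p ∈ excSet G f τ then (1:ℝ) else 0)]
      simp
    rw [this, ← Finset.sum_add_distrib]
    refine Finset.sum_le_sum fun u _ => ?_
    rw [← Finset.sum_add_distrib]
    refine Finset.sum_le_sum fun v _ => ?_
    have hnn : 0 ≤ A u v * (if U u v < η then 1 else 0) := by
      simp only [hA]; split_ifs <;> simp
    have hnn2 : 0 ≤ (1 - A u v) * (if 1 - η < U u v then 1 else 0) := by
      simp only [hA]; split_ifs <;> simp
    by_cases hE : (u, v) ∈ excSet G f τ
    · rw [if_pos hE]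
      simp only [excSet, Finset.mem_filter, Finset.mem_univ, true_and] at hE
      by_cases h4 : U u v < η
      · have h5 : τ (f u) (f v) = 0 := by
          simp only [hτ]; exact if_pos h4
        rw [h5] at hE
        have h6 : G.Adj u v := by simpa using hE
        have h7 : A u v = 1 := by simp [hA, h6]
        rw [if_pos h4, h7] at *
        linarith
      · by_cases h4' : 1 - η < U u v
        · have h5 : τ (f u) (f v) = 2 := by
            simp only [hτ]; rw [if_neg h4, if_pos h4']
          rw [h5] at hE
          have h6 : ¬ G.Adj u v := by simpa using hE
          have h7 : A u v = 0 := by simp [hA, h6]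
          rw [if_pos h4', h7] at *
          linarith
        · exact absurd ((hτ1 u v).2 ⟨not_lt.1 h4, not_lt.1 h4'⟩) hE.1
    · rw [if_neg hE]; linarith
  have : (0:ℝ) ≤ (n:ℝ)^2 := by positivity
  nlinarith

lemma fibre_bound {n K : ℕ} (f : Fin n → Fin K) (τ : Fin K → Fin K → Fin 3) (θ : ℝ)
    (hs : ∀ u v, τ (f u) (f v) = 1 → τ (f v) (f u) = 1)
    (S : Finset (SimpleGraph (Fin n))) (hS : ∀ G ∈ S, ((excSet G f τ).card : ℝ) ≤ θ * (n:ℝ)^2) :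
    (S.card : ℝ) ≤ (((Finset.univ : Finset (Fin n × Fin n)).powerset).filter
      (fun E => (E.card : ℝ) ≤ θ * ((Finset.univ : Finset (Fin n × Fin n)).card : ℝ))).card *
      (2:ℝ) ^ (((midSet f τ).card : ℝ) / 2) := by
  classical
  set M := (midSet f τ).filter (fun p => p.1 < p.2) with hM
  have hM2 : (M.card : ℝ) ≤ (midSet f τ).card / 2 := by
    have h1 : M.card = ((midSet f τ).filter (fun p => p.2 < p.1)).card := by
      refine Finset.card_bij (fun p _ => p.swap) ?_ ?_ ?_
      · intro p hp
        simp only [hM, midSet, Finset.mem_filter, Finset.mem_univ, true_and] at hp ⊢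
        exact ⟨hs _ _ hp.1, hp.2⟩
      · intro p _ q _ h; exact Prod.swap_injective h
      · intro p hp
        simp only [midSet, Finset.mem_filter, Finset.mem_univ, true_and] at hp
        refine ⟨p.swap, ?_, by simp⟩
        simp only [hM, midSet, Finset.mem_filter, Finset.mem_univ, true_and]
        exact ⟨hs _ _ hp.1, hp.2⟩
    have h2 : M.card + ((midSet f τ).filter (fun p => p.2 < p.1)).card ≤ (midSet f τ).card := by
      rw [hM, ← Finset.card_union_of_disjoint]
      · exact Finset.card_le_card (Finset.union_subset (Finset.filter_subset _ _) (Finset.filter_subset _ _))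
      · rw [Finset.disjoint_filter]
        intro p _ h3 h4; exact absurd h3 (not_lt.2 h4.le)
    have h3 : ((M.card + M.card : ℕ) : ℝ) ≤ (midSet f τ).card := by
      exact_mod_cast (by omega : M.card + M.card ≤ (midSet f τ).card)
    push_cast at h3; linarith
  set F := ((Finset.univ : Finset (Fin n × Fin n)).powerset).filter
      (fun E => (E.card : ℝ) ≤ θ * ((Finset.univ : Finset (Fin n × Fin n)).card : ℝ))
  have hcard : S.card ≤ (F ×ˢ M.powerset).card := by
    refine Finset.card_le_card_of_injOn (fun G => (excSet G f τ, M.filter fun p => G.Adj p.1 p.2)) ?_ ?_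
    · intro G hG
      simp only [Finset.coe_product, Set.mem_prod, Finset.mem_coe]
      refine ⟨Finset.mem_filter.2 ⟨by simp, ?_⟩, Finset.mem_powerset.2 (Finset.filter_subset _ _)⟩
      refine (hS G hG).trans (le_of_eq ?_)
      simp; ring_nf; simp
    · intro G hG G' hG' h
      have h1 : excSet G f τ = excSet G' f τ := (Prod.ext_iff.1 h).1
      have h2 : (M.filter fun p => G.Adj p.1 p.2) = M.filter fun p => G'.Adj p.1 p.2 := (Prod.ext_iff.1 h).2
      have key : ∀ u v, u < v → (G.Adj u v ↔ G'.Adj u v) := by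
        intro u v huv
        by_cases hm : τ (f u) (f v) = 1
        · have h3 := Finset.ext_iff.1 h2 (u, v)
          simpa [hM, midSet, hm, huv] using h3
        · have h3 := Finset.ext_iff.1 h1 (u, v)
          simp only [excSet, Finset.mem_filter, Finset.mem_univ, true_and, hm, ne_eq, not_false_eq_true] at h3
          tauto
      ext u v
      rcases lt_trichotomy u v with h3 | h3 | h3
      · exact key u v h3
      · subst h3; simp
      · rw [G.adj_comm, G'.adj_comm]; exact key v u h3
  rw [Finset.card_product, Finset.card_powerset] at hcard
  calc (S.card : ℝ) ≤ ((F.card * 2 ^ M.card : ℕ) : ℝ) := by exact_mod_cast hcard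
    _ = (F.card:ℝ) * (2:ℝ) ^ (M.card:ℝ) := by push_cast; rw [Real.rpow_natCast]
    _ ≤ _ := by
      refine mul_le_mul_of_nonneg_left ?_ (by positivity)
      exact Real.rpow_le_rpow_of_exponent_le (by norm_num) hM2

lemma count_upper {Q : GraphClass} (hQ : IsHereditary Q) {r : ℕ} (hr : 1 ≤ r) (hng : ¬ Good Q (r+1))
    (ε : ℝ) (hε : 0 < ε) :
    ∃ N : ℕ, ∀ n ≥ N, (Nat.card ↥(Q n) : ℝ) ≤ (2 : ℝ) ^ ((1 - 1 / (r:ℝ) + ε) * choose2 n) := by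
  classical
  obtain ⟨θ, hθ, hsub⟩ := small_subsets (ε/16) (by positivity)
  obtain ⟨δ₁, hδ₁, N₁, hstr⟩ := struct_bound hQ hr hng (ε/4) (θ/4) (by positivity) (by positivity)
  obtain ⟨K, hK⟩ := exists_data (min δ₁ (θ/4)) θ (by positivity) hθ (min_le_right _ _)
  have hr1 : (1:ℝ) ≤ r := by exact_mod_cast hr
  set a := 1 - 1 / (r:ℝ) with ha
  have ha1 : a ≤ 1 := by
    have : 0 ≤ 1 / (r:ℝ) := by positivity
    linarith
  have ha0 : 0 ≤ a := by
    rw [ha, sub_nonneg, div_le_one (by linarith)]; exact hr1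
  obtain ⟨N₂, hN₂⟩ := exists_nat_gt (((K:ℝ) + 2 * (K * K) + (1 + ε) / 2) / (ε / 4))
  refine ⟨max (max N₁ 1) N₂, fun n hn => ?_⟩
  have hn1 : N₁ ≤ n := le_trans (le_trans (le_max_left _ _) (le_max_left _ _)) hn
  have hn2 : 1 ≤ n := le_trans (le_trans (le_max_right _ _) (le_max_left _ _)) hn
  have hn3 : N₂ ≤ n := le_trans (le_max_right _ _) hn
  choose f τ U hUs hU hcut hτ hexc using fun G : SimpleGraph (Fin n) => hK n hn2 G
  let S : Finset (SimpleGraph (Fin n)) := Finset.univ.filter (· ∈ Q n)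
  have hS : Nat.card ↥(Q n) = S.card := by
    rw [Nat.card_eq_fintype_card, Fintype.card_subtype]
  rw [hS]
  have hfib := Finset.card_eq_sum_card_fiberwise (s := S) (f := fun G => (f G, τ G))
    (t := Finset.univ) (fun _ _ => by simp)
  have hB : ∀ β : (Fin n → Fin K) × (Fin K → Fin K → Fin 3),
      ((S.filter fun G => (f G, τ G) = β).card : ℝ) ≤
        (2:ℝ) ^ (ε / 16 * (n:ℝ)^2) * (2:ℝ) ^ ((a + ε/4) * (n:ℝ)^2 / 2) := by
    intro β
    rcases Finset.eq_empty_or_nonempty (S.filter fun G => (f G, τ G) = β) with h0 | ⟨G₀, hG₀⟩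
    · rw [h0]; simp; positivity
    rw [Finset.mem_filter] at hG₀
    obtain ⟨hG₀S, rfl⟩ := hG₀
    have hG₀Q : G₀ ∈ Q n := (Finset.mem_filter.1 hG₀S).2
    have h1 := fibre_bound (f G₀) (τ G₀) θ (fun u v h => by
        rw [hτ] at h ⊢; rwa [hUs]) (S.filter fun G => (f G, τ G) = (f G₀, τ G₀)) (fun G hG => by
        have := (Finset.mem_filter.1 hG).2
        rw [Prod.ext_iff] at this
        simp only at this
        rw [← this.1, ← this.2]
        exact hexc G)
    refine h1.trans ?_
    have h2 := hsub (Finset.univ : Finset (Fin n × Fin n))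
    have hc : ((Finset.univ : Finset (Fin n × Fin n)).card : ℝ) = (n:ℝ)^2 := by
      simp; ring
    have h3 := hstr n hn1 G₀ hG₀Q (U G₀) (hUs G₀) (hU G₀) (fun A B => by
      refine le_trans ?_ (mul_le_mul_of_nonneg_right (min_le_left δ₁ (θ/4)) (by positivity))
      convert hcut G₀ A B using 6)
    have h4 : midSet (f G₀) (τ G₀) = Finset.univ.filter fun p : Fin n × Fin n => U G₀ p.1 p.2 ∈ Icc (θ/4) (1-θ/4) := by
      ext p; simp only [midSet, Finset.mem_filter, hτ]
    rw [h4]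
    refine mul_le_mul ?_ ?_ (by positivity) (by positivity)
    · refine h2.trans (le_of_eq ?_); rw [hc]
    · refine Real.rpow_le_rpow_of_exponent_le (by norm_num) ?_
      linarith
  have htot : (S.card : ℝ) ≤ ((K:ℝ) ^ n * 3 ^ (K * K)) *
      ((2:ℝ) ^ (ε / 16 * (n:ℝ)^2) * (2:ℝ) ^ ((a + ε/4) * (n:ℝ)^2 / 2)) := by
    rw [hfib]
    push_cast
    refine (Finset.sum_le_sum fun β _ => hB β).trans (le_of_eq ?_)
    rw [Finset.sum_const, nsmul_eq_mul]
    congr 1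
    simp [Fintype.card_prod, pow_mul]
  refine htot.trans ?_
  have hK2 : ((K:ℝ)^n) ≤ (2:ℝ) ^ ((K:ℝ) * n) := by
    rw [Real.rpow_mul (by norm_num), Real.rpow_natCast, Real.rpow_natCast]
    refine pow_le_pow_left₀ (by positivity) ?_ _
    exact_mod_cast (Nat.lt_two_pow_self (n := K)).le
  have h32 : (3:ℝ) ^ (K*K) ≤ (2:ℝ) ^ (2 * ((K:ℝ) * K)) := by
    rw [Real.rpow_mul (by norm_num)]
    have : ((K:ℝ) * K) = ((K * K : ℕ) : ℝ) := by push_cast; ring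
    rw [this, Real.rpow_natCast]
    exact pow_le_pow_left₀ (by positivity) (by norm_num) _
  calc _ ≤ ((2:ℝ) ^ ((K:ℝ) * n) * (2:ℝ) ^ (2 * ((K:ℝ) * K))) *
      ((2:ℝ) ^ (ε / 16 * (n:ℝ)^2) * (2:ℝ) ^ ((a + ε/4) * (n:ℝ)^2 / 2)) := by gcongr
    _ ≤ _ := by
      rw [← Real.rpow_add (by norm_num), ← Real.rpow_add (by norm_num), ← Real.rpow_add (by norm_num)]
      refine Real.rpow_le_rpow_of_exponent_le (by norm_num) ?_
      have hnN : ((K:ℝ) + 2 * (K * K) + (1 + ε) / 2) / (ε / 4) < n := lt_of_lt_of_le hN₂ (by exact_mod_cast hn3)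
      rw [div_lt_iff₀ (by positivity)] at hnN
      have hn1' : (1:ℝ) ≤ n := by exact_mod_cast hn2
      have h5 : ((K:ℝ) + 2 * (K * K) + (1 + ε) / 2) * n ≤ n * (ε / 4) * n := by
        exact mul_le_mul_of_nonneg_right hnN.le (by linarith)
      have h6 : 2 * ((K:ℝ) * K) ≤ 2 * (K * K) * n := by
        nlinarith [(by positivity : (0:ℝ) ≤ (K:ℝ) * K)]
      have h7 : a * n ≤ 1 * n := mul_le_mul_of_nonneg_right ha1 (by linarith)
      unfold choose2
      nlinarith [sq_nonneg (n:ℝ)]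


noncomputable def qf (n : ℕ) [NeZero n] (x : ℝ) : Fin n := Fin.ofNat n (⌈(n:ℝ) * x⌉ - 1).toNat

lemma measurable_qf (n : ℕ) [NeZero n] : Measurable (qf n) := by
  have h1 : Measurable (fun x : ℝ => ⌈(n:ℝ) * x⌉) := Int.measurable_ceil.comp (measurable_const_mul _)
  exact (Measurable.of_discrete (f := fun z : ℤ => Fin.ofNat n (z - 1).toNat)).comp h1

lemma ceil_eq_qf {n : ℕ} [NeZero n] {x : ℝ} (hx : x ∈ Ioc (0:ℝ) 1) : ⌈(n:ℝ) * x⌉ = ((qf n x : ℕ) : ℤ) + 1 := by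
  have hn : (0:ℝ) < n := by exact_mod_cast NeZero.pos n
  have h1 : 0 < ⌈(n:ℝ) * x⌉ := Int.ceil_pos.2 (mul_pos hn hx.1)
  have h2 : ⌈(n:ℝ) * x⌉ ≤ n := Int.ceil_le.2 (by have := hx.2; push_cast; nlinarith)
  have h3 : (⌈(n:ℝ) * x⌉ - 1).toNat < n := by omega
  simp only [qf, Fin.ofNat, Nat.mod_eq_of_lt h3]
  omega

lemma qf_eq_iff {n : ℕ} [NeZero n] {x : ℝ} (hx : x ∈ Ioc (0:ℝ) 1) (v : Fin n) :
    qf n x = v ↔ x ∈ Ioc (((v:ℕ):ℝ)/n) ((((v:ℕ):ℝ)+1)/n) := by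
  have hn : (0:ℝ) < n := by exact_mod_cast NeZero.pos n
  have h := ceil_eq_qf (n := n) hx
  rw [Fin.ext_iff]
  have h1 : ((qf n x : ℕ) = (v:ℕ)) ↔ ⌈(n:ℝ) * x⌉ = ((v:ℕ):ℤ) + 1 := by
    rw [h]; omega
  rw [h1, Int.ceil_eq_iff, mem_Ioc, div_lt_iff₀ hn, le_div_iff₀ hn]
  push_cast
  rw [mul_comm x]
  simp

lemma Ioc_sub {n : ℕ} (v : Fin n) : Ioc (((v:ℕ):ℝ)/n) ((((v:ℕ):ℝ)+1)/n) ⊆ Ioc 0 1 := by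
  have hn : (0:ℝ) < n := by exact_mod_cast v.pos
  intro x hx
  refine ⟨lt_of_le_of_lt (by positivity) hx.1, hx.2.trans ?_⟩
  rw [div_le_one hn]
  exact_mod_cast v.2

lemma mu0_ae : ∀ᵐ x ∂mu0, x ∈ Ioc (0:ℝ) 1 := by
  have : mu0 = volume.restrict (Ioc (0:ℝ) 1) := by
    exact (Measure.restrict_congr_set Ioc_ae_eq_Icc).symm
  rw [this]
  exact ae_restrict_mem measurableSet_Ioc

lemma mu0_ae2 : ∀ᵐ p ∂(mu0.prod mu0), p.1 ∈ Ioc (0:ℝ) 1 ∧ p.2 ∈ Ioc (0:ℝ) 1 := by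
  have h1 := (Measure.quasiMeasurePreserving_fst (μ := mu0) (ν := mu0)).ae mu0_ae
  have h2 := (Measure.quasiMeasurePreserving_snd (μ := mu0) (ν := mu0)).ae mu0_ae
  filter_upwards [h1, h2] with p h1 h2 using ⟨h1, h2⟩

lemma mu0_qf (n : ℕ) [NeZero n] (v : Fin n) : mu0.real (qf n ⁻¹' {v}) = 1 / n := by
  have hn : (0:ℝ) < n := by exact_mod_cast NeZero.pos n
  have h1 : mu0.real (qf n ⁻¹' {v}) = mu0.real (Ioc (((v:ℕ):ℝ)/n) ((((v:ℕ):ℝ)+1)/n)) := by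
    refine measureReal_congr ?_
    filter_upwards [mu0_ae] with x hx
    exact propext (qf_eq_iff hx v)
  rw [h1, measureReal_restrict_apply measurableSet_Ioc,
    inter_eq_left.2 ((Ioc_sub v).trans Ioc_subset_Icc_self), Real.volume_real_Ioc]
  rw [max_eq_left]
  · field_simp; ring
  · rw [← sub_div]; simp

lemma graphon_qf {n : ℕ} [NeZero n] (G : SimpleGraph (Fin n)) [DecidableRel G.Adj] {x y : ℝ} (hx : x ∈ Ioc (0:ℝ) 1)
    (hy : y ∈ Ioc (0:ℝ) 1) : graphonOfGraph G x y = if G.Adj (qf n x) (qf n y) then 1 else 0 := by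
  unfold graphonOfGraph
  have : (∃ i j : Fin n, G.Adj i j ∧ ⌈(n : ℝ) * x⌉ = ((i : ℕ) : ℤ) + 1 ∧
      ⌈(n : ℝ) * y⌉ = ((j : ℕ) : ℤ) + 1) ↔ G.Adj (qf n x) (qf n y) := by
    rw [ceil_eq_qf hx, ceil_eq_qf hy]
    constructor
    · rintro ⟨i, j, h, h1, h2⟩
      have e1 : qf n x = i := Fin.ext (by omega)
      have e2 : qf n y = j := Fin.ext (by omega)
      rwa [e1, e2]
    · intro h; exact ⟨_, _, h, rfl, rfl⟩
  by_cases h : G.Adj (qf n x) (qf n y)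
  · rw [if_pos h, if_pos (this.2 h)]
  · rw [if_neg h, if_neg (fun h' => h (this.1 h'))]

lemma measurable_graphon {n : ℕ} (G : SimpleGraph (Fin n)) : Measurable (Function.uncurry (graphonOfGraph G)) := by
  classical
  have h1 : Measurable (fun p : ℝ × ℝ => (⌈(n:ℝ) * p.1⌉, ⌈(n:ℝ) * p.2⌉)) :=
    (Int.measurable_ceil.comp ((measurable_const_mul _).comp measurable_fst)).prodMk
      (Int.measurable_ceil.comp ((measurable_const_mul _).comp measurable_snd))
  exact (Measurable.of_discrete (f := fun z : ℤ × ℤ => if ∃ i j : Fin n, G.Adj i j ∧ z.1 = ((i : ℕ) : ℤ) + 1 ∧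
      z.2 = ((j : ℕ) : ℤ) + 1 then (1:ℝ) else 0)).comp h1

lemma graphon_mem {n : ℕ} (G : SimpleGraph (Fin n)) (x y : ℝ) : graphonOfGraph G x y ∈ Icc (0:ℝ) 1 := by
  unfold graphonOfGraph; split_ifs <;> simp

lemma setInt_eq (S T : Set ℝ) (hS : MeasurableSet S) (hT : MeasurableSet T) (hS1 : S ⊆ Icc 0 1)
    (hT1 : T ⊆ Icc 0 1) (U : ℝ → ℝ → ℝ) :
    ∫ p in S ×ˢ T, U p.1 p.2 = ∫ p in S ×ˢ T, U p.1 p.2 ∂(mu0.prod mu0) := by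
  congr 1
  rw [Measure.prod_restrict, Measure.restrict_restrict (hS.prod hT),
    inter_eq_left.2 (Set.prod_mono hS1 hT1)]
  rfl

lemma cutNorm_le {U : ℝ → ℝ → ℝ} {δ : ℝ} (h : CutLe mu0 U δ) : cutNorm U ≤ δ := by
  refine csSup_le ⟨_, ∅, ∅, by simp, by simp, by simp, by simp, rfl⟩ ?_
  rintro _ ⟨S, T, hS, hT, hS1, hT1, rfl⟩
  rw [setInt_eq S T hS hT hS1 hT1]
  exact h S T hS hT

lemma cutNorm_nonneg (U : ℝ → ℝ → ℝ) : 0 ≤ cutNorm U := by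
  refine Real.sSup_nonneg ?_
  rintro _ ⟨S, T, hS, hT, hS1, hT1, rfl⟩
  exact abs_nonneg _

lemma cutLe_of_cutNorm {U : ℝ → ℝ → ℝ} (C : ℝ) (hb : ∀ x y, |U x y| ≤ C)
    {δ : ℝ} (h : cutNorm U ≤ δ) : CutLe mu0 U δ := by
  intro S T hS hT
  have e : ∫ p in S ×ˢ T, U p.1 p.2 ∂(mu0.prod mu0) = ∫ p in (S ∩ Icc 0 1) ×ˢ (T ∩ Icc 0 1), U p.1 p.2 := by
    congr 1
    rw [Measure.prod_restrict, Measure.restrict_restrict (hS.prod hT), Set.prod_inter_prod]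
    rfl
  rw [e]
  refine le_trans (le_csSup (s := { r : ℝ | ∃ S T : Set ℝ, MeasurableSet S ∧ MeasurableSet T ∧
    S ⊆ Set.Icc 0 1 ∧ T ⊆ Set.Icc 0 1 ∧
    r = |∫ p in S ×ˢ T, U p.1 p.2| }) ⟨C, ?_⟩ ⟨S ∩ Icc 0 1, T ∩ Icc 0 1, hS.inter measurableSet_Icc,
    hT.inter measurableSet_Icc, inter_subset_right, inter_subset_right, rfl⟩) h
  rintro _ ⟨S, T, hS, hT, hS1, hT1, rfl⟩
  rw [setInt_eq S T hS hT hS1 hT1]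
  have := norm_setIntegral_le_of_norm_le_const (μ := mu0.prod mu0) (s := S ×ˢ T) (f := fun p => U p.1 p.2) (C := C)
    (by finiteness) (fun p _ => hb _ _)
  rw [Real.norm_eq_abs] at this
  refine this.trans ?_
  have h0 : 0 ≤ C := (abs_nonneg _).trans (hb 0 0)
  have : (mu0.prod mu0).real (S ×ˢ T) ≤ 1 := measureReal_le_one
  nlinarith

lemma isMPSelf_id : IsMPSelf id := ⟨MeasurePreserving.id _, Set.mapsTo_id _⟩

lemma deltaCut_le {W₁ W₂ : ℝ → ℝ → ℝ} {σ₁ σ₂ : ℝ → ℝ} (h1 : IsMPSelf σ₁) (h2 : IsMPSelf σ₂) :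
    deltaCut W₁ W₂ ≤ cutNorm (fun x y => W₁ (σ₁ x) (σ₁ y) - W₂ (σ₂ x) (σ₂ y)) := by
  refine csInf_le ⟨0, ?_⟩ ⟨σ₁, σ₂, h1, h2, rfl⟩
  rintro _ ⟨_, _, _, _, rfl⟩
  exact cutNorm_nonneg _

lemma deltaCut_nonneg (W₁ W₂ : ℝ → ℝ → ℝ) : 0 ≤ deltaCut W₁ W₂ := by
  refine Real.sInf_nonneg ?_
  rintro _ ⟨_, _, _, _, rfl⟩
  exact cutNorm_nonneg _

lemma exists_of_deltaCut_lt {W₁ W₂ : ℝ → ℝ → ℝ} {δ : ℝ} (h : deltaCut W₁ W₂ < δ) :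
    ∃ σ₁ σ₂, IsMPSelf σ₁ ∧ IsMPSelf σ₂ ∧ cutNorm (fun x y => W₁ (σ₁ x) (σ₁ y) - W₂ (σ₂ x) (σ₂ y)) < δ := by
  obtain ⟨_, ⟨σ₁, σ₂, h1, h2, rfl⟩, h3⟩ := exists_lt_of_csInf_lt
    (s := { r : ℝ | ∃ σ₁ σ₂ : ℝ → ℝ, IsMPSelf σ₁ ∧ IsMPSelf σ₂ ∧
    r = cutNorm (fun x y => W₁ (σ₁ x) (σ₁ y) - W₂ (σ₂ x) (σ₂ y)) })
    ⟨_, id, id, isMPSelf_id, isMPSelf_id, rfl⟩ h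
  exact ⟨σ₁, σ₂, h1, h2, h3⟩


lemma step_int {n : ℕ} [NeZero n] (B : Fin n → Fin n → ℝ) (S T : Set ℝ) (hS : MeasurableSet S) (hT : MeasurableSet T) :
    ∫ p in S ×ˢ T, B (qf n p.1) (qf n p.2) ∂(mu0.prod mu0) =
      ∑ u, ∑ v, mu0.real (S ∩ qf n ⁻¹' {u}) * B u v * mu0.real (T ∩ qf n ⁻¹' {v}) := by
  classical
  have hm : ∀ u, MeasurableSet (S ∩ qf n ⁻¹' {u}) := fun u =>
    hS.inter (measurable_qf n (measurableSet_singleton u))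
  have hm' : ∀ u, MeasurableSet (T ∩ qf n ⁻¹' {u}) := fun u =>
    hT.inter (measurable_qf n (measurableSet_singleton u))
  have e : ∀ p : ℝ × ℝ, (S ×ˢ T).indicator (fun p => B (qf n p.1) (qf n p.2)) p =
      ∑ u, ∑ v, ((S ∩ qf n ⁻¹' {u}) ×ˢ (T ∩ qf n ⁻¹' {v})).indicator (fun _ => B u v) p := by
    intro p
    rw [Finset.sum_eq_single (qf n p.1), Finset.sum_eq_single (qf n p.2)]
    · simp [Set.indicator]
    · intro v _ hv; simp [Set.indicator, hv.symm]
    · simp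
    · intro v _ hv; simp [Set.indicator, hv.symm]
    · simp
  rw [← integral_indicator (hS.prod hT)]
  simp only [e]
  rw [integral_finset_sum]
  · refine Finset.sum_congr rfl fun u _ => ?_
    rw [integral_finset_sum]
    · refine Finset.sum_congr rfl fun v _ => ?_
      rw [integral_indicator ((hm u).prod (hm' v)), setIntegral_const, measureReal_prod_prod, smul_eq_mul]
      ring
    · intro v _
      exact (integrable_const _).indicator ((hm u).prod (hm' v))
  · intro u _
    refine integrable_finset_sum _ fun v _ => ?_
    exact (integrable_const _).indicator ((hm u).prod (hm' v))

/-- Hadamard characters -/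
noncomputable def chi {d : ℕ} (x y : Fin d → Bool) : ℝ := ∏ i, if (x i && y i) then (-1:ℝ) else 1

lemma chi_symm {d : ℕ} (x y : Fin d → Bool) : chi x y = chi y x := by
  simp [chi, Bool.and_comm]

lemma chi_val {d : ℕ} (x y : Fin d → Bool) : chi x y = 1 ∨ chi x y = -1 := by
  unfold chi
  refine Finset.prod_induction _ (fun z => z = 1 ∨ z = -1) ?_ (Or.inl rfl) ?_
  · rintro a b (rfl | rfl) (rfl | rfl) <;> norm_num
  · intro i _; split_ifs <;> simp

lemma chi_orth {d : ℕ} (y z : Fin d → Bool) : ∑ x, chi x y * chi x z = if y = z then (2:ℝ)^d else 0 := by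
  have h1 : ∀ x : Fin d → Bool, chi x y * chi x z =
      ∏ i, (if (x i && y i) then (-1:ℝ) else 1) * (if (x i && z i) then (-1:ℝ) else 1) := by
    intro x; rw [Finset.prod_mul_distrib]; rfl
  simp only [h1]
  have h2 := (Finset.prod_univ_sum (fun _ : Fin d => (Finset.univ : Finset Bool))
    (fun i b => (if (b && y i) then (-1:ℝ) else 1) * (if (b && z i) then (-1:ℝ) else 1)))
  rw [Fintype.piFinset_univ] at h2
  rw [← h2]
  by_cases hyz : y = z
  · subst hyz
    simp only [if_true]
    have : ∀ i : Fin d, ∑ b : Bool, (if (b && y i) then (-1:ℝ) else 1) * (if (b && y i) then (-1:ℝ) else 1) = 2 := by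
      intro i; cases y i <;> simp <;> norm_num
    simp only [this]; simp
  · rw [if_neg hyz]
    obtain ⟨i, hi⟩ := Function.ne_iff.1 hyz
    refine Finset.prod_eq_zero (Finset.mem_univ i) ?_
    revert hi
    cases y i <;> cases z i <;> simp

lemma lindsey {d : ℕ} (f g : (Fin d → Bool) → ℝ) (c : ℝ) (hf : ∀ x, |f x| ≤ c) (hg : ∀ x, |g x| ≤ c) :
    |∑ x, ∑ y, f x * chi x y * g y| ≤ c^2 * 2^d * Real.sqrt (2^d) := by
  have hc : 0 ≤ c := (abs_nonneg _).trans (hf (fun _ => false))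
  refine abs_le_of_sq_le_sq ?_ (by positivity)
  have h1 : ∑ x, ∑ y, f x * chi x y * g y = ∑ x, f x * ∑ y, chi x y * g y := by
    refine Finset.sum_congr rfl fun x _ => ?_
    rw [Finset.mul_sum]
    refine Finset.sum_congr rfl fun y _ => by ring
  rw [h1]
  refine (Finset.sum_mul_sq_le_sq_mul_sq _ _ _).trans ?_
  have h2 : ∑ x : Fin d → Bool, (∑ y, chi x y * g y)^2 = 2^d * ∑ y, g y ^ 2 := by
    have : ∀ x : Fin d → Bool, (∑ y, chi x y * g y)^2 = ∑ y, ∑ z, chi x y * chi x z * (g y * g z) := by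
      intro x
      rw [sq, Finset.sum_mul_sum]
      refine Finset.sum_congr rfl fun y _ => Finset.sum_congr rfl fun z _ => by ring
    simp only [this]
    rw [Finset.sum_comm, Finset.mul_sum]
    refine Finset.sum_congr rfl fun y _ => ?_
    rw [Finset.sum_comm]
    simp only [← Finset.sum_mul, chi_orth]
    simp; ring
  have hsq : ∀ (k : (Fin d → Bool) → ℝ), (∀ x, |k x| ≤ c) → ∑ x, k x ^ 2 ≤ 2^d * c^2 := by
    intro k hk
    have : ∑ x, k x ^ 2 ≤ ∑ x : Fin d → Bool, c^2 := by
      refine Finset.sum_le_sum fun x _ => ?_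
      rw [← sq_abs]; exact pow_le_pow_left₀ (abs_nonneg _) (hk x) 2
    simpa using this
  rw [h2]
  have h3 := hsq f hf
  have h4 := hsq g hg
  have h5 : Real.sqrt (2^d) ^ 2 = (2:ℝ)^d := Real.sq_sqrt (by positivity)
  calc (∑ x, f x ^ 2) * (2^d * ∑ y, g y ^ 2) ≤ (2^d * c^2) * (2^d * (2^d * c^2)) := by gcongr
    _ = _ := by rw [mul_pow, h5]; ring

section
variable {r : ℕ} (t : Fin r → Fin r → ℝ) (hts : ∀ i j, t i j = t j i) (d : ℕ)

/-- block and offset of a vertex -/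
noncomputable def offB {r d : ℕ} (u : Fin (r * 2^d)) : Fin d → Bool :=
  (Fintype.equivFinOfCardEq (α := Fin d → Bool) (n := 2^d) (by simp)).symm (finProdFinEquiv.symm u).2

def blk {r d : ℕ} (u : Fin (r * 2^d)) : Fin r := (finProdFinEquiv.symm u).1

/-- template graph -/
def tGraph : SimpleGraph (Fin (r * 2^d)) where
  Adj u v := u ≠ v ∧ (t (blk u) (blk v) = 1 ∨ (t (blk u) (blk v) = 1/2 ∧ chi (offB u) (offB v) = -1)) ∧
    (t (blk v) (blk u) = 1 ∨ (t (blk v) (blk u) = 1/2 ∧ chi (offB v) (offB u) = -1))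
  symm := ⟨fun u v h => ⟨h.1.symm, h.2.2, h.2.1⟩⟩
  loopless := ⟨fun u h => h.1 rfl⟩
end

lemma tGraph_adj {r : ℕ} (t : Fin r → Fin r → ℝ) (hts : ∀ i j, t i j = t j i) (d : ℕ) (u v : Fin (r * 2^d)) :
    (tGraph t d).Adj u v ↔ u ≠ v ∧ (t (blk u) (blk v) = 1 ∨ (t (blk u) (blk v) = 1/2 ∧ chi (offB u) (offB v) = -1)) := by
  simp only [tGraph]
  rw [hts (blk v), chi_symm (offB v)]; tauto

lemma sum_blk {r d : ℕ} (F : Fin (r * 2^d) → ℝ) : ∃ e : Fin r → (Fin d → Bool) → Fin (r * 2^d),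
    (∀ i x, blk (e i x) = i) ∧ (∀ i x, offB (e i x) = x) ∧ ∀ F : Fin (r * 2^d) → ℝ, ∑ u, F u = ∑ i, ∑ x, F (e i x) := by
  let e₀ := (Fintype.equivFinOfCardEq (α := Fin d → Bool) (n := 2^d) (by simp))
  refine ⟨fun i x => finProdFinEquiv (i, e₀ x), ?_, ?_, ?_⟩
  · intro i x; simp only [blk, Equiv.symm_apply_apply]
  · intro i x; simp only [offB, Equiv.symm_apply_apply]; exact e₀.symm_apply_apply x
  · intro F
    rw [← Fintype.sum_prod_type' (f := fun i x => F (finProdFinEquiv (i, e₀ x)))]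
    exact (Fintype.sum_equiv ((Equiv.prodCongr (Equiv.refl _) e₀).trans finProdFinEquiv) _ _ (fun x => rfl)).symm

lemma tGraph_sum {r : ℕ} (hr : 1 ≤ r) (t : Fin r → Fin r → ℝ) (hts : ∀ i j, t i j = t j i)
    (htv : ∀ i j, t i j = 0 ∨ t i j = 1/2 ∨ t i j = 1) (d : ℕ) [DecidableRel (tGraph t d).Adj]
    (f g : Fin (r * 2^d) → ℝ) (c : ℝ) (hf : ∀ x, |f x| ≤ c) (hg : ∀ x, |g x| ≤ c) :
    |∑ u, ∑ v, f u * ((if (tGraph t d).Adj u v then 1 else 0) - t (blk u) (blk v)) * g v| ≤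
      r^2 * (c^2 * 2^d * Real.sqrt (2^d)) + r * 2^d * (2 * c^2) := by
  classical
  obtain ⟨e, he1, he2, he⟩ := sum_blk f
  have hc : 0 ≤ c := (abs_nonneg _).trans (hf ⟨0, by positivity⟩)
  let k : Fin r → Fin r → ℝ := fun i j => if t i j = 1/2 then -1/2 else 0
  have hk : ∀ i j, |k i j| ≤ 1 := by
    intro i j; simp only [k]; split_ifs
    · rw [abs_le]; constructor <;> norm_num
    · simp
  have hsplit : ∀ u v, |f u * ((if (tGraph t d).Adj u v then 1 else 0) - t (blk u) (blk v)) * g v -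
      f u * (k (blk u) (blk v) * chi (offB u) (offB v)) * g v| ≤ if u = v then 2 * c^2 else 0 := by
    intro u v
    rw [← sub_mul, ← mul_sub]
    have hfg : |f u| * |g v| ≤ c^2 := by
      rw [sq]; exact mul_le_mul (hf u) (hg v) (abs_nonneg _) hc
    by_cases huv : u = v
    · rw [if_pos huv, abs_mul, abs_mul]
      have h1 : |(if (tGraph t d).Adj u v then (1:ℝ) else 0) - t (blk u) (blk v) - k (blk u) (blk v) * chi (offB u) (offB v)| ≤ 2 := by
        simp only [k]
        have hch := chi_val (offB u) (offB v)
        rcases htv (blk u) (blk v) with h | h | h <;> rw [h] <;> rcases hch with h' | h' <;> rw [h'] <;>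
          split_ifs <;> norm_num [abs_le] at *
      nlinarith [abs_nonneg (f u), abs_nonneg (g v), mul_nonneg (abs_nonneg (f u)) (abs_nonneg (g v))]
    · rw [if_neg huv]
      have h1 : (if (tGraph t d).Adj u v then (1:ℝ) else 0) - t (blk u) (blk v) - k (blk u) (blk v) * chi (offB u) (offB v) = 0 := by
        simp only [k, tGraph_adj t hts, huv, ne_eq, not_false_eq_true, true_and]
        have hch := chi_val (offB u) (offB v)
        rcases htv (blk u) (blk v) with h | h | h <;> rw [h] <;> rcases hch with h' | h' <;> rw [h'] <;> norm_num
      rw [h1]; simp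
  have hmain : |∑ u, ∑ v, f u * (k (blk u) (blk v) * chi (offB u) (offB v)) * g v| ≤
      r^2 * (c^2 * 2^d * Real.sqrt (2^d)) := by
    have e1 : ∑ u, ∑ v, f u * (k (blk u) (blk v) * chi (offB u) (offB v)) * g v =
        ∑ i, ∑ j, k i j * ∑ x, ∑ y, f (e i x) * chi x y * g (e j y) := by
      rw [he]
      simp only [he, he1, he2]
      refine Finset.sum_congr rfl fun i _ => ?_
      rw [Finset.sum_comm]
      refine Finset.sum_congr rfl fun j _ => ?_
      rw [Finset.mul_sum]
      refine Finset.sum_congr rfl fun x _ => ?_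
      rw [Finset.mul_sum]
      refine Finset.sum_congr rfl fun y _ => by ring
    rw [e1]
    have hb : ∀ i j, |k i j * ∑ x, ∑ y, f (e i x) * chi x y * g (e j y)| ≤ c^2 * 2^d * Real.sqrt (2^d) := by
      intro i j
      rw [abs_mul]
      have := lindsey (fun x => f (e i x)) (fun y => g (e j y)) c (fun _ => hf _) (fun _ => hg _)
      calc _ ≤ 1 * (c^2 * 2^d * Real.sqrt (2^d)) := mul_le_mul (hk i j) this (abs_nonneg _) (by norm_num)
        _ = _ := one_mul _
    calc _ ≤ ∑ i, ∑ j, |k i j * ∑ x, ∑ y, f (e i x) * chi x y * g (e j y)| :=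
          (Finset.abs_sum_le_sum_abs _ _).trans (Finset.sum_le_sum fun i _ => Finset.abs_sum_le_sum_abs _ _)
      _ ≤ ∑ i : Fin r, ∑ j : Fin r, c^2 * 2^d * Real.sqrt (2^d) :=
          Finset.sum_le_sum fun i _ => Finset.sum_le_sum fun j _ => hb i j
      _ = _ := by simp; ring
  have hdiff : |∑ u, ∑ v, f u * ((if (tGraph t d).Adj u v then 1 else 0) - t (blk u) (blk v)) * g v -
      ∑ u, ∑ v, f u * (k (blk u) (blk v) * chi (offB u) (offB v)) * g v| ≤ r * 2^d * (2 * c^2) := by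
    rw [← Finset.sum_sub_distrib]
    simp only [← Finset.sum_sub_distrib]
    calc _ ≤ ∑ u, ∑ v, _ :=
          (Finset.abs_sum_le_sum_abs _ _).trans (Finset.sum_le_sum fun i _ => Finset.abs_sum_le_sum_abs _ _)
      _ ≤ ∑ u : Fin (r * 2^d), ∑ v : Fin (r * 2^d), if u = v then 2 * c^2 else 0 :=
          Finset.sum_le_sum fun i _ => Finset.sum_le_sum fun j _ => hsplit i j
      _ = _ := by simp
  have := abs_sub_abs_le_abs_sub (∑ u, ∑ v, f u * ((if (tGraph t d).Adj u v then 1 else 0) - t (blk u) (blk v)) * g v)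
    (∑ u, ∑ v, f u * (k (blk u) (blk v) * chi (offB u) (offB v)) * g v)
  linarith


lemma blk_qf {r d : ℕ} [NeZero r] [NeZero (r * 2^d)] {x : ℝ} (hx : x ∈ Ioc (0:ℝ) 1) :
    blk (qf (r * 2^d) x) = qf r x := by
  symm
  rw [qf_eq_iff hx]
  have h := (qf_eq_iff hx (qf (r * 2^d) x)).1 rfl
  set u := qf (r * 2^d) x with hu
  have hr : (0:ℝ) < r := by exact_mod_cast NeZero.pos r
  have hM : (0:ℝ) < 2^d := by positivity
  have hub : (blk u : ℕ) = u / 2^d := rfl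
  have h1 : (blk u : ℕ) * 2^d ≤ (u:ℕ) := by rw [hub]; exact Nat.div_mul_le_self _ _
  have h2 : (u:ℕ) + 1 ≤ ((blk u : ℕ) + 1) * 2^d := by
    rw [hub, add_mul, one_mul]
    exact Nat.lt_div_mul_add (by positivity)
  have h1' : ((blk u : ℕ):ℝ) * 2^d ≤ ((u:ℕ):ℝ) := by exact_mod_cast h1
  have h2' : ((u:ℕ):ℝ) + 1 ≤ (((blk u : ℕ):ℝ) + 1) * 2^d := by exact_mod_cast h2
  push_cast at h
  constructor
  · refine lt_of_le_of_lt ?_ h.1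
    rw [div_le_div_iff₀ hr (by positivity)]; nlinarith
  · refine h.2.trans ?_
    rw [div_le_div_iff₀ (by positivity) hr]; nlinarith

lemma template_limit {Q : GraphClass} {r : ℕ} [NeZero r] (t : Fin r → Fin r → ℝ) (hts : ∀ i j, t i j = t j i)
    (htv : ∀ i j, t i j = 0 ∨ t i j = 1/2 ∨ t i j = 1) (hmem : ∀ d, tGraph t d ∈ Q (r * 2^d))
    (W' : ℝ → ℝ → ℝ) (hW' : IsGraphon W')
    (hval : ∀ x ∈ Ioc (0:ℝ) 1, ∀ y ∈ Ioc (0:ℝ) 1, W' x y = t (qf r x) (qf r y)) : W' ∈ limitSet Q := by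
  classical
  have hr1 : 1 ≤ r := NeZero.pos r
  refine ⟨hW', fun d => r * 2^d, fun d => tGraph t d, hmem, ?_, ?_⟩
  · refine tendsto_atTop_mono (fun d => ?_) tendsto_id
    calc d ≤ 2^d := (Nat.lt_two_pow_self).le
      _ ≤ r * 2^d := Nat.le_mul_of_pos_left _ hr1
  · have hlim : Tendsto (fun d : ℕ => 3 / Real.sqrt (2^d)) atTop (nhds 0) := by
      refine Tendsto.div_atTop tendsto_const_nhds ?_
      exact Real.tendsto_sqrt_atTop.comp (tendsto_pow_atTop_atTop_of_one_lt (by norm_num))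
    refine squeeze_zero (fun d => deltaCut_nonneg _ _) (fun d => ?_) hlim
    haveI : NeZero (r * 2^d) := ⟨by positivity⟩
    refine (deltaCut_le isMPSelf_id isMPSelf_id).trans (cutNorm_le ?_)
    intro S T hS hT
    have e : ∫ p in S ×ˢ T, (graphonOfGraph (tGraph t d) (id p.1) (id p.2) - W' (id p.1) (id p.2)) ∂(mu0.prod mu0) =
        ∫ p in S ×ˢ T, (fun u v => (if (tGraph t d).Adj u v then (1:ℝ) else 0) - t (blk u) (blk v))
          (qf (r * 2^d) p.1) (qf (r * 2^d) p.2) ∂(mu0.prod mu0) := by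
      refine integral_congr_ae (ae_restrict_of_ae ?_)
      filter_upwards [mu0_ae2] with p hp
      simp only [id]
      rw [graphon_qf _ hp.1 hp.2, hval _ hp.1 _ hp.2, blk_qf hp.1, blk_qf hp.2]
    rw [e, step_int (fun u v : Fin (r * 2^d) => (if (tGraph t d).Adj u v then (1:ℝ) else 0) - t (blk u) (blk v)) S T hS hT]
    have hb : ∀ (A : Set ℝ) (u : Fin (r * 2^d)), |mu0.real (A ∩ qf (r * 2^d) ⁻¹' {u})| ≤ 1 / ((r * 2^d : ℕ) : ℝ) := by
      intro A u
      rw [abs_of_nonneg measureReal_nonneg, ← mu0_qf (r * 2^d) u]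
      exact measureReal_mono (s₂ := qf (r * 2^d) ⁻¹' {u}) inter_subset_right (by finiteness)
    refine (tGraph_sum hr1 t hts htv d _ _ _ (hb S) (hb T)).trans ?_
    have hr' : (1:ℝ) ≤ r := by exact_mod_cast hr1
    have hM : (0:ℝ) < 2^d := by positivity
    push_cast
    set s := Real.sqrt (2^d) with hs
    have hs2 : s * s = 2^d := Real.mul_self_sqrt hM.le
    have hs1 : 1 ≤ s := by rw [hs, Real.one_le_sqrt]; exact one_le_pow₀ (by norm_num)
    rw [← hs2]
    have e2 : (r:ℝ)^2 * ((1 / (r * (s*s)))^2 * (s*s) * s) + r * (s*s) * (2 * (1 / (r * (s*s)))^2) =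
      1 / s + 2 / (r * (s*s)) := by
      have : s ≠ 0 := by positivity
      field_simp
    rw [e2]
    have : 2 / (r * (s*s)) ≤ 2 / s := by
      refine div_le_div_of_nonneg_left (by norm_num) (by positivity) ?_
      nlinarith
    calc _ ≤ 1 / s + 2 / s := by linarith
      _ = 3 / s := by ring

lemma exists_limit_finite {Q : GraphClass} {r : ℕ} (hr : 1 ≤ r) (h : Good Q r) :
    ∃ W' ∈ limitSet Q, W' ∈ Rset r := by
  classical
  haveI : NeZero r := ⟨by omega⟩
  obtain ⟨s, hs⟩ := exists_signs h
  let t : Fin r → Fin r → ℝ := fun i j => if i ≠ j then 1/2 else if s i = true then 1 else 0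
  have hts : ∀ i j, t i j = t j i := by
    intro i j
    by_cases hij : i = j
    · subst hij; rfl
    · simp [t, hij, Ne.symm hij]
  have htv : ∀ i j, t i j = 0 ∨ t i j = 1/2 ∨ t i j = 1 := by
    intro i j; simp only [t]; split_ifs <;> simp
  let W' : ℝ → ℝ → ℝ := fun x y => if x ∈ Ioc (0:ℝ) 1 ∧ y ∈ Ioc (0:ℝ) 1 then t (qf r x) (qf r y) else 0
  have hval : ∀ x ∈ Ioc (0:ℝ) 1, ∀ y ∈ Ioc (0:ℝ) 1, W' x y = t (qf r x) (qf r y) := fun x hx y hy => if_pos ⟨hx, hy⟩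
  have hG : IsGraphon W' := by
    refine ⟨fun x y => ?_, ?_, fun x y => ?_⟩
    · simp only [W', and_comm, hts (qf r x)]
    · refine Measurable.ite ?_ ?_ measurable_const
      · exact (measurable_fst measurableSet_Ioc).inter (measurable_snd measurableSet_Ioc)
      · exact (Measurable.of_discrete (f := fun z : Fin r × Fin r => t z.1 z.2)).comp
          (((measurable_qf r).comp measurable_fst).prodMk ((measurable_qf r).comp measurable_snd))
    · simp only [W']
      split_ifs
      · rcases htv (qf r x) (qf r y) with h | h | h <;> rw [h] <;> norm_num
      · simp
  refine ⟨W', template_limit t hts htv (fun d => ?_) W' hG hval, hG, ?_, ?_⟩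
  · refine sign_mem hs _ blk fun u v huv hc => ?_
    rw [tGraph_adj t hts, hc]
    simp only [t, ne_eq, huv, not_false_eq_true, not_true_eq_false, if_false, true_and]
    split_ifs with h1 <;> simp [h1]
  · intro p hp
    simp only [Er, mem_iUnion] at hp
    obtain ⟨i, j, hij, hp⟩ := hp
    rw [Set.mem_prod] at hp
    have h1 := Ioc_sub i hp.1
    have h2 := Ioc_sub j hp.2
    rw [hval _ h1 _ h2, (qf_eq_iff h1 i).2 hp.1, (qf_eq_iff h2 j).2 hp.2]
    simp [t, hij]
  · rintro p ⟨-, hp⟩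
    by_cases h1 : p.1 ∈ Ioc (0:ℝ) 1 ∧ p.2 ∈ Ioc (0:ℝ) 1
    · rw [hval _ h1.1 _ h1.2]
      have : qf r p.1 = qf r p.2 := by
        by_contra hne
        apply hp
        simp only [Er, mem_iUnion]
        exact ⟨qf r p.1, qf r p.2, hne, (qf_eq_iff h1.1 _).1 rfl, (qf_eq_iff h1.2 _).1 rfl⟩
      rw [this]
      simp only [t]; split_ifs <;> simp_all
    · left; exact if_neg h1

lemma exists_limit_infinite {Q : GraphClass} (h : ∀ r, 1 ≤ r → Good Q r) :
    (fun _ _ => 1/2 : ℝ → ℝ → ℝ) ∈ limitSet Q := by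
  refine template_limit (r := 1) (fun _ _ => 1/2) (fun _ _ => rfl) (fun _ _ => by simp) (fun d => ?_) _ ?_ ?_
  · exact all_mem (h _ (by simp [Nat.one_le_two_pow])) _
  · exact ⟨fun _ _ => rfl, measurable_const, fun _ _ => by norm_num⟩
  · intros; rfl


/-- the randomness support -/
def randS (W : ℝ → ℝ → ℝ) : Set (ℝ × ℝ) := {p | 0 < W p.1 p.2 ∧ W p.1 p.2 < 1}

lemma measurableSet_randS {W : ℝ → ℝ → ℝ} (hW : IsGraphon W) : MeasurableSet (randS W) :=
  (measurableSet_lt measurable_const hW.2.1).inter (measurableSet_lt hW.2.1 measurable_const)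

lemma randS_symm {W : ℝ → ℝ → ℝ} (hW : IsGraphon W) (x y : ℝ) (h : (x, y) ∈ randS W) : (y, x) ∈ randS W := by
  simp only [randS, mem_setOf_eq] at h ⊢
  rwa [hW.1 y x]

lemma randS_free {Q : GraphClass} (hQ : IsHereditary Q) {r : ℕ} (hng : ¬ Good Q (r+1))
    {W : ℝ → ℝ → ℝ} (hWL : W ∈ limitSet Q) :
    (Measure.pi fun _ : Fin (r+1) => mu0) (cliqueEv (r+1) (randS W)) = 0 := by
  classical
  obtain ⟨hW, nk, Gk, hG, hn, hlim⟩ := hWL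
  unfold Good at hng
  push Not at hng
  obtain ⟨m, hm⟩ := hng
  by_contra hpos
  let R : ℕ → Set (ℝ × ℝ) := fun k => {p | W p.1 p.2 ∈ Icc (1/((k:ℝ)+1)) (1 - 1/((k:ℝ)+1))}
  have hRm : ∀ k, MeasurableSet (R k) := fun k => hW.2.1 measurableSet_Icc
  have hsub : cliqueEv (r+1) (randS W) ⊆ ⋃ k, cliqueEv (r+1) (R k) := by
    intro x hx
    have h1 : ∀ i j : Fin (r+1), ∃ k : ℕ, i ≠ j → ∀ k' ≥ k, (x i, x j) ∈ R k' := by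
      intro i j
      by_cases hij : i = j
      · exact ⟨0, fun h => absurd hij h⟩
      have h2 := hx i j hij
      simp only [randS, mem_setOf_eq] at h2
      obtain ⟨k, hk⟩ := exists_nat_one_div_lt (lt_min h2.1 (sub_pos.2 h2.2))
      refine ⟨k, fun _ k' hk' => ?_⟩
      have h3 : 1 / ((k':ℝ) + 1) ≤ 1 / ((k:ℝ)+1) := by
        have : (k:ℝ) ≤ k' := by exact_mod_cast hk'
        gcongr
      rw [lt_min_iff] at hk
      simp only [R, mem_setOf_eq, mem_Icc]
      constructor <;> linarith [hk.1, hk.2]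
    choose k hk using h1
    rw [mem_iUnion]
    refine ⟨Finset.univ.sup (fun p : Fin (r+1) × Fin (r+1) => k p.1 p.2), fun i j hij => hk i j hij _ ?_⟩
    exact Finset.le_sup (f := fun p : Fin (r+1) × Fin (r+1) => k p.1 p.2) (Finset.mem_univ (i, j))
  have : ∃ k, (Measure.pi fun _ : Fin (r+1) => mu0) (cliqueEv (r+1) (R k)) ≠ 0 := by
    by_contra hall
    push Not at hall
    exact hpos (measure_mono_null hsub (measure_iUnion_null hall))
  obtain ⟨k, hk⟩ := this
  set c := (Measure.pi fun _ : Fin (r+1) => mu0).real (cliqueEv (r+1) (R k)) with hc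
  have hc0 : 0 < c := ENNReal.toReal_pos hk (by finiteness)
  obtain ⟨κ, hκ, N, hM⟩ := lemmaM (r+1) m c (1/((k:ℝ)+1)) hc0 (by positivity)
  obtain ⟨l, hl1, hl2⟩ := ((hn.eventually_ge_atTop (N+1)).and (hlim.eventually_lt_const hκ)).exists
  obtain ⟨σ₁, σ₂, h1, h2, hcut⟩ := exists_of_deltaCut_lt hl2
  haveI : NeZero (nk l) := ⟨by omega⟩
  have hcl := cutLe_of_cutNorm 1 (fun x y => by
    have := graphon_mem (Gk l) (σ₁ x) (σ₁ y)
    have h' := hW.2.2 (σ₂ x) (σ₂ y)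
    rw [abs_le]; constructor <;> linarith [this.1, this.2, h'.1, h'.2]) hcut.le
  obtain ⟨D, hD⟩ := hM mu0 (fun x y => W (σ₂ x) (σ₂ y)) (fun x y => hW.1 _ _)
    (hW.2.1.comp ((h2.1.measurable.comp measurable_fst).prodMk (h2.1.measurable.comp measurable_snd)))
    (fun x y => hW.2.2 _ _) (by
      have hmp := measurePreserving_pi (fun _ : Fin (r+1) => mu0) (fun _ : Fin (r+1) => mu0) (f := fun _ => σ₂) (fun _ => h2.1)
      rw [hc, ← hmp.measureReal_preimage (measurableSet_cliqueEv (r+1) (hRm k)).nullMeasurableSet]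
      exact le_rfl) (nk l) (by omega) (Gk l)
    (fun x => qf (nk l) (σ₁ x)) ((measurable_qf _).comp h1.1.measurable) (fun v => by
      rw [← mu0_qf (nk l) v, ← h1.1.measureReal_preimage ((measurable_qf _) (measurableSet_singleton v)).nullMeasurableSet]
      exact le_rfl) (by
      intro S T hS hT
      have := hcl S T hS hT
      rw [← abs_neg, ← integral_neg] at this
      refine le_trans (le_of_eq ?_) this
      congr 1
      refine integral_congr_ae (ae_restrict_of_ae ?_)
      have hq := (h1.1.prod h1.1).quasiMeasurePreserving.ae mu0_ae2
      filter_upwards [hq] with p hp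
      simp only [Prod.map_fst, Prod.map_snd] at hp
      rw [graphon_qf _ hp.1 hp.2]; ring)
  obtain ⟨F, hF, hFQ⟩ := hm D
  obtain ⟨φ, hφ, hφF⟩ := hD F hF
  exact hFQ (hφF ▸ (InQ.of_mem hQ (hG l)).comap φ hφ)

lemma randS_le {Q : GraphClass} (hQ : IsHereditary Q) {r : ℕ} (hr : 1 ≤ r) (hng : ¬ Good Q (r+1))
    {W : ℝ → ℝ → ℝ} (hWL : W ∈ limitSet Q) : (mu0.prod mu0).real (randS W) ≤ 1 - 1 / r :=
  turan_le r hr mu0 _ (measurableSet_randS hWL.1) (randS_symm hWL.1) (randS_free hQ hng hWL)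

/-- entropy as an integral over the product measure -/
lemma measurable_binEnt : Measurable binEnt := by
  unfold binEnt
  have h : Measurable (Real.logb 2) := by
    unfold Real.logb; exact Real.measurable_log.div_const _
  exact (measurable_id.neg.mul h).sub ((measurable_const.sub measurable_id).mul (h.comp (measurable_const.sub measurable_id)))

lemma binEnt_eq (x : ℝ) : binEnt x = Real.binEntropy x / Real.log 2 := by
  unfold binEnt Real.logb
  rw [Real.binEntropy_eq_negMulLog_add_negMulLog_one_sub]
  simp only [Real.negMulLog]; ring

lemma binEnt_nonneg {x : ℝ} (hx : x ∈ Icc (0:ℝ) 1) : 0 ≤ binEnt x := by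
  rw [binEnt_eq]; exact div_nonneg (Real.binEntropy_nonneg hx.1 hx.2) (Real.log_nonneg (by norm_num))

lemma binEnt_le_one (x : ℝ) : binEnt x ≤ 1 := by
  rw [binEnt_eq, div_le_one (Real.log_pos (by norm_num))]; exact Real.binEntropy_le_log_two

lemma binEnt_eq_one {x : ℝ} : binEnt x = 1 ↔ x = 1/2 := by
  rw [binEnt_eq, div_eq_one_iff_eq (Real.log_pos (by norm_num)).ne', Real.binEntropy_eq_log_two]
  norm_num

lemma binEnt_zero : binEnt 0 = 0 := by simp [binEnt]
lemma binEnt_one : binEnt 1 = 0 := by simp [binEnt]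

lemma measurable_binEntW {W : ℝ → ℝ → ℝ} (hW : IsGraphon W) : Measurable (fun p : ℝ × ℝ => binEnt (W p.1 p.2)) :=
  measurable_binEnt.comp hW.2.1

lemma integrable_binEntW {W : ℝ → ℝ → ℝ} (hW : IsGraphon W) : Integrable (fun p : ℝ × ℝ => binEnt (W p.1 p.2)) (mu0.prod mu0) :=
  integrable_bdd (C := 1) (measurable_binEntW hW) (fun p => by
    rw [abs_of_nonneg (binEnt_nonneg (hW.2.2 _ _))]; exact binEnt_le_one _)

lemma graphonEnt_eq {W : ℝ → ℝ → ℝ} (hW : IsGraphon W) :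
    graphonEnt W = ∫ p, binEnt (W p.1 p.2) ∂(mu0.prod mu0) :=
  (integral_prod _ (integrable_binEntW hW)).symm

lemma binEnt_le_ind {W : ℝ → ℝ → ℝ} (hW : IsGraphon W) (p : ℝ × ℝ) :
    binEnt (W p.1 p.2) ≤ (randS W).indicator (fun _ => (1:ℝ)) p := by
  by_cases hp : p ∈ randS W
  · rw [indicator_of_mem hp]; exact binEnt_le_one _
  · rw [indicator_of_notMem hp]
    have h := hW.2.2 p.1 p.2
    simp only [randS, mem_setOf_eq, not_and_or, not_lt] at hp
    rcases hp with h1 | h1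
    · rw [le_antisymm h1 h.1, binEnt_zero]
    · rw [le_antisymm h.2 h1, binEnt_one]

lemma ent_le_rand {W : ℝ → ℝ → ℝ} (hW : IsGraphon W) : graphonEnt W ≤ (mu0.prod mu0).real (randS W) := by
  rw [graphonEnt_eq hW, ← integral_indicator_one (measurableSet_randS hW)]
  refine integral_mono (integrable_binEntW hW) ?_ (binEnt_le_ind hW)
  exact (integrable_const (1:ℝ)).indicator (measurableSet_randS hW)

lemma ent_le_one {W : ℝ → ℝ → ℝ} (hW : IsGraphon W) : graphonEnt W ≤ 1 :=
  (ent_le_rand hW).trans measureReal_le_one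

/-- if the entropy fills the randomness support, `W = 1/2` there -/
lemma half_of_ent {W : ℝ → ℝ → ℝ} (hW : IsGraphon W) (h : (mu0.prod mu0).real (randS W) ≤ graphonEnt W) :
    ∀ᵐ p ∂(mu0.prod mu0), p ∈ randS W → W p.1 p.2 = 1/2 := by
  have h1 : ∫ p, ((randS W).indicator (fun _ => (1:ℝ)) p - binEnt (W p.1 p.2)) ∂(mu0.prod mu0) = 0 := by
    rw [integral_sub ((integrable_const (1:ℝ)).indicator (measurableSet_randS hW)) (integrable_binEntW hW),
      ← graphonEnt_eq hW]
    have := integral_indicator_one (μ := mu0.prod mu0) (measurableSet_randS hW)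
    have e : ∫ p, (randS W).indicator (fun _ => (1:ℝ)) p ∂(mu0.prod mu0) = (mu0.prod mu0).real (randS W) := this
    rw [e]
    linarith [ent_le_rand hW]
  rw [integral_eq_zero_iff_of_nonneg (fun p => sub_nonneg.2 (binEnt_le_ind hW p))
    (((integrable_const (1:ℝ)).indicator (measurableSet_randS hW)).sub (integrable_binEntW hW))] at h1
  filter_upwards [h1] with p hp hpr
  rw [indicator_of_mem hpr] at hp
  simp only [Pi.zero_apply] at hp
  exact binEnt_eq_one.1 (by linarith)


lemma exists_map_mu0 (ν : Measure ℝ) [IsProbabilityMeasure ν] : ∃ g : ℝ → ℝ, Measurable g ∧ mu0.map g = ν := by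
  obtain ⟨f, hf, hfv⟩ := MeasureTheory.Measure.exists_measurable_map_eq ν
  have hp : Measurable (projIcc (0:ℝ) 1 zero_le_one) := continuous_projIcc.measurable
  refine ⟨fun x => f (projIcc 0 1 zero_le_one x), hf.comp hp, ?_⟩
  have h1 : mu0 = (volume : Measure unitInterval).map Subtype.val := by
    rw [show (volume : Measure unitInterval) = Measure.comap Subtype.val volume from rfl,
      map_comap_subtype_coe measurableSet_Icc]
  change mu0.map (f ∘ projIcc 0 1 zero_le_one) = ν
  rw [h1, Measure.map_map (hf.comp hp) measurable_subtype_coe, ← hfv]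
  congr 1
  ext x
  simp [projIcc_val]

lemma block_measure {r : ℕ} [NeZero r] (i : Fin r) (B : Set ℝ) (hB : MeasurableSet B) :
    mu0 (qf r ⁻¹' {i} ∩ {x | (r:ℝ) * x - i ∈ B}) = (r:ENNReal)⁻¹ * mu0 B := by
  have hr : (0:ℝ) < r := by exact_mod_cast NeZero.pos r
  have e1 : mu0 (qf r ⁻¹' {i} ∩ {x | (r:ℝ) * x - i ∈ B}) =
      volume ((fun x => (r:ℝ) * x) ⁻¹' ((fun y => y + (-(i:ℕ):ℝ)) ⁻¹' (Ioc 0 1 ∩ B))) := by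
    have : mu0 (qf r ⁻¹' {i} ∩ {x | (r:ℝ) * x - i ∈ B}) =
      mu0 ((fun x => (r:ℝ) * x) ⁻¹' ((fun y => y + (-(i:ℕ):ℝ)) ⁻¹' (Ioc 0 1 ∩ B))) := by
      refine measure_congr ?_
      filter_upwards [mu0_ae] with x hx
      refine propext ?_
      change (qf r x = i ∧ (r:ℝ) * x - (i:ℕ) ∈ B) ↔ ((r:ℝ) * x + -(i:ℕ) ∈ Ioc (0:ℝ) 1 ∧ (r:ℝ) * x + -(i:ℕ) ∈ B)
      rw [qf_eq_iff hx, ← sub_eq_add_neg]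
      refine and_congr_left fun _ => ?_
      rw [mem_Ioc, mem_Ioc, div_lt_iff₀ hr, le_div_iff₀ hr]
      constructor <;> rintro ⟨h1, h2⟩ <;> constructor <;> linarith
    rw [this, Measure.restrict_eq_self]
    intro x hx
    obtain ⟨⟨h1, h2⟩, -⟩ := hx
    simp only at h1 h2
    refine Ioc_subset_Icc_self (Ioc_sub i ?_)
    rw [mem_Ioc, div_lt_iff₀ hr, le_div_iff₀ hr]
    constructor <;> linarith
  rw [e1, Real.volume_preimage_mul_left hr.ne', measure_preimage_add_right]
  congr 1
  · rw [abs_of_pos (by positivity), ENNReal.ofReal_inv_of_pos hr]; simp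
  · rw [Measure.restrict_apply hB, inter_comm]
    refine measure_congr (EventuallyEq.inter (ae_eq_refl _) Ioc_ae_eq_Icc)

lemma exists_sigma {r : ℕ} [NeZero r] (c : ℝ → Fin r) (hc : Measurable c)
    (h : ∀ i, mu0.real (c ⁻¹' {i}) = 1/r) :
    ∃ σ : ℝ → ℝ, IsMPSelf σ ∧ ∀ᵐ x ∂mu0, c (σ x) = qf r x := by
  classical
  have hr : (0:ℝ) < r := by exact_mod_cast NeZero.pos r
  have hr0 : (r:ENNReal) ≠ 0 := by exact_mod_cast (NeZero.ne r)
  have hci : ∀ i, MeasurableSet (c ⁻¹' {i}) := fun i => hc (measurableSet_singleton i)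
  have h' : ∀ i, mu0 (c ⁻¹' {i}) = (r:ENNReal)⁻¹ := by
    intro i
    rw [← ofReal_measureReal (by finiteness), h i, one_div, ENNReal.ofReal_inv_of_pos hr]; simp
  have hex : ∀ i, ∃ g : ℝ → ℝ, Measurable g ∧ mu0.map g = ProbabilityTheory.cond mu0 (c ⁻¹' {i}) := by
    intro i
    haveI := ProbabilityTheory.cond_isProbabilityMeasure (μ := mu0) (s := c ⁻¹' {i}) (by rw [h' i]; simp)
    exact exists_map_mu0 _
  choose g hg hgm using hex
  let σ : ℝ → ℝ := fun x => g (qf r x) ((r:ℝ) * x - (qf r x : ℕ))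
  have hσ : Measurable σ := by
    have h1 : Measurable (fun z : Fin r × ℝ => g z.1 ((r:ℝ) * z.2 - (z.1 : ℕ))) := by
      refine measurable_from_prod_countable_right fun i => ?_
      exact (hg i).comp (by fun_prop)
    exact h1.comp ((measurable_qf r).prodMk measurable_id)
  have key : ∀ i (A : Set ℝ), MeasurableSet A → mu0 (qf r ⁻¹' {i} ∩ σ ⁻¹' A) = mu0 (c ⁻¹' {i} ∩ A) := by
    intro i A hA
    have e : qf r ⁻¹' {i} ∩ σ ⁻¹' A = qf r ⁻¹' {i} ∩ {x | (r:ℝ) * x - (i:ℕ) ∈ g i ⁻¹' A} := by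
      ext x
      simp only [mem_inter_iff, mem_preimage, mem_singleton_iff, mem_setOf_eq, σ]
      refine and_congr_right fun hx => ?_
      rw [hx]
    rw [e, block_measure i _ (hg i hA), ← Measure.map_apply (hg i) hA, hgm, ProbabilityTheory.cond_apply (hci i),
      h' i, inv_inv, ← mul_assoc, ENNReal.inv_mul_cancel hr0 (by simp), one_mul]
  have hsum : ∀ (f : ℝ → Fin r) (hf : Measurable f) (A : Set ℝ), MeasurableSet A → mu0 A = ∑ i, mu0 (f ⁻¹' {i} ∩ A) := by
    intro f hf A hA
    rw [← measure_biUnion_finset]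
    · congr 1; ext x; simp
    · intro i _ j _ hij
      refine Disjoint.mono inter_subset_left inter_subset_left ?_
      exact Disjoint.preimage _ (by simpa using hij)
    · intro i _; exact (hf (measurableSet_singleton i)).inter hA
  have hmp : mu0.map σ = mu0 := by
    ext A hA
    rw [Measure.map_apply hσ hA, hsum _ (measurable_qf r) _ (hσ hA), hsum c hc A hA]
    exact Finset.sum_congr rfl fun i _ => key i A hA
  have hcol : ∀ᵐ x ∂mu0, c (σ x) = qf r x := by
    have : ∀ i, ∀ᵐ x ∂mu0, qf r x = i → c (σ x) = i := by
      intro i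
      rw [ae_iff]
      have e : {x | ¬ (qf r x = i → c (σ x) = i)} = qf r ⁻¹' {i} ∩ σ ⁻¹' (c ⁻¹' {i})ᶜ := by
        ext x; simp
      rw [e, key i _ (hci i).compl]; simp
    filter_upwards [ae_all_iff.2 this] with x hx using hx _ rfl
  have hin : ∀ᵐ x ∂mu0, σ x ∈ Icc (0:ℝ) 1 := by
    have : ∀ᵐ y ∂(mu0.map σ), y ∈ Icc (0:ℝ) 1 := by
      rw [hmp]; exact ae_restrict_mem measurableSet_Icc
    exact ae_of_ae_map hσ.aemeasurable this
  let σ' : ℝ → ℝ := fun x => if σ x ∈ Icc (0:ℝ) 1 then σ x else 0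
  have hσ' : Measurable σ' := Measurable.ite (hσ measurableSet_Icc) hσ measurable_const
  have hee : σ' =ᵐ[mu0] σ := by
    filter_upwards [hin] with x hx using if_pos hx
  refine ⟨σ', ⟨⟨hσ', ?_⟩, fun x _ => ?_⟩, ?_⟩
  · rw [Measure.map_congr hee, hmp]
  · simp only [σ']; split_ifs with h1
    · exact h1
    · simp
  · filter_upwards [hee, hcol] with x h1 h2; rw [h1, h2]

lemma mp_prod {σ : ℝ → ℝ} (h : IsMPSelf σ) : MeasurePreserving (fun p : ℝ × ℝ => (σ p.1, σ p.2)) (mu0.prod mu0) (mu0.prod mu0) :=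
  h.1.prod h.1

lemma deltaCut_zero {W W' : ℝ → ℝ → ℝ} {σ : ℝ → ℝ} (h : IsMPSelf σ)
    (hae : ∀ᵐ p ∂(mu0.prod mu0), W (σ p.1) (σ p.2) = W' p.1 p.2) : deltaCut W W' = 0 := by
  refine le_antisymm ((deltaCut_le h isMPSelf_id).trans (cutNorm_le ?_)) (deltaCut_nonneg _ _)
  intro S T hS hT
  have : ∫ p in S ×ˢ T, (W (σ p.1) (σ p.2) - W' (id p.1) (id p.2)) ∂(mu0.prod mu0) = ∫ p in S ×ˢ T, (0:ℝ) ∂(mu0.prod mu0) := by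
    refine integral_congr_ae (ae_restrict_of_ae ?_)
    filter_upwards [hae] with p hp
    simp [hp]
  rw [this]; simp

lemma repr_finite {r : ℕ} [NeZero r] {W : ℝ → ℝ → ℝ} (hW : IsGraphon W) (c : ℝ → Fin r) (hc : Measurable c)
    (h : ∀ i, mu0.real (c ⁻¹' {i}) = 1/r)
    (hR : ∀ᵐ p ∂(mu0.prod mu0), (p ∈ randS W ↔ c p.1 ≠ c p.2))
    (hh : ∀ᵐ p ∂(mu0.prod mu0), p ∈ randS W → W p.1 p.2 = 1/2) :
    ∃ W' ∈ Rset r, deltaCut W W' = 0 := by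
  classical
  obtain ⟨σ, hσ, hcol⟩ := exists_sigma c hc h
  have hσm : Measurable σ := hσ.1.measurable
  let W' : ℝ → ℝ → ℝ := fun x y => if x ∈ Ioc (0:ℝ) 1 ∧ y ∈ Ioc (0:ℝ) 1 then
    (if qf r x ≠ qf r y then 1/2 else if W (σ x) (σ y) = 1 then 1 else 0) else 0
  have hval : ∀ x ∈ Ioc (0:ℝ) 1, ∀ y ∈ Ioc (0:ℝ) 1, W' x y =
    (if qf r x ≠ qf r y then 1/2 else if W (σ x) (σ y) = 1 then 1 else 0) := fun x hx y hy => if_pos ⟨hx, hy⟩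
  have hG : IsGraphon W' := by
    refine ⟨fun x y => ?_, ?_, fun x y => ?_⟩
    · simp only [W', and_comm, hW.1 (σ x), ne_comm]
    · refine Measurable.ite ?_ (Measurable.ite ?_ measurable_const (Measurable.ite ?_ measurable_const measurable_const)) measurable_const
      · exact (measurable_fst measurableSet_Ioc).inter (measurable_snd measurableSet_Ioc)
      · have := (measurableSet_eq_fun ((measurable_qf r).comp measurable_fst) ((measurable_qf r).comp (measurable_snd (α := ℝ) (β := ℝ)))).compl
        exact this
      · have : Measurable (fun p : ℝ × ℝ => W (σ p.1) (σ p.2)) :=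
          hW.2.1.comp ((hσm.comp measurable_fst).prodMk (hσm.comp measurable_snd))
        exact this (measurableSet_singleton 1)
    · simp only [W']; split_ifs <;> norm_num
  refine ⟨W', ⟨hG, ?_, ?_⟩, deltaCut_zero hσ ?_⟩
  · intro p hp
    simp only [Er, mem_iUnion] at hp
    obtain ⟨i, j, hij, hp⟩ := hp
    rw [Set.mem_prod] at hp
    have h1 := Ioc_sub i hp.1
    have h2 := Ioc_sub j hp.2
    rw [hval _ h1 _ h2, (qf_eq_iff h1 i).2 hp.1, (qf_eq_iff h2 j).2 hp.2, if_pos hij]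
  · rintro p ⟨-, hp⟩
    by_cases h1 : p.1 ∈ Ioc (0:ℝ) 1 ∧ p.2 ∈ Ioc (0:ℝ) 1
    · rw [hval _ h1.1 _ h1.2]
      have : qf r p.1 = qf r p.2 := by
        by_contra hne
        apply hp
        simp only [Er, mem_iUnion]
        exact ⟨qf r p.1, qf r p.2, hne, (qf_eq_iff h1.1 _).1 rfl, (qf_eq_iff h1.2 _).1 rfl⟩
      rw [if_neg (by simpa using this)]
      split_ifs <;> simp
    · left; exact if_neg h1
  · have q1 := (mp_prod hσ).quasiMeasurePreserving.ae hR
    have q2 := (mp_prod hσ).quasiMeasurePreserving.ae hh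
    have q3 : ∀ᵐ p ∂(mu0.prod mu0), c (σ p.1) = qf r p.1 := Measure.quasiMeasurePreserving_fst.ae hcol
    have q4 : ∀ᵐ p ∂(mu0.prod mu0), c (σ p.2) = qf r p.2 := Measure.quasiMeasurePreserving_snd.ae hcol
    filter_upwards [q1, q2, q3, q4, mu0_ae2] with p a1 a2 a3 a4 a5
    simp only [a3, a4] at a1
    rw [hval _ a5.1 _ a5.2]
    by_cases hne : qf r p.1 ≠ qf r p.2
    · rw [if_pos hne]; exact a2 (a1.2 hne)
    · rw [if_neg hne]
      have a6 : ¬ (0 < W (σ p.1) (σ p.2) ∧ W (σ p.1) (σ p.2) < 1) := fun hx => hne (a1.1 hx)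
      have a7 := hW.2.2 (σ p.1) (σ p.2)
      split_ifs with a8
      · exact a8
      · by_contra a9
        exact a6 ⟨lt_of_le_of_ne a7.1 (Ne.symm a9), lt_of_le_of_ne a7.2 a8⟩

lemma ent_forward {Q : GraphClass} (hQ : IsHereditary Q) {r : ℕ} (hr : 1 ≤ r) (hng : ¬ Good Q (r+1))
    {W : ℝ → ℝ → ℝ} (hWL : W ∈ limitSet Q) (he : graphonEnt W = 1 - 1/(r:ℝ)) :
    ∃ W' ∈ Rset r, deltaCut W W' = 0 := by
  haveI : NeZero r := ⟨by omega⟩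
  have hW := hWL.1
  have h1 := randS_le hQ hr hng hWL
  have h2 := ent_le_rand hW
  have h3 := half_of_ent hW (by rw [he]; exact h1)
  have h4 : (mu0.prod mu0).real (randS W) = 1 - 1/(r:ℝ) := le_antisymm h1 (he ▸ h2)
  have hfree := randS_free hQ hng hWL
  have hm := measurableSet_randS hW
  obtain ⟨c, hc, hci, hcR⟩ := turan_eq r hr mu0 (randS W) hm (randS_symm hW) hfree h4
    (deg_eq r hr (randS W) hm (randS_symm hW) hfree h4)
  exact repr_finite hW c hc hci hcR h3

lemma ent_forward_inf {W : ℝ → ℝ → ℝ} (hW : IsGraphon W) (he : graphonEnt W = 1) :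
    deltaCut W (fun _ _ => 1/2) = 0 := by
  have h3 := half_of_ent hW (by rw [he]; exact measureReal_le_one)
  have h2 := ent_le_rand hW
  have h4 : (mu0.prod mu0) (randS W)ᶜ = 0 := by
    rw [prob_compl_eq_zero_iff (measurableSet_randS hW)]
    have : (mu0.prod mu0).real (randS W) = 1 := le_antisymm measureReal_le_one (he ▸ h2)
    rw [← ofReal_measureReal (by finiteness), this]; simp
  refine deltaCut_zero isMPSelf_id ?_
  have h5 : ∀ᵐ p ∂(mu0.prod mu0), p ∈ randS W := h4
  filter_upwards [h3, h5] with p a1 a2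
  exact a1 a2


/-- pairing against `f` is controlled by the cut norm, uniformly in measure preserving maps -/
def PairOK (f : ℝ × ℝ → ℝ) : Prop :=
  ∀ η > 0, ∃ ε > 0, ∀ D : ℝ → ℝ → ℝ, Measurable (Function.uncurry D) → (∀ x y, |D x y| ≤ 1) →
    ∀ σ : ℝ → ℝ, IsMPSelf σ → CutLe mu0 D ε →
      |∫ p, D p.1 p.2 * f (σ p.1, σ p.2) ∂(mu0.prod mu0)| ≤ η

lemma pair_integrable {f : ℝ × ℝ → ℝ} (hf : Integrable f (mu0.prod mu0)) {D : ℝ → ℝ → ℝ}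
    (hD : Measurable (Function.uncurry D)) (hb : ∀ x y, |D x y| ≤ 1) {σ : ℝ → ℝ} (hσ : IsMPSelf σ) :
    Integrable (fun p : ℝ × ℝ => D p.1 p.2 * f (σ p.1, σ p.2)) (mu0.prod mu0) := by
  have h1 : Integrable (fun p : ℝ × ℝ => f (σ p.1, σ p.2)) (mu0.prod mu0) :=
    (mp_prod hσ).integrable_comp_of_integrable hf
  exact h1.bdd_mul (c := 1) hD.aestronglyMeasurable (Eventually.of_forall fun p => hb p.1 p.2)

lemma PairOK.add {f g : ℝ × ℝ → ℝ} (hf : Integrable f (mu0.prod mu0)) (hg : Integrable g (mu0.prod mu0))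
    (h1 : PairOK f) (h2 : PairOK g) : PairOK (f + g) := by
  intro η hη
  obtain ⟨a, ha, h1⟩ := h1 (η/2) (by positivity)
  obtain ⟨b, hb, h2⟩ := h2 (η/2) (by positivity)
  refine ⟨min a b, lt_min ha hb, fun D hD hDb σ hσ hc => ?_⟩
  have k1 := h1 D hD hDb σ hσ (fun S T hS hT => (hc S T hS hT).trans (min_le_left _ _))
  have k2 := h2 D hD hDb σ hσ (fun S T hS hT => (hc S T hS hT).trans (min_le_right _ _))
  simp only [Pi.add_apply, mul_add]
  rw [integral_add (pair_integrable hf hD hDb hσ) (pair_integrable hg hD hDb hσ)]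
  calc _ ≤ _ := abs_add_le _ _
    _ ≤ η := by linarith

lemma PairOK.smul {f : ℝ × ℝ → ℝ} (c : ℝ) (h1 : PairOK f) : PairOK (fun p => c * f p) := by
  intro η hη
  obtain ⟨a, ha, h1⟩ := h1 (η/(|c|+1)) (by positivity)
  refine ⟨a, ha, fun D hD hDb σ hσ hc => ?_⟩
  have k1 := h1 D hD hDb σ hσ hc
  have : ∀ p : ℝ × ℝ, D p.1 p.2 * (c * f (σ p.1, σ p.2)) = c * (D p.1 p.2 * f (σ p.1, σ p.2)) := fun p => by ring
  simp only [this]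
  rw [integral_const_mul, abs_mul]
  rw [le_div_iff₀ (by positivity)] at k1
  nlinarith [abs_nonneg (∫ p, D p.1 p.2 * f (σ p.1, σ p.2) ∂(mu0.prod mu0))]

lemma PairOK.approx {f : ℝ × ℝ → ℝ} (hf : Integrable f (mu0.prod mu0))
    (h : ∀ η > 0, ∃ g, Integrable g (mu0.prod mu0) ∧ PairOK g ∧ ∫ p, |f p - g p| ∂(mu0.prod mu0) ≤ η) : PairOK f := by
  intro η hη
  obtain ⟨g, hg, hP, hfg⟩ := h (η/2) (by positivity)
  obtain ⟨a, ha, h1⟩ := hP (η/2) (by positivity)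
  refine ⟨a, ha, fun D hD hDb σ hσ hc => ?_⟩
  have k1 := h1 D hD hDb σ hσ hc
  have i1 := pair_integrable hg hD hDb hσ
  have i2 := pair_integrable (hf.sub hg) hD hDb hσ
  have e : ∫ p, D p.1 p.2 * f (σ p.1, σ p.2) ∂(mu0.prod mu0) =
      ∫ p, D p.1 p.2 * g (σ p.1, σ p.2) ∂(mu0.prod mu0) + ∫ p, D p.1 p.2 * (f - g) (σ p.1, σ p.2) ∂(mu0.prod mu0) := by
    rw [← integral_add i1 i2]
    congr 1; ext p; simp only [Pi.sub_apply]; ring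
  have k2 : |∫ p, D p.1 p.2 * (f - g) (σ p.1, σ p.2) ∂(mu0.prod mu0)| ≤ η/2 := by
    have m1 : ∫ p, |f p - g p| ∂(mu0.prod mu0) = ∫ p, |f (σ p.1, σ p.2) - g (σ p.1, σ p.2)| ∂(mu0.prod mu0) := by
      conv_lhs => rw [← (mp_prod hσ).map_eq]
      rw [integral_map (mp_prod hσ).measurable.aemeasurable]
      rw [(mp_prod hσ).map_eq]
      exact (hf.sub hg).abs.aestronglyMeasurable
    refine abs_integral_le_integral_abs.trans (le_trans ?_ (m1 ▸ hfg))
    refine integral_mono i2.abs ((mp_prod hσ).integrable_comp_of_integrable (hf.sub hg).abs) fun p => ?_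
    simp only [Pi.sub_apply, abs_mul]
    exact mul_le_of_le_one_left (abs_nonneg _) (hDb _ _)
  rw [e]
  calc _ ≤ _ := abs_add_le _ _
    _ ≤ η := by linarith

lemma int_ind {A : Set (ℝ × ℝ)} (hA : MeasurableSet A) : Integrable (A.indicator (fun _ => (1:ℝ))) (mu0.prod mu0) :=
  (integrable_const (1:ℝ)).indicator hA

lemma PairOK.rect {S T : Set ℝ} (hS : MeasurableSet S) (hT : MeasurableSet T) :
    PairOK ((S ×ˢ T).indicator (fun _ => (1:ℝ))) := by
  intro η hη
  refine ⟨η, hη, fun D hD hDb σ hσ hc => ?_⟩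
  have hσm := hσ.1.measurable
  have := hc (σ ⁻¹' S) (σ ⁻¹' T) (hσm hS) (hσm hT)
  rw [← integral_indicator ((hσm hS).prod (hσm hT))] at this
  convert this using 3
  ext p
  by_cases hp : p ∈ (σ ⁻¹' S) ×ˢ (σ ⁻¹' T)
  · rw [indicator_of_mem hp, indicator_of_mem (by exact hp), mul_one]
  · rw [indicator_of_notMem hp, indicator_of_notMem (by exact hp), mul_zero]

lemma PairOK.set {A : Set (ℝ × ℝ)} (hA : MeasurableSet A) : PairOK (A.indicator (fun _ => (1:ℝ))) := by
  induction A, hA using MeasurableSpace.induction_on_inter (s := image2 (· ×ˢ ·) {s : Set ℝ | MeasurableSet s} {t : Set ℝ | MeasurableSet t}) generateFrom_prod.symm isPiSystem_prod with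
  | empty =>
    have := PairOK.rect (S := ∅) (T := ∅) MeasurableSet.empty MeasurableSet.empty
    simpa using this
  | basic t ht =>
    obtain ⟨S, hS, T, hT, rfl⟩ := ht
    exact PairOK.rect hS hT
  | compl t ht ih =>
    have h1 := PairOK.rect (S := univ) (T := univ) MeasurableSet.univ MeasurableSet.univ
    have h2 := PairOK.add (int_ind (MeasurableSet.univ.prod MeasurableSet.univ)) ((int_ind ht).const_mul (-1)) h1 (ih.smul (-1))
    convert h2 using 1
    ext p
    by_cases hp : p ∈ t <;> simp [hp]
  | iUnion A hd hm ih =>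
    let B : ℕ → Set (ℝ × ℝ) := fun n => ⋃ i ∈ Finset.range n, A i
    have hBm : ∀ n, MeasurableSet (B n) := fun n => Finset.measurableSet_biUnion _ fun i _ => hm i
    have hB : ∀ n, PairOK ((B n).indicator (fun _ => (1:ℝ))) := by
      intro n
      induction n with
      | zero => 
        have := PairOK.rect (S := ∅) (T := ∅) MeasurableSet.empty MeasurableSet.empty
        simpa [B] using this
      | succ n ihn =>
        have e : B (n+1) = A n ∪ B n := by
          simp only [B, Finset.range_add_one, Finset.set_biUnion_insert]
        have dis : Disjoint (A n) (B n) := by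
          simp only [B, disjoint_iUnion_right]
          intro i hi
          exact hd (by simp at hi; omega)
        rw [e, indicator_union_of_disjoint dis]
        exact PairOK.add (int_ind (hm n)) (int_ind (hBm n)) (ih n) ihn
    have hmono : Monotone B := by
      intro m n hmn
      exact biUnion_subset_biUnion_left (by simpa using hmn)
    have hU : ⋃ n, B n = ⋃ n, A n := by
      ext p; simp only [B, mem_iUnion, Finset.mem_range]
      constructor
      · rintro ⟨n, i, _, h⟩; exact ⟨i, h⟩
      · rintro ⟨i, h⟩; exact ⟨i+1, i, by omega, h⟩
    have hAm : MeasurableSet (⋃ n, A n) := MeasurableSet.iUnion hm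
    have hlim := tendsto_measure_iUnion_atTop (μ := mu0.prod mu0) hmono
    rw [hU] at hlim
    have hlim' : Tendsto (fun n => (mu0.prod mu0).real (B n)) atTop (nhds ((mu0.prod mu0).real (⋃ n, A n))) :=
      (ENNReal.tendsto_toReal (by finiteness)).comp hlim
    refine PairOK.approx (int_ind hAm) fun η hη => ?_
    obtain ⟨n, hn⟩ := (hlim'.eventually_const_lt (show (mu0.prod mu0).real (⋃ n, A n) - η < _ by linarith)).exists
    refine ⟨_, int_ind (hBm n), hB n, ?_⟩
    have hsub : B n ⊆ ⋃ n, A n := hU ▸ subset_iUnion B n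
    have e : ∀ p, |(⋃ n, A n).indicator (fun _ => (1:ℝ)) p - (B n).indicator (fun _ => (1:ℝ)) p| =
      (⋃ n, A n).indicator (fun _ => (1:ℝ)) p - (B n).indicator (fun _ => (1:ℝ)) p := by
      intro p
      refine abs_of_nonneg (sub_nonneg.2 ?_)
      exact indicator_le_indicator_of_subset hsub (fun _ => by norm_num) p
    simp only [e]
    rw [integral_sub (int_ind hAm) (int_ind (hBm n)), integral_indicator_const _ hAm, integral_indicator_const _ (hBm n)]
    simp only [smul_eq_mul, mul_one]
    linarith

lemma PairOK.all {f : ℝ × ℝ → ℝ} (hf : Integrable f (mu0.prod mu0)) : PairOK f := by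
  refine Integrable.induction PairOK ?_ ?_ ?_ ?_ hf
  · intro c s hs _
    convert (PairOK.set hs).smul c using 1
    ext p
    by_cases hp : p ∈ s <;> simp [hp]
  · intro f g _ hf hg h1 h2
    exact PairOK.add hf hg h1 h2
  · rw [← isSeqClosed_iff_isClosed]
    intro u f hu hlim
    refine PairOK.approx (L1.integrable_coeFn f) fun η hη => ?_
    rw [Metric.tendsto_atTop] at hlim
    obtain ⟨N, hN⟩ := hlim η hη
    refine ⟨u N, L1.integrable_coeFn _, hu N, ?_⟩
    have h1 := hN N le_rfl
    rw [dist_comm, L1.dist_eq_integral_dist] at h1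
    simp only [Real.dist_eq] at h1
    exact h1.le
  · intro f g hfg hf h
    refine PairOK.approx (hf.congr hfg) fun η hη => ⟨f, hf, h, ?_⟩
    have : ∫ p, |g p - f p| ∂(mu0.prod mu0) = ∫ p, (0:ℝ) ∂(mu0.prod mu0) := by
      refine integral_congr_ae ?_
      filter_upwards [hfg] with p hp
      simp [hp]
    rw [this]; simpa using hη.le


lemma int_W {W : ℝ → ℝ → ℝ} (hW : IsGraphon W) : Integrable (fun p : ℝ × ℝ => W p.1 p.2) (mu0.prod mu0) :=
  integrable_bdd (C := 1) hW.2.1 (fun p => by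
    rw [abs_of_nonneg (hW.2.2 p.1 p.2).1]; exact (hW.2.2 p.1 p.2).2)

lemma int_W2 {W : ℝ → ℝ → ℝ} (hW : IsGraphon W) : Integrable (fun p : ℝ × ℝ => W p.1 p.2 * W p.1 p.2) (mu0.prod mu0) :=
  integrable_bdd (C := 1) (hW.2.1.mul hW.2.1) (fun p => by
    have := hW.2.2 p.1 p.2
    rw [abs_of_nonneg (mul_nonneg this.1 this.1)]; nlinarith [this.1, this.2])

lemma isGraphon_comp {W : ℝ → ℝ → ℝ} (hW : IsGraphon W) {σ : ℝ → ℝ} (hσ : IsMPSelf σ) :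
    IsGraphon (fun x y => W (σ x) (σ y)) := by
  refine ⟨fun x y => hW.1 _ _, ?_, fun x y => hW.2.2 _ _⟩
  exact hW.2.1.comp (mp_prod hσ).measurable

lemma int_comp {f : ℝ × ℝ → ℝ} (hf : Measurable f) {σ : ℝ → ℝ} (hσ : IsMPSelf σ) :
    ∫ p, f (σ p.1, σ p.2) ∂(mu0.prod mu0) = ∫ p, f p ∂(mu0.prod mu0) := by
  conv_rhs => rw [← (mp_prod hσ).map_eq]
  rw [integral_map (mp_prod hσ).measurable.aemeasurable hf.aestronglyMeasurable]

/-- the quadratic entropy does not decrease -/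
lemma quad_le {W W' : ℝ → ℝ → ℝ} (hW : IsGraphon W) (hW' : IsGraphon W') (h : deltaCut W W' = 0) :
    ∫ p, 4 * (W' p.1 p.2 * (1 - W' p.1 p.2)) ∂(mu0.prod mu0) ≤ ∫ p, 4 * (W p.1 p.2 * (1 - W p.1 p.2)) ∂(mu0.prod mu0) := by
  refine le_of_forall_pos_le_add fun η hη => ?_
  obtain ⟨ε, hε, H⟩ := PairOK.all (int_W hW) (η/16) (by positivity)
  obtain ⟨σ₁, σ₂, h1, h2, hcut⟩ := exists_of_deltaCut_lt (W₁ := W) (W₂ := W') (δ := min ε (η/16)) (by rw [h]; positivity)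
  have g1 := isGraphon_comp hW h1
  have g2 := isGraphon_comp hW' h2
  have hb : ∀ x y, |W (σ₁ x) (σ₁ y) - W' (σ₂ x) (σ₂ y)| ≤ 1 := fun x y => by
    have a := hW.2.2 (σ₁ x) (σ₁ y)
    have b := hW'.2.2 (σ₂ x) (σ₂ y)
    rw [abs_le]; constructor <;> linarith [a.1, a.2, b.1, b.2]
  have hcl := cutLe_of_cutNorm 1 hb hcut.le
  have k1 := H (fun x y => W (σ₁ x) (σ₁ y) - W' (σ₂ x) (σ₂ y)) (g1.2.1.sub g2.2.1) hb σ₁ h1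
    (fun S T hS hT => (hcl S T hS hT).trans (min_le_left _ _))
  have k2 := (hcl univ univ MeasurableSet.univ MeasurableSet.univ).trans (min_le_right _ _)
  simp only [univ_prod_univ, Measure.restrict_univ] at k2
  rw [integral_sub (int_W g1) (int_W g2), int_comp (f := fun p => W p.1 p.2) hW.2.1 h1,
    int_comp (f := fun p => W' p.1 p.2) hW'.2.1 h2] at k2
  have i12 : Integrable (fun p : ℝ × ℝ => (W (σ₁ p.1) (σ₁ p.2) - W' (σ₂ p.1) (σ₂ p.2)) * W (σ₁ p.1) (σ₁ p.2)) (mu0.prod mu0) :=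
    pair_integrable (f := fun p => W p.1 p.2) (D := fun x y => W (σ₁ x) (σ₁ y) - W' (σ₂ x) (σ₂ y)) (int_W hW) (g1.2.1.sub g2.2.1) hb h1
  have k3 : ∫ p, (W p.1 p.2 * W p.1 p.2) ∂(mu0.prod mu0) - ∫ p, (W' p.1 p.2 * W' p.1 p.2) ∂(mu0.prod mu0) ≤
      2 * ∫ p, (W (σ₁ p.1) (σ₁ p.2) - W' (σ₂ p.1) (σ₂ p.2)) * W (σ₁ p.1) (σ₁ p.2) ∂(mu0.prod mu0) := by
    rw [← int_comp (f := fun p => W p.1 p.2 * W p.1 p.2) (hW.2.1.mul hW.2.1) h1,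
      ← int_comp (f := fun p => W' p.1 p.2 * W' p.1 p.2) (hW'.2.1.mul hW'.2.1) h2,
      ← integral_sub (int_W2 g1) (int_W2 g2), ← integral_const_mul]
    refine integral_mono ((int_W2 g1).sub (int_W2 g2)) (i12.const_mul 2) fun p => ?_
    simp only [Pi.sub_apply]
    nlinarith [sq_nonneg (W (σ₁ p.1) (σ₁ p.2) - W' (σ₂ p.1) (σ₂ p.2))]
  have e : ∀ {V : ℝ → ℝ → ℝ}, IsGraphon V → ∫ p, 4 * (V p.1 p.2 * (1 - V p.1 p.2)) ∂(mu0.prod mu0) =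
      4 * (∫ p, V p.1 p.2 ∂(mu0.prod mu0) - ∫ p, (V p.1 p.2 * V p.1 p.2) ∂(mu0.prod mu0)) := by
    intro V hV
    rw [integral_const_mul, ← integral_sub (int_W hV) (int_W2 hV)]
    congr 2; ext p; ring
  rw [e hW, e hW']
  have k4 := le_abs_self (∫ p, (W (σ₁ p.1) (σ₁ p.2) - W' (σ₂ p.1) (σ₂ p.2)) * W (σ₁ p.1) (σ₁ p.2) ∂(mu0.prod mu0))
  have k5 := (abs_le.1 k2).1
  linarith

lemma quad_le_ind {W : ℝ → ℝ → ℝ} (hW : IsGraphon W) (p : ℝ × ℝ) :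
    4 * (W p.1 p.2 * (1 - W p.1 p.2)) ≤ (randS W).indicator (fun _ => (1:ℝ)) p := by
  by_cases hp : p ∈ randS W
  · rw [indicator_of_mem hp]; nlinarith [sq_nonneg (2 * W p.1 p.2 - 1)]
  · rw [indicator_of_notMem hp]
    have h1 := hW.2.2 p.1 p.2
    by_cases h0 : W p.1 p.2 = 0
    · simp [h0]
    by_cases h2 : W p.1 p.2 = 1
    · simp [h2]
    exact absurd ⟨lt_of_le_of_ne h1.1 (Ne.symm h0), lt_of_le_of_ne h1.2 h2⟩ hp

lemma int_quad {W : ℝ → ℝ → ℝ} (hW : IsGraphon W) :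
    Integrable (fun p : ℝ × ℝ => 4 * (W p.1 p.2 * (1 - W p.1 p.2))) (mu0.prod mu0) := by
  have := ((int_W hW).sub (int_W2 hW)).const_mul 4
  refine this.congr (Eventually.of_forall fun p => ?_)
  simp only [Pi.sub_apply]; ring

lemma ent_of_quad {W : ℝ → ℝ → ℝ} (hW : IsGraphon W) {s : ℝ} (h1 : (mu0.prod mu0).real (randS W) ≤ s)
    (h2 : s ≤ ∫ p, 4 * (W p.1 p.2 * (1 - W p.1 p.2)) ∂(mu0.prod mu0)) : graphonEnt W = s := by
  have hR := measurableSet_randS hW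
  have e1 : ∫ p, (randS W).indicator (fun _ => (1:ℝ)) p ∂(mu0.prod mu0) = (mu0.prod mu0).real (randS W) := by
    rw [integral_indicator_const _ hR]; simp
  have h3 : ∫ p, 4 * (W p.1 p.2 * (1 - W p.1 p.2)) ∂(mu0.prod mu0) ≤ (mu0.prod mu0).real (randS W) := by
    rw [← e1]; exact integral_mono (int_quad hW) (int_ind hR) (quad_le_ind hW)
  have h4 : ∫ p, ((randS W).indicator (fun _ => (1:ℝ)) p - 4 * (W p.1 p.2 * (1 - W p.1 p.2))) ∂(mu0.prod mu0) = 0 := by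
    rw [integral_sub (int_ind hR) (int_quad hW), e1]; linarith
  rw [integral_eq_zero_iff_of_nonneg (fun p => sub_nonneg.2 (quad_le_ind hW p)) ((int_ind hR).sub (int_quad hW))] at h4
  have h5 : graphonEnt W = (mu0.prod mu0).real (randS W) := by
    rw [graphonEnt_eq hW, ← e1]
    refine integral_congr_ae ?_
    filter_upwards [h4] with p hp
    simp only [Pi.zero_apply] at hp
    by_cases hm : p ∈ randS W
    · rw [indicator_of_mem hm] at hp ⊢
      rw [binEnt_eq_one]
      have : (2 * W p.1 p.2 - 1)^2 = 0 := by linarith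
      have := pow_eq_zero_iff (two_ne_zero) |>.1 this
      linarith
    · rw [indicator_of_notMem hm] at hp ⊢
      have : W p.1 p.2 * (1 - W p.1 p.2) = 0 := by linarith
      rcases mul_eq_zero.1 this with h | h
      · rw [h, binEnt_zero]
      · rw [show W p.1 p.2 = 1 by linarith, binEnt_one]
  linarith

lemma quad_Rset {r : ℕ} (hr : 1 ≤ r) {W' : ℝ → ℝ → ℝ} (h : W' ∈ Rset r) :
    ∫ p, 4 * (W' p.1 p.2 * (1 - W' p.1 p.2)) ∂(mu0.prod mu0) = 1 - 1/(r:ℝ) := by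
  haveI : NeZero r := ⟨by omega⟩
  obtain ⟨hG, hE, hO⟩ := h
  obtain ⟨m1, m2⟩ := measure_colour_ne mu0 hr (qf r) (measurable_qf r) (mu0_qf r)
  rw [← m2]
  have e1 : ∫ p, ({p : ℝ × ℝ | qf r p.1 ≠ qf r p.2}).indicator (fun _ => (1:ℝ)) p ∂(mu0.prod mu0) =
      (mu0.prod mu0).real {p : ℝ × ℝ | qf r p.1 ≠ qf r p.2} := by
    rw [integral_indicator_const _ m1]; simp
  rw [← e1]
  refine integral_congr_ae ?_
  filter_upwards [mu0_ae2] with p hp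
  have hiff : p ∈ Er r ↔ qf r p.1 ≠ qf r p.2 := by
    simp only [Er, mem_iUnion]
    constructor
    · rintro ⟨i, j, hij, hp'⟩
      rw [Set.mem_prod] at hp'
      rwa [(qf_eq_iff hp.1 i).2 hp'.1, (qf_eq_iff hp.2 j).2 hp'.2]
    · intro hne
      exact ⟨qf r p.1, qf r p.2, hne, (qf_eq_iff hp.1 _).1 rfl, (qf_eq_iff hp.2 _).1 rfl⟩
  by_cases hm : p ∈ Er r
  · rw [indicator_of_mem (hiff.1 hm), hE p hm]; norm_num
  · rw [indicator_of_notMem (fun hx => hm (hiff.2 hx))]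
    rcases hO p ⟨⟨Ioc_subset_Icc_self hp.1, Ioc_subset_Icc_self hp.2⟩, hm⟩ with h | h <;> rw [h] <;> norm_num

lemma ent_back {Q : GraphClass} (hQ : IsHereditary Q) {r : ℕ} (hr : 1 ≤ r) (hng : ¬ Good Q (r+1))
    {W W' : ℝ → ℝ → ℝ} (hWL : W ∈ limitSet Q) (hW' : W' ∈ Rset r) (h : deltaCut W W' = 0) :
    graphonEnt W = 1 - 1/(r:ℝ) :=
  ent_of_quad hWL.1 (randS_le hQ hr hng hWL) (quad_Rset hr hW' ▸ quad_le hWL.1 hW'.1 h)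

lemma ent_back_inf {W W' : ℝ → ℝ → ℝ} (hW : IsGraphon W) (hW' : IsGraphon W')
    (hh : ∀ x ∈ Set.Icc (0:ℝ) 1, ∀ y ∈ Set.Icc (0:ℝ) 1, W' x y = 1/2) (h : deltaCut W W' = 0) :
    graphonEnt W = 1 := by
  refine ent_of_quad hW measureReal_le_one ?_
  refine le_trans (le_of_eq ?_) (quad_le hW hW' h)
  have : ∫ p, 4 * (W' p.1 p.2 * (1 - W' p.1 p.2)) ∂(mu0.prod mu0) = ∫ p, (1:ℝ) ∂(mu0.prod mu0) := by
    refine integral_congr_ae ?_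
    filter_upwards [mu0_ae2] with p hp
    rw [hh _ (Ioc_subset_Icc_self hp.1) _ (Ioc_subset_Icc_self hp.2)]; norm_num
  rw [this]; simp

lemma deltaCut_self (W : ℝ → ℝ → ℝ) : deltaCut W W = 0 :=
  deltaCut_zero isMPSelf_id (Eventually.of_forall fun _ => rfl)

lemma sSup_ent {Q : GraphClass} {s : ℝ} (h1 : ∃ W ∈ limitSet Q, graphonEnt W = s)
    (h2 : ∀ W ∈ limitSet Q, graphonEnt W ≤ s) : sSup (graphonEnt '' limitSet Q) = s := by
  obtain ⟨W, hW, rfl⟩ := h1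
  refine IsGreatest.csSup_eq ⟨⟨W, hW, rfl⟩, ?_⟩
  rintro _ ⟨V, hV, rfl⟩
  exact h2 V hV

/-- Theorem 1.6: for a hereditary class `Q` there is an `r` (the
colouring number, possibly `∞`) with `max_{W ∈ Q̂} Ent(W) = 1 - 1/r`, attained exactly
at the graph limits representable by graphons in `R_r`, and `|Q_n| = 2^{(1-1/r+o(1)) C(n,2)}`. -/
theorem stmt16 (Q : GraphClass) (hQ : IsHereditary Q) (hne : (limitSet Q).Nonempty) :
    ∃ r : ℕ∞, 1 ≤ r ∧
      (∃ W ∈ limitSet Q, graphonEnt W = oneSubInv r) ∧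
      sSup (graphonEnt '' limitSet Q) = oneSubInv r ∧
      (∀ W ∈ limitSet Q,
        (graphonEnt W = oneSubInv r ↔ ∃ W' ∈ RsetE r, deltaCut W W' = 0)) ∧
      (∀ ε : ℝ, 0 < ε → ∃ N : ℕ, ∀ n ≥ N,
        (2 : ℝ) ^ ((oneSubInv r - ε) * choose2 n) ≤ (Nat.card ↥(Q n) : ℝ) ∧
          (Nat.card ↥(Q n) : ℝ) ≤ (2 : ℝ) ^ ((oneSubInv r + ε) * choose2 n)) := by
  rcases good_dichotomy (good_one hQ hne) with hall | ⟨r, hr, hg, hng⟩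
  · have ht : oneSubInv ⊤ = 1 := rfl
    have hex : ∃ W ∈ limitSet Q, graphonEnt W = 1 :=
      ⟨_, exists_limit_infinite hall, ent_back_inf (exists_limit_infinite hall).1 (exists_limit_infinite hall).1
        (fun _ _ _ _ => rfl) (deltaCut_self _)⟩
    refine ⟨⊤, le_top, ?_⟩
    rw [ht]
    refine ⟨hex, sSup_ent hex fun W hW => ent_le_one hW.1, fun W hW => ⟨fun he => ?_, ?_⟩, ?_⟩
    · exact ⟨_, ⟨(exists_limit_infinite hall).1, fun _ _ _ _ => rfl⟩, ent_forward_inf hW.1 he⟩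
    · rintro ⟨W', ⟨h1, h2⟩, h3⟩
      exact ent_back_inf hW.1 h1 h2 h3
    · intro ε hε
      exact count_infinite hall ε hε
  · have ht : oneSubInv (r : ℕ∞) = 1 - 1 / (r:ℝ) := rfl
    have hex : ∃ W ∈ limitSet Q, graphonEnt W = 1 - 1 / (r:ℝ) := by
      obtain ⟨W', h1, h2⟩ := exists_limit_finite hr hg
      exact ⟨W', h1, ent_back hQ hr hng h1 h2 (deltaCut_self _)⟩
    refine ⟨(r : ℕ∞), by exact_mod_cast hr, ?_⟩
    rw [ht]
    refine ⟨hex, sSup_ent hex fun W hW => (ent_le_rand hW.1).trans (randS_le hQ hr hng hW),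
      fun W hW => ⟨fun he => ent_forward hQ hr hng hW he, ?_⟩, ?_⟩
    · rintro ⟨W', h1, h3⟩
      exact ent_back hQ hr hng hW h1 h3
    · intro ε hε
      obtain ⟨N1, h1⟩ := count_lower_finite hr hg ε hε
      obtain ⟨N2, h2⟩ := count_upper hQ hr hng ε hε
      exact ⟨max N1 N2, fun n hn => ⟨h1 n (le_trans (le_max_left _ _) hn), h2 n (le_trans (le_max_right _ _) hn)⟩⟩

end
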